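/- Let 0 < p < 1 and let g, f_1, ..., f_n be functions in the multiplier algebra M(Q_p). If |g(z)| ≤ (Σ_{j=1}^n |f_j(z)|^2)^{1/2} for all z in the unit disk D, then there exist functions g_1, ..., g_n in M(Q_p) such that Σ_{j=1}^n f_j(z) g_j(z) = g(z)^3 for all z ∈ D. -/

import Mathlib

open MeasureTheory Complex Metric Set Filter
open scoped ENNReal Real

noncomputable section

/-- The open unit disk in `ℂ`. -/
def unitDisk : Set ℂ := Metric.ball 0 1

/-- The Möbius automorphism `φ_a(z) = (a - z)/(1 - ā z)` of the unit disk. -/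
def moebius (a z : ℂ) : ℂ := (a - z) / (1 - (starRingEnd ℂ) a * z)

/-- Membership in `H^∞(𝔻)`: bounded analytic functions on the unit disk. -/
def MemHinf (f : ℂ → ℂ) : Prop :=
  DifferentiableOn ℂ f unitDisk ∧ ∃ M : ℝ, ∀ z ∈ unitDisk, ‖f z‖ ≤ M

/-- The integral `∫_𝔻 |f'(z)|² (1 - |φ_a(z)|²)^p dA(z)`. -/
def qpIntegral (p : ℝ) (f : ℂ → ℂ) (a : ℂ) : ℝ≥0∞ :=
  ∫⁻ z in unitDisk, ENNReal.ofReal (‖deriv f z‖ ^ 2 * (1 - ‖moebius a z‖ ^ 2) ^ p)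

/-- Finiteness of the `H²`-part of the `Q_p` norm: the integrals of `|f|²` over circles of
radius `r < 1` are uniformly bounded (equivalently, the boundary integral `∫ |f|² dσ`
is finite). -/
def h2Bounded (f : ℂ → ℂ) : Prop :=
  ∃ M : ℝ, ∀ r ∈ Set.Ico (0 : ℝ) 1,
    (∫ t in (0 : ℝ)..(2 * Real.pi), ‖f ((r : ℂ) * Complex.exp (Complex.I * t))‖ ^ 2) ≤ M

/-- Membership in the space `Q_p`: `f` is analytic on the unit disk and
`‖f‖_{Q_p}² = ∫_𝕋 |f|² dσ + sup_{a ∈ 𝔻} ∫_𝔻 |f'(z)|² (1 - |φ_a(z)|²)^p dA(z) < ∞`. -/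
def MemQp (p : ℝ) (f : ℂ → ℂ) : Prop :=
  DifferentiableOn ℂ f unitDisk ∧ h2Bounded f ∧
    ∃ C : ℝ, ∀ a ∈ unitDisk, qpIntegral p f a ≤ ENNReal.ofReal C

/-- The multiplier algebra `M(Q_p)`. -/
def MemMQp (p : ℝ) (φ : ℂ → ℂ) : Prop :=
  MemQp p φ ∧ ∀ f : ℂ → ℂ, MemQp p f → MemQp p (fun z => φ z * f z)

/-- The Carleson square `S(I)` over the arc of the unit circle centered at `e^{iθ}` with
normalized length `h`. -/
def carlesonBox (θ h : ℝ) : Set ℂ :=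
  {z : ℂ | 1 - h < ‖z‖ ∧ ‖z‖ < 1 ∧
    ∃ t : ℝ, |t - θ| < Real.pi * h ∧ z = (‖z‖ : ℂ) * Complex.exp (Complex.I * t)}

/-- A measure `μ` on the unit disk is a `p`-Carleson measure if `μ(S(I)) ≤ C |I|^p`
for every arc `I` of the unit circle. -/
def IsPCarleson (p : ℝ) (μ : Measure ℂ) : Prop :=
  ∃ C : ℝ, ∀ θ : ℝ, ∀ h ∈ Set.Ioc (0 : ℝ) 1,
    μ (carlesonBox θ h) ≤ ENNReal.ofReal (C * h ^ p)

/-- The `p`-Carleson constant `‖μ‖_p = sup_{I ⊂ 𝕋} μ(S(I))/|I|^p`. -/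
def pCarlesonNorm (p : ℝ) (μ : Measure ℂ) : ℝ≥0∞ :=
  ⨆ (θ : ℝ) (h : ℝ) (_ : h ∈ Set.Ioc (0 : ℝ) 1),
    μ (carlesonBox θ h) / ENNReal.ofReal (h ^ p)

/-- The measure `w(z) dA(z)` on the unit disk. -/
def diskMeasure (w : ℂ → ℝ) : Measure ℂ :=
  (volume.restrict unitDisk).withDensity fun z => ENNReal.ofReal (w z)

/-- The Wirtinger derivative `∂F/∂z`. -/
def wderiv (F : ℂ → ℂ) (z : ℂ) : ℂ :=
  (fderiv ℝ F z 1 - Complex.I * fderiv ℝ F z Complex.I) / 2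

/-- The Wirtinger derivative `∂F/∂z̄`. -/
def wderivBar (F : ℂ → ℂ) (z : ℂ) : ℂ :=
  (fderiv ℝ F z 1 + Complex.I * fderiv ℝ F z Complex.I) / 2

/-- The squared length of the (real) gradient: `|∇F|² = 2|∂F/∂z|² + 2|∂F/∂z̄|²`. -/
def gradSq (F : ℂ → ℂ) (z : ℂ) : ℝ :=
  2 * ‖wderiv F z‖ ^ 2 + 2 * ‖wderivBar F z‖ ^ 2

/-- The arc of the unit circle centered at `e^{iθ}` of normalized length `h`, parametrized
by angle. -/
def arcInterval (θ h : ℝ) : Set ℝ := Set.Ioo (θ - Real.pi * h) (θ + Real.pi * h)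

/-- The double integral `∫_I ∫_I |f(ξ) - f(η)|²/|ξ - η|^{2-p} |dξ| |dη|` over the arc
centered at `e^{iθ}` of normalized length `h`. -/
def qpTDouble (p : ℝ) (f : ℝ → ℂ) (θ h : ℝ) : ℝ≥0∞ :=
  ∫⁻ s in arcInterval θ h, ∫⁻ u in arcInterval θ h,
    ENNReal.ofReal (‖f s - f u‖ ^ 2 /
      ‖Complex.exp (Complex.I * s) - Complex.exp (Complex.I * u)‖ ^ (2 - p))

/-- The integral `∫_𝕋 |f|² dσ` of a function on the unit circle (parametrized by angle). -/
def l2Circle (f : ℝ → ℂ) : ℝ≥0∞ :=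
  ∫⁻ t in Set.Ioc (0 : ℝ) (2 * Real.pi), (‖f t‖₊ : ℝ≥0∞) ^ 2

/-- Membership in `Q_p(𝕋)` for a function on the unit circle (parametrized by angle):
`f ∈ L²(𝕋)` and `sup_{I ⊂ 𝕋} |I|^{-p} ∫_I ∫_I |f(ξ) - f(η)|²/|ξ - η|^{2-p} |dξ||dη| < ∞`. -/
def MemQpT (p : ℝ) (f : ℝ → ℂ) : Prop :=
  Function.Periodic f (2 * Real.pi) ∧ Measurable f ∧ l2Circle f < ⊤ ∧
    ∃ C : ℝ, ∀ θ : ℝ, ∀ h ∈ Set.Ioc (0 : ℝ) 1, qpTDouble p f θ h ≤ ENNReal.ofReal (C * h ^ p)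

/-- The square of the `Q_p` norm of an analytic function `f` on the disk with boundary
values `fb`. -/
def qpNormSq (p : ℝ) (f : ℂ → ℂ) (fb : ℝ → ℂ) : ℝ≥0∞ :=
  l2Circle fb + ⨆ a ∈ unitDisk, qpIntegral p f a

/-- The square of the `Q_p(𝕋)` norm of a function on the unit circle. -/
def qpTNormSq (p : ℝ) (fb : ℝ → ℂ) : ℝ≥0∞ :=
  l2Circle fb + ⨆ (θ : ℝ) (h : ℝ) (_ : h ∈ Set.Ioc (0 : ℝ) 1),
    qpTDouble p fb θ h / ENNReal.ofReal (h ^ p)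

/-- `fb` is the a.e. radial boundary-value function of `F`. -/
def RadialLimit (F : ℂ → ℂ) (fb : ℝ → ℂ) : Prop :=
  ∀ᵐ t : ℝ, Filter.Tendsto (fun r : ℝ => F ((r : ℂ) * Complex.exp (Complex.I * t)))
    (nhdsWithin 1 (Set.Iio 1)) (nhds (fb t))

/-- The Poisson integral (harmonic extension) of a function on the unit circle. -/
def poissonExt (f : ℝ → ℂ) (z : ℂ) : ℂ :=
  (1 / (2 * Real.pi)) • ∫ t in (0 : ℝ)..(2 * Real.pi),
    ((1 - ‖z‖ ^ 2) / ‖Complex.exp (Complex.I * t) - z‖ ^ 2) • f t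

open scoped ComplexConjugate

/-! ### Moebius maps -/

theorem mem_D {z : ℂ} : z ∈ unitDisk ↔ ‖z‖ < 1 := by
  simp [unitDisk]

theorem isOpen_D : IsOpen unitDisk := Metric.isOpen_ball

theorem meas_D : MeasurableSet unitDisk := isOpen_D.measurableSet

theorem wt_pos {z : ℂ} (hz : z ∈ unitDisk) : 0 < 1 - ‖z‖ ^ 2 := by
  have := mem_D.1 hz
  nlinarith [norm_nonneg z]

theorem norm_id (a z : ℂ) :
    ‖1 - conj a * z‖ ^ 2 - ‖a - z‖ ^ 2 = (1 - ‖a‖ ^ 2) * (1 - ‖z‖ ^ 2) := by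
  simp only [Complex.sq_norm, Complex.normSq_apply]
  simp
  ring

theorem one_sub_norm_le {a z : ℂ} (ha : a ∈ unitDisk) : 1 - ‖z‖ ≤ ‖1 - conj a * z‖ := by
  have h1 := norm_sub_norm_le (1 : ℂ) (conj a * z)
  rw [norm_mul, RCLike.norm_conj, norm_one] at h1
  have := mem_D.1 ha
  nlinarith [norm_nonneg z, norm_nonneg a]

theorem one_sub_norm_le' {a z : ℂ} (hz : z ∈ unitDisk) : 1 - ‖a‖ ≤ ‖1 - conj a * z‖ := by
  have h1 := norm_sub_norm_le (1 : ℂ) (conj a * z)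
  rw [norm_mul, RCLike.norm_conj, norm_one] at h1
  have := mem_D.1 hz
  nlinarith [norm_nonneg z, norm_nonneg a]

theorem den_pos {a z : ℂ} (ha : a ∈ unitDisk) (hz : z ∈ unitDisk) : 0 < ‖1 - conj a * z‖ := by
  have := one_sub_norm_le (z := z) ha
  have := mem_D.1 hz
  linarith

theorem den_ne {a z : ℂ} (ha : a ∈ unitDisk) (hz : z ∈ unitDisk) : 1 - conj a * z ≠ 0 :=
  norm_pos_iff.1 (den_pos ha hz)

theorem den_le_two {a z : ℂ} (ha : a ∈ unitDisk) (hz : z ∈ unitDisk) : ‖1 - conj a * z‖ ≤ 2 := by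
  have h1 := norm_sub_le (1 : ℂ) (conj a * z)
  rw [norm_mul, RCLike.norm_conj, norm_one] at h1
  have := mem_D.1 hz
  have := mem_D.1 ha
  nlinarith [norm_nonneg z, norm_nonneg a]

theorem den_symm (a z : ℂ) : ‖1 - conj a * z‖ = ‖1 - conj z * a‖ := by
  rw [← RCLike.norm_conj (1 - conj a * z)]
  simp [mul_comm]

theorem sub_le_den {a z : ℂ} (ha : a ∈ unitDisk) (hz : z ∈ unitDisk) :
    ‖a - z‖ ≤ ‖1 - conj a * z‖ := by
  have := norm_id a z
  have h1 := wt_pos ha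
  have h2 := wt_pos hz
  have h3 : 0 < (1 - ‖a‖ ^ 2) * (1 - ‖z‖ ^ 2) := mul_pos h1 h2
  exact abs_le_of_sq_le_sq' (by linarith) (norm_nonneg _) |>.2

theorem wt_le_den {a z : ℂ} (ha : a ∈ unitDisk) (hz : z ∈ unitDisk) :
    1 - ‖z‖ ^ 2 ≤ 2 * ‖1 - conj a * z‖ := by
  have := one_sub_norm_le (z := z) ha
  have := mem_D.1 hz
  nlinarith [norm_nonneg z]

theorem wt_mul_le_den_sq {a z : ℂ} :
    (1 - ‖a‖ ^ 2) * (1 - ‖z‖ ^ 2) ≤ ‖1 - conj a * z‖ ^ 2 := by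
  have := norm_id a z
  nlinarith [sq_nonneg ‖a - z‖]

theorem one_sub_moebius {a z : ℂ} (ha : a ∈ unitDisk) (hz : z ∈ unitDisk) :
    1 - ‖moebius a z‖ ^ 2 = (1 - ‖a‖ ^ 2) * (1 - ‖z‖ ^ 2) / ‖1 - conj a * z‖ ^ 2 := by
  have h := den_pos ha hz
  rw [moebius, norm_div, div_pow, eq_div_iff (by positivity), ← norm_id, sub_mul, one_mul,
    div_mul_cancel₀ _ (by positivity)]

theorem moebius_mem {a z : ℂ} (ha : a ∈ unitDisk) (hz : z ∈ unitDisk) :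
    moebius a z ∈ unitDisk := by
  have h := one_sub_moebius ha hz
  have h1 := wt_pos ha
  have h2 := wt_pos hz
  have h3 := den_pos ha hz
  have h4 : 0 < 1 - ‖moebius a z‖ ^ 2 := by rw [h]; positivity
  rw [mem_D]
  nlinarith [norm_nonneg (moebius a z)]

theorem wt_ne {a : ℂ} (ha : a ∈ unitDisk) : 1 - conj a * a ≠ 0 := den_ne ha ha

theorem moebius_den {a z w : ℂ} (ha : a ∈ unitDisk) (hz : z ∈ unitDisk) (hw : w ∈ unitDisk) :
    1 - conj (moebius a w) * moebius a z =
      (1 - conj a * a) * (1 - conj w * z) / ((1 - a * conj w) * (1 - conj a * z)) := by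
  have h1 := den_ne ha hz
  have h2 : 1 - a * conj w ≠ 0 := by
    have := den_ne hw ha
    rwa [mul_comm] at this
  simp only [moebius, map_div₀, map_sub, map_mul, map_one, Complex.conj_conj]
  rw [div_mul_div_comm, eq_div_iff (mul_ne_zero h2 h1), sub_mul,
    div_mul_cancel₀ _ (mul_ne_zero h2 h1)]
  ring

theorem moebius_invol {a z : ℂ} (ha : a ∈ unitDisk) (hz : z ∈ unitDisk) :
    moebius a (moebius a z) = z := by
  have h1 := den_ne ha hz
  have h2 := wt_ne ha
  have h3 : 1 - conj a * ((a - z) / (1 - conj a * z)) = (1 - conj a * a) / (1 - conj a * z) := by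
    rw [eq_div_iff h1, sub_mul, mul_assoc, div_mul_cancel₀ _ h1]
    ring
  rw [moebius, moebius, h3, div_eq_iff (div_ne_zero h2 h1), ← mul_div_assoc, eq_div_iff h1,
    sub_mul, div_mul_cancel₀ _ h1]
  ring

theorem moebius_zero (a : ℂ) : moebius a 0 = a := by simp [moebius]

theorem norm_wt {a : ℂ} (ha : a ∈ unitDisk) : ‖1 - conj a * a‖ = 1 - ‖a‖ ^ 2 := by
  rw [Complex.conj_mul', ← Complex.ofReal_pow, ← Complex.ofReal_one, ← Complex.ofReal_sub,
    Complex.norm_real, Real.norm_of_nonneg (wt_pos ha).le]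

theorem moebius_hasDeriv {a z : ℂ} (ha : a ∈ unitDisk) (hz : z ∈ unitDisk) :
    HasDerivAt (moebius a) (-(1 - conj a * a) / (1 - conj a * z) ^ 2) z := by
  have h1 := den_ne ha hz
  have h2 : HasDerivAt (fun z => a - z) (-1) z := by
    simpa using (hasDerivAt_id z).const_sub a
  have h3 : HasDerivAt (fun z => 1 - conj a * z) (-conj a) z := by
    simpa using ((hasDerivAt_id z).const_mul (conj a)).const_sub 1
  refine (h2.div h3 h1).congr_deriv ?_
  congr 1
  ring

/-- `|φ_a'(z)|` -/
def mder (a z : ℂ) : ℝ := (1 - ‖a‖ ^ 2) / ‖1 - conj a * z‖ ^ 2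

theorem mder_pos {a z : ℂ} (ha : a ∈ unitDisk) (hz : z ∈ unitDisk) : 0 < mder a z := by
  have := wt_pos ha
  have := den_pos ha hz
  unfold mder
  positivity

theorem norm_mder {a z : ℂ} (ha : a ∈ unitDisk) :
    ‖-(1 - conj a * a) / (1 - conj a * z) ^ 2‖ = mder a z := by
  rw [norm_div, norm_neg, norm_wt ha, norm_pow, mder]

theorem wt_moebius {a z : ℂ} (ha : a ∈ unitDisk) (hz : z ∈ unitDisk) :
    1 - ‖moebius a z‖ ^ 2 = (1 - ‖z‖ ^ 2) * mder a z := by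
  rw [one_sub_moebius ha hz, mder]; ring

theorem norm_moebius_den {a z w : ℂ} (ha : a ∈ unitDisk) (hz : z ∈ unitDisk)
    (hw : w ∈ unitDisk) :
    ‖1 - conj (moebius a w) * moebius a z‖ ^ 2 =
      ‖1 - conj w * z‖ ^ 2 * mder a z * mder a w := by
  rw [moebius_den ha hz hw, norm_div, norm_mul, norm_mul, norm_wt ha, mder, mder]
  have h : ‖1 - a * conj w‖ = ‖1 - conj a * w‖ := by
    rw [den_symm, mul_comm]
  rw [h]
  have := den_pos ha hz
  have := den_pos ha hw
  field_simp

theorem mder_moebius {a z : ℂ} (ha : a ∈ unitDisk) (hz : z ∈ unitDisk) :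
    mder a (moebius a z) * mder a z = 1 := by
  have h := wt_moebius ha (moebius_mem ha hz)
  rw [moebius_invol ha hz, wt_moebius ha hz] at h
  have := wt_pos hz
  have h3 : (1 - ‖z‖ ^ 2) * (mder a (moebius a z) * mder a z) = (1 - ‖z‖ ^ 2) * 1 := by linarith
  exact mul_left_cancel₀ this.ne' h3

theorem moebius_image {a : ℂ} (ha : a ∈ unitDisk) : moebius a '' unitDisk = unitDisk := by
  ext z
  constructor
  · rintro ⟨w, hw, rfl⟩
    exact moebius_mem ha hw
  · intro hz
    exact ⟨_, moebius_mem ha hz, moebius_invol ha hz⟩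

theorem moebius_inj {a : ℂ} (ha : a ∈ unitDisk) : InjOn (moebius a) unitDisk := by
  intro z hz w hw h
  rw [← moebius_invol ha hz, h, moebius_invol ha hw]

theorem lintegral_moebius {a : ℂ} (ha : a ∈ unitDisk) (Φ : ℂ → ℝ≥0∞) :
    ∫⁻ z in unitDisk, Φ z =
      ∫⁻ z in unitDisk, ENNReal.ofReal (mder a z ^ 2) * Φ (moebius a z) := by
  conv_lhs => rw [← moebius_image ha]
  rw [lintegral_image_eq_lintegral_abs_det_fderiv_mul volume meas_D
    (fun z hz => ((moebius_hasDeriv ha hz).hasFDerivAt.restrictScalars ℝ).hasFDerivWithinAt)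
    (moebius_inj ha)]
  refine setLIntegral_congr_fun meas_D fun z hz => ?_
  congr 2
  rw [← norm_mder (z := z) ha, ← Complex.normSq_eq_norm_sq]
  set c := -(1 - conj a * a) / (1 - conj a * z) ^ 2
  rw [ContinuousLinearMap.det, ← LinearMap.det_toMatrix Complex.basisOneI, Matrix.det_fin_two]
  simp [LinearMap.toMatrix_apply, Complex.normSq_apply]
  nlinarith [sq_nonneg c.re, sq_nonneg c.im]

theorem measurable_moebius (a : ℂ) : Measurable (moebius a) := by
  unfold moebius
  fun_prop

theorem measurable_mder (a : ℂ) : Measurable (mder a) := by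
  unfold mder
  fun_prop

theorem lintegral_rot {c : ℂ} (hc : ‖c‖ = 1) {Φ : ℂ → ℝ≥0∞} (hΦ : Measurable Φ) :
    ∫⁻ v in unitDisk, Φ v = ∫⁻ v in unitDisk, Φ (c * v) := by
  let e := rotation ⟨c, by simpa [Submonoid.unitSphere] using hc⟩
  have h := (e.measurePreserving).setLIntegral_comp_preimage (s := unitDisk) meas_D hΦ
  rw [← h]
  have h2 : (⇑e) ⁻¹' unitDisk = unitDisk := by
    ext v
    simp [mem_D]
  rw [h2]
  rfl

theorem le_of_sq_le_sq_nn {x y : ℝ} (h : x ^ 2 ≤ y ^ 2) (hy : 0 ≤ y) : x ≤ y :=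
  (abs_le_of_sq_le_sq' h hy).2

theorem polar_lower {t ρ θ : ℝ} (ht : t ∈ Set.Ico (0 : ℝ) 1) (hρ : ρ ∈ Set.Ioo (0 : ℝ) 1)
    (hθ : θ ∈ Set.Ioo (-π) π) :
    |θ| / (2 * π) ≤ ‖1 - conj ((ρ : ℂ) * (Real.cos θ + Real.sin θ * I)) * (t : ℂ)‖ := by
  have hpi := Real.pi_pos
  obtain ⟨ht0, ht1⟩ := ht
  obtain ⟨hρ0, hρ1⟩ := hρ
  have habs : |θ| ≤ π := abs_le.2 ⟨hθ.1.le, hθ.2.le⟩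
  refine le_of_sq_le_sq_nn ?_ (norm_nonneg _)
  have e : ‖1 - conj ((ρ : ℂ) * (Real.cos θ + Real.sin θ * I)) * (t : ℂ)‖ ^ 2
      = (1 - ρ * t) ^ 2 + 2 * (ρ * t) * (1 - Real.cos θ) := by
    rw [Complex.sq_norm, Complex.normSq_apply]
    simp
    simp only [← Complex.ofReal_cos, ← Complex.ofReal_sin, Complex.ofReal_re, Complex.ofReal_im]
    have := Real.sin_sq_add_cos_sq θ
    ring_nf
    linear_combination (ρ ^ 2 * t ^ 2) * this
  rw [e]
  have hc := Real.cos_le_one_sub_mul_cos_sq habs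
  have hcos : 2 / π ^ 2 * θ ^ 2 ≤ 1 - Real.cos θ := by linarith
  have hq : (|θ| / (2 * π)) ^ 2 = θ ^ 2 / (4 * π ^ 2) := by
    rw [div_pow, sq_abs]; ring
  rw [hq]
  have hs : 0 ≤ ρ * t := by positivity
  rcases le_total (ρ * t) (1 / 2) with h | h
  · have h1 : θ ^ 2 / (4 * π ^ 2) ≤ 1 / 4 := by
      rw [div_le_iff₀ (by positivity)]
      have := sq_le_sq' (abs_le.1 habs).1 (abs_le.1 habs).2
      linarith
    have h2 : (1:ℝ) / 4 ≤ (1 - ρ * t) ^ 2 := by nlinarith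
    have h3 : 0 ≤ 1 - Real.cos θ := by linarith [Real.cos_le_one θ]
    nlinarith [mul_nonneg hs h3]
  · have h1 : θ ^ 2 / (4 * π ^ 2) ≤ 2 / π ^ 2 * θ ^ 2 := by
      rw [div_mul_eq_mul_div, div_le_div_iff₀ (by positivity) (by positivity)]
      nlinarith [sq_nonneg θ, sq_nonneg (θ * π)]
    have h3 : 0 ≤ 1 - Real.cos θ := by linarith [Real.cos_le_one θ]
    nlinarith [sq_nonneg (1 - ρ * t)]

theorem lint_radial {β : ℝ} (hβ : β < 1) :
    ∫⁻ ρ in Set.Ioo (0 : ℝ) 1, ENNReal.ofReal ((1 - ρ) ^ (-β)) < ⊤ := by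
  have h : IntervalIntegrable (fun x : ℝ => x ^ (-β)) volume 0 1 :=
    intervalIntegral.intervalIntegrable_rpow' (by linarith)
  have h2 := (h.comp_sub_left 1).symm
  simp only [sub_self, sub_zero] at h2
  rw [intervalIntegrable_iff_integrableOn_Ioo_of_le zero_le_one] at h2
  refine lt_of_le_of_lt ?_ h2.2
  refine lintegral_mono fun x => ?_
  exact Real.ofReal_le_enorm _

theorem lint_ang {y : ℝ} (hy : y < 1) :
    ∫⁻ θ in Set.Ioo (-π) π, ENNReal.ofReal (|θ| ^ (-y)) < ⊤ := by
  have hpi := Real.pi_pos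
  have h : IntervalIntegrable (fun x : ℝ => x ^ (-y)) volume 0 π :=
    intervalIntegral.intervalIntegrable_rpow' (by linarith)
  have h1 : IntervalIntegrable (fun x : ℝ => |x| ^ (-y)) volume 0 π := by
    refine h.congr_ae ?_
    filter_upwards [self_mem_ae_restrict measurableSet_uIoc] with x hx
    rw [Set.uIoc_of_le hpi.le] at hx
    simp only [abs_of_pos hx.1]
  have h2 : IntervalIntegrable (fun x : ℝ => |x| ^ (-y)) volume (-π) 0 := by
    have := (h1.comp_sub_left 0).symm
    simpa using this
  have h3 := h2.trans h1
  rw [intervalIntegrable_iff_integrableOn_Ioo_of_le (by linarith)] at h3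
  refine lt_of_le_of_lt ?_ h3.2
  refine lintegral_mono fun x => ?_
  exact Real.ofReal_le_enorm _

theorem lemR {α b : ℝ} (hα0 : 0 ≤ α) (hα : α < 1) (hb0 : 0 ≤ b) (hb : b < 2 - α) :
    ∃ C : ℝ, 0 ≤ C ∧ ∀ z ∈ unitDisk,
      ∫⁻ v in unitDisk, ENNReal.ofReal ((1 - ‖v‖ ^ 2) ^ (-α) * ‖1 - conj v * z‖ ^ (-b)) ≤
        ENNReal.ofReal C := by
  have hpi := Real.pi_pos
  set y := b / (2 - α) with hy
  set x := b * (1 - α) / (2 - α) with hx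
  have h2α : 0 < 2 - α := by linarith
  have hxy : b = x + y := by rw [hx, hy]; field_simp; ring
  have hy0 : 0 ≤ y := by positivity
  have hy1 : y < 1 := by rw [hy, div_lt_one h2α]; exact hb
  have hx0 : 0 ≤ x := div_nonneg (mul_nonneg hb0 (by linarith)) h2α.le
  have hx1 : α + x < 1 := by
    have : x = y * (1 - α) := by rw [hx, hy]; ring
    rw [this]; nlinarith
  set I1 := ∫⁻ ρ in Set.Ioo (0 : ℝ) 1, ENNReal.ofReal ((1 - ρ) ^ (-(α + x))) with hI1
  set I2 := ∫⁻ θ in Set.Ioo (-π) π, ENNReal.ofReal (|θ| ^ (-y)) with hI2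
  have hI1f : I1 < ⊤ := lint_radial hx1
  have hI2f : I2 < ⊤ := lint_ang hy1
  set K := ENNReal.ofReal ((2 * π) ^ y) with hK
  refine ⟨(K * (I1 * I2)).toReal, ENNReal.toReal_nonneg, fun z hz => ?_⟩
  rw [ENNReal.ofReal_toReal (ENNReal.mul_lt_top ENNReal.ofReal_lt_top
    (ENNReal.mul_lt_top hI1f hI2f)).ne]
  have hmeas : ∀ z : ℂ, Measurable fun v : ℂ =>
      ENNReal.ofReal ((1 - ‖v‖ ^ 2) ^ (-α) * ‖1 - conj v * z‖ ^ (-b)) := by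
    intro z
    have : Measurable fun v : ℂ => conj v := Complex.continuous_conj.measurable
    fun_prop
  obtain ⟨c, hc, hcz⟩ : ∃ c : ℂ, ‖c‖ = 1 ∧ z = c * (‖z‖ : ℂ) := by
    refine ⟨Complex.exp (Complex.arg z * I), by simp [Complex.norm_exp], ?_⟩
    rw [mul_comm, Complex.norm_mul_exp_arg_mul_I]
  rw [lintegral_rot hc (hmeas z)]
  have e1 : ∀ v : ℂ, ENNReal.ofReal ((1 - ‖c * v‖ ^ 2) ^ (-α) * ‖1 - conj (c * v) * z‖ ^ (-b)) =
      ENNReal.ofReal ((1 - ‖v‖ ^ 2) ^ (-α) * ‖1 - conj v * (‖z‖ : ℂ)‖ ^ (-b)) := by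
    intro v
    have : conj (c * v) * z = conj v * (‖z‖ : ℂ) := by
      conv_lhs => rw [hcz]
      have hcc : conj c * c = 1 := by rw [Complex.conj_mul', hc]; simp
      rw [map_mul]
      linear_combination (conj v * (‖z‖ : ℂ)) * hcc
    rw [this, norm_mul, hc, one_mul]
  simp_rw [e1]
  rw [← lintegral_indicator meas_D, ← Complex.lintegral_comp_polarCoord_symm]
  have hbd : ∀ q : ℝ × ℝ, q.2 ≠ 0 → q ∈ polarCoord.target →
      ENNReal.ofReal q.1 • unitDisk.indicator (fun v : ℂ =>
        ENNReal.ofReal ((1 - ‖v‖ ^ 2) ^ (-α) * ‖1 - conj v * (‖z‖ : ℂ)‖ ^ (-b)))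
        (Complex.polarCoord.symm q) ≤
      K * ((Set.Ioo (0 : ℝ) 1).indicator (fun ρ => ENNReal.ofReal ((1 - ρ) ^ (-(α + x)))) q.1 *
        (Set.Ioo (-π) π).indicator (fun θ => ENNReal.ofReal (|θ| ^ (-y))) q.2) := by
    rintro ⟨ρ, θ⟩ h0 hq
    simp only at h0
    simp only [polarCoord_target, Set.mem_prod, Set.mem_Ioi] at hq
    obtain ⟨hρ0, hθ⟩ := hq
    by_cases hρ : ρ < 1
    · have hmem : Complex.polarCoord.symm (ρ, θ) ∈ unitDisk := by
        rw [mem_D, Complex.norm_polarCoord_symm]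
        simpa [abs_of_pos hρ0] using hρ
      rw [Set.indicator_of_mem hmem, Set.indicator_of_mem (show ρ ∈ Set.Ioo (0:ℝ) 1 from ⟨hρ0, hρ⟩),
        Set.indicator_of_mem hθ, Complex.norm_polarCoord_symm, Complex.polarCoord_symm_apply]
      simp only [abs_of_pos hρ0, smul_eq_mul]
      rw [hK, ← ENNReal.ofReal_mul hρ0.le, ← ENNReal.ofReal_mul (by
        apply Real.rpow_nonneg; linarith), ← ENNReal.ofReal_mul (by positivity)]
      apply ENNReal.ofReal_le_ofReal
      have hzz := mem_D.1 hz
      have hlow := polar_lower (t := ‖z‖) ⟨norm_nonneg z, hzz⟩ ⟨hρ0, hρ⟩ hθ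
      have hmem' : (ρ : ℂ) * (Real.cos θ + Real.sin θ * I) ∈ unitDisk := by
        rwa [Complex.polarCoord_symm_apply] at hmem
      have hlow2 := one_sub_norm_le' (a := (ρ : ℂ) * (Real.cos θ + Real.sin θ * I))
        (z := (‖z‖ : ℂ)) (by rw [mem_D]; simpa using hzz)
      have hn : ‖(ρ : ℂ) * (Real.cos θ + Real.sin θ * I)‖ = ρ := by
        have := Complex.norm_polarCoord_symm (ρ, θ)
        rw [Complex.polarCoord_symm_apply] at this
        simpa [abs_of_pos hρ0] using this
      rw [hn] at hlow2
      set d := ‖1 - conj ((ρ : ℂ) * (Real.cos θ + Real.sin θ * I)) * (‖z‖ : ℂ)‖ with hd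
      have h1ρ : 0 < 1 - ρ := by linarith
      have hdpos : 0 < d := by linarith
      have A1 : (1 - ρ ^ 2) ^ (-α) ≤ (1 - ρ) ^ (-α) := by
        apply Real.rpow_le_rpow_of_nonpos h1ρ (by nlinarith) (by linarith)
      have A2 : d ^ (-x) ≤ (1 - ρ) ^ (-x) :=
        Real.rpow_le_rpow_of_nonpos h1ρ hlow2 (by linarith)
      have A3 : d ^ (-y) ≤ (2 * π) ^ y * |θ| ^ (-y) := by
        have hθp : 0 < |θ| := abs_pos.2 h0
        have := Real.rpow_le_rpow_of_nonpos (by positivity) hlow (show -y ≤ 0 by linarith)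
        refine this.trans (le_of_eq ?_)
        rw [Real.div_rpow hθp.le (by positivity), Real.rpow_neg (by positivity : (0:ℝ) ≤ 2 * π)]
        field_simp
      have A4 : d ^ (-b) = d ^ (-x) * d ^ (-y) := by
        rw [← Real.rpow_add hdpos]; congr 1; linarith
      have A5 : (1 - ρ) ^ (-(α + x)) = (1 - ρ) ^ (-α) * (1 - ρ) ^ (-x) := by
        rw [← Real.rpow_add h1ρ]; congr 1; ring
      rw [A4, A5]
      have p1 : 0 ≤ (1 - ρ) ^ (-α) := Real.rpow_nonneg h1ρ.le _
      have p2 : 0 ≤ (1 - ρ) ^ (-x) := Real.rpow_nonneg h1ρ.le _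
      have p3 : 0 ≤ d ^ (-y) := Real.rpow_nonneg hdpos.le _
      have p4 : 0 ≤ (1 - ρ ^ 2) ^ (-α) := Real.rpow_nonneg (by nlinarith) _
      calc ρ * ((1 - ρ ^ 2) ^ (-α) * (d ^ (-x) * d ^ (-y)))
          ≤ 1 * ((1 - ρ) ^ (-α) * ((1 - ρ) ^ (-x) * ((2 * π) ^ y * |θ| ^ (-y)))) := by
            gcongr
        _ = _ := by ring
    · have hmem : Complex.polarCoord.symm (ρ, θ) ∉ unitDisk := by
        rw [mem_D, Complex.norm_polarCoord_symm]
        simpa [abs_of_pos hρ0] using hρ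
      rw [Set.indicator_of_notMem hmem]
      simp
  have hae : ∀ᵐ q : ℝ × ℝ, q.2 ≠ 0 := by
    have h1 : ∀ᵐ t : ℝ, t ≠ 0 := by simp [ae_iff, measure_singleton]
    exact Measure.quasiMeasurePreserving_snd.ae h1
  refine (setLIntegral_mono_ae' polarCoord.open_target.measurableSet
    (hae.mono fun q hq hq' => hbd q hq hq')).trans ?_
  refine (setLIntegral_le_lintegral _ _).trans ?_
  rw [lintegral_const_mul' _ _ ENNReal.ofReal_ne_top]
  gcongr
  rw [Measure.volume_eq_prod, lintegral_prod_mul]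
  · rw [lintegral_indicator measurableSet_Ioo, lintegral_indicator measurableSet_Ioo]
  · apply Measurable.aemeasurable
    apply Measurable.indicator _ measurableSet_Ioo
    fun_prop
  · apply Measurable.aemeasurable
    apply Measurable.indicator _ measurableSet_Ioo
    fun_prop

theorem exists_exp {x : ℝ} (hx : 0 < x) : ∃ t, Real.exp t = x := ⟨Real.log x, Real.exp_log hx⟩

theorem lemFR {α c : ℝ} (hα0 : 0 ≤ α) (hα : α < 1) (hc0 : 0 < c) (hc : c ≤ 2 - α) :
    ∃ C : ℝ, 0 ≤ C ∧ ∀ z ∈ unitDisk,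
      ∫⁻ w in unitDisk, ENNReal.ofReal ((1 - ‖w‖ ^ 2) ^ (-α) * ‖1 - conj w * z‖ ^ (-(2 - α + c))) ≤
        ENNReal.ofReal (C * (1 - ‖z‖ ^ 2) ^ (-c)) := by
  obtain ⟨C, hC0, hC⟩ := lemR (b := 2 - α - c) hα0 hα (by linarith) (by linarith)
  refine ⟨C, hC0, fun z hz => ?_⟩
  rw [lintegral_moebius hz]
  have e : ∀ v ∈ unitDisk, ENNReal.ofReal (mder z v ^ 2) * ENNReal.ofReal
      ((1 - ‖moebius z v‖ ^ 2) ^ (-α) * ‖1 - conj (moebius z v) * z‖ ^ (-(2 - α + c))) =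
      ENNReal.ofReal ((1 - ‖z‖ ^ 2) ^ (-c)) *
        ENNReal.ofReal ((1 - ‖v‖ ^ 2) ^ (-α) * ‖1 - conj v * z‖ ^ (-(2 - α - c))) := by
    intro v hv
    have hq := wt_pos hz
    have hv' := wt_pos hv
    rw [← ENNReal.ofReal_mul (sq_nonneg _), ← ENNReal.ofReal_mul (Real.rpow_nonneg hq.le _)]
    congr 1
    have h0 : (0 : ℂ) ∈ unitDisk := by simp [mem_D]
    have h1 := norm_moebius_den (a := z) (z := 0) (w := v) hz h0 hv
    rw [moebius_zero] at h1
    have h2 : mder z 0 = 1 - ‖z‖ ^ 2 := by simp [mder]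
    have h3 : ‖1 - conj (moebius z v) * z‖ = (1 - ‖z‖ ^ 2) / ‖1 - conj v * z‖ := by
      have hd := den_pos hv hz
      rw [← abs_of_nonneg (norm_nonneg (1 - conj (moebius z v) * z)),
        ← abs_of_pos (div_pos hq hd), ← sq_eq_sq_iff_abs_eq_abs, h1, h2, mder, den_symm z v]
      simp
      ring
    rw [h3, wt_moebius hz hv, mder, den_symm z v]
    obtain ⟨x, hx⟩ := exists_exp hq
    obtain ⟨y, hy⟩ := exists_exp hv'
    obtain ⟨t, ht⟩ := exists_exp (den_pos hv hz)
    rw [← hx, ← hy, ← ht]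
    simp only [← Real.exp_nat_mul, ← Real.exp_sub, ← Real.exp_add, ← Real.exp_mul]
    congr 1
    push_cast
    ring
  rw [setLIntegral_congr_fun meas_D e, lintegral_const_mul' _ _ ENNReal.ofReal_ne_top, mul_comm,
    ENNReal.ofReal_mul hC0]
  gcongr
  exact hC z hz

theorem ennCS {X : Type*} [MeasurableSpace X] {μ : Measure X} {f g : X → ℝ≥0∞} (hf : AEMeasurable f μ) (hg : AEMeasurable g μ) :
    (∫⁻ x, f x * g x ∂μ) ^ 2 ≤ (∫⁻ x, f x ^ 2 ∂μ) * (∫⁻ x, g x ^ 2 ∂μ) := by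
  have h := ENNReal.lintegral_mul_le_Lp_mul_Lq μ Real.HolderConjugate.two_two hf hg
  simp only [Pi.mul_apply, ENNReal.rpow_two] at h
  calc (∫⁻ x, f x * g x ∂μ) ^ 2 ≤ ((∫⁻ x, f x ^ 2 ∂μ) ^ (1 / 2 : ℝ) *
        (∫⁻ x, g x ^ 2 ∂μ) ^ (1 / 2 : ℝ)) ^ 2 := by gcongr
    _ = _ := by
      rw [mul_pow, ← ENNReal.rpow_natCast, ← ENNReal.rpow_natCast, ← ENNReal.rpow_mul,
        ← ENNReal.rpow_mul]
      norm_num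

theorem ennCSw {μ : Measure ℂ} {K u v H : ℂ → ℝ≥0∞} (hK : Measurable K) (hu : Measurable u)
    (hv : Measurable v) (hH : Measurable H) (huv : ∀ᵐ x ∂μ, u x * v x = 1) :
    (∫⁻ x, K x * H x ∂μ) ^ 2 ≤ (∫⁻ x, K x * u x ∂μ) * (∫⁻ x, K x * v x * H x ^ 2 ∂μ) := by
  have h := ennCS (μ := μ) (f := fun x => (K x * u x) ^ (1 / 2 : ℝ))
    (g := fun x => (K x * v x) ^ (1 / 2 : ℝ) * H x) (by fun_prop) (by fun_prop)
  have hs : ∀ t : ℝ≥0∞, (t ^ (1 / 2 : ℝ)) ^ 2 = t := by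
    intro t
    rw [← ENNReal.rpow_natCast, ← ENNReal.rpow_mul]
    norm_num
  have e1 : ∫⁻ x, K x * H x ∂μ =
      ∫⁻ x, (K x * u x) ^ (1 / 2 : ℝ) * ((K x * v x) ^ (1 / 2 : ℝ) * H x) ∂μ := by
    apply lintegral_congr_ae
    filter_upwards [huv] with x hx
    rw [← mul_assoc, ← ENNReal.mul_rpow_of_nonneg _ _ (by norm_num)]
    have : K x * u x * (K x * v x) = K x ^ 2 := by
      rw [show K x * u x * (K x * v x) = K x ^ 2 * (u x * v x) by ring, hx, mul_one]
    rw [this]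
    congr 1
    rw [← ENNReal.rpow_natCast, ← ENNReal.rpow_mul]
    norm_num
  rw [e1]
  refine h.trans (le_of_eq ?_)
  simp only [mul_pow, hs]

def kap (ε : ℝ) (z w : ℂ) : ℝ :=
  (1 - ‖z‖ ^ 2) ^ (-ε) * (1 - ‖w‖ ^ 2) ^ (-ε) * ‖1 - conj w * z‖ ^ (2 * ε - 2)

def Tk (ε : ℝ) (H : ℂ → ℝ≥0∞) (z : ℂ) : ℝ≥0∞ :=
  ∫⁻ w in unitDisk, ENNReal.ofReal (kap ε z w) * H w

def Iw (p : ℝ) (a : ℂ) (H : ℂ → ℝ≥0∞) : ℝ≥0∞ :=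
  ∫⁻ z in unitDisk, H z ^ 2 * ENNReal.ofReal ((1 - ‖moebius a z‖ ^ 2) ^ p)

theorem kap_symm (ε : ℝ) (z w : ℂ) : kap ε z w = kap ε w z := by
  unfold kap; rw [den_symm w z]; ring

theorem measurable_conj : Measurable fun v : ℂ => conj v := Complex.continuous_conj.measurable

theorem measurable_kap (ε : ℝ) : Measurable fun q : ℂ × ℂ => kap ε q.1 q.2 := by
  unfold kap
  have := measurable_conj
  fun_prop

theorem measurable_kap_r (ε : ℝ) (z : ℂ) : Measurable fun w : ℂ => kap ε z w := by
  unfold kap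
  have := measurable_conj
  fun_prop

theorem measurable_kap_l (ε : ℝ) (w : ℂ) : Measurable fun z : ℂ => kap ε z w := by
  unfold kap
  fun_prop

theorem measurable_Tk (ε : ℝ) {H : ℂ → ℝ≥0∞} (hH : Measurable H) : Measurable (Tk ε H) := by
  unfold Tk
  apply Measurable.lintegral_prod_right' (f := fun q : ℂ × ℂ => ENNReal.ofReal (kap ε q.1 q.2) * H q.2)
  have := measurable_kap ε
  fun_prop

theorem kap_nonneg {ε : ℝ} {z w : ℂ} (hz : z ∈ unitDisk) (hw : w ∈ unitDisk) : 0 ≤ kap ε z w := by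
  have := wt_pos hz
  have := wt_pos hw
  unfold kap
  positivity

theorem schur1 {ε s : ℝ} (hε : 0 ≤ ε) (hs : ε < s) (hs1 : s + ε < 1) :
    ∃ C : ℝ, 0 ≤ C ∧ ∀ z ∈ unitDisk,
      ∫⁻ w in unitDisk, ENNReal.ofReal (kap ε z w) * ENNReal.ofReal ((1 - ‖w‖ ^ 2) ^ (-s)) ≤
        ENNReal.ofReal (C * (1 - ‖z‖ ^ 2) ^ (-s)) := by
  obtain ⟨C, hC0, hC⟩ := lemFR (α := s + ε) (c := s - ε) (by linarith) hs1 (by linarith) (by linarith)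
  refine ⟨C, hC0, fun z hz => ?_⟩
  have hq := wt_pos hz
  have e : ∀ w ∈ unitDisk,
      ENNReal.ofReal (kap ε z w) * ENNReal.ofReal ((1 - ‖w‖ ^ 2) ^ (-s)) =
      ENNReal.ofReal ((1 - ‖z‖ ^ 2) ^ (-ε)) * ENNReal.ofReal
        ((1 - ‖w‖ ^ 2) ^ (-(s + ε)) * ‖1 - conj w * z‖ ^ (-(2 - (s + ε) + (s - ε)))) := by
    intro w hw
    rw [← ENNReal.ofReal_mul (kap_nonneg hz hw), ← ENNReal.ofReal_mul (by positivity)]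
    congr 1
    rw [kap, show -(2 - (s + ε) + (s - ε)) = 2 * ε - 2 by ring, show -(s + ε) = -ε + -s by ring,
      Real.rpow_add (wt_pos hw)]
    ring
  rw [setLIntegral_congr_fun meas_D e, lintegral_const_mul' _ _ ENNReal.ofReal_ne_top]
  calc _ ≤ ENNReal.ofReal ((1 - ‖z‖ ^ 2) ^ (-ε)) *
        ENNReal.ofReal (C * (1 - ‖z‖ ^ 2) ^ (-(s - ε))) := by gcongr; exact hC z hz
    _ = _ := by
      rw [← ENNReal.ofReal_mul (by positivity)]
      congr 1
      rw [show -s = -ε + -(s - ε) by ring, Real.rpow_add hq]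
      ring

theorem schur2 {p : ℝ} (hp0 : 0 < p) (hp1 : p < 1) :
    ∃ C : ℝ≥0∞, C ≠ ⊤ ∧ ∀ H : ℂ → ℝ≥0∞, Measurable H →
      ∫⁻ z in unitDisk, Tk ((1 - p) / 4) H z ^ 2 * ENNReal.ofReal ((1 - ‖z‖ ^ 2) ^ p) ≤
        C * ∫⁻ z in unitDisk, H z ^ 2 * ENNReal.ofReal ((1 - ‖z‖ ^ 2) ^ p) := by
  set ε := (1 - p) / 4 with hε
  set s := (1 + p) / 2 with hs
  obtain ⟨C1, hC10, hC1⟩ := schur1 (ε := ε) (s := s) (by linarith) (by linarith) (by linarith)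
  obtain ⟨C2, hC20, hC2⟩ := schur1 (ε := ε) (s := s - p) (by linarith) (by linarith) (by linarith)
  refine ⟨ENNReal.ofReal C1 * ENNReal.ofReal C2, ENNReal.mul_ne_top ENNReal.ofReal_ne_top
    ENNReal.ofReal_ne_top, fun H hH => ?_⟩
  have hk := measurable_kap ε
  have step1 : ∀ z ∈ unitDisk,
      Tk ε H z ^ 2 * ENNReal.ofReal ((1 - ‖z‖ ^ 2) ^ p) ≤
      ENNReal.ofReal C1 * ∫⁻ w in unitDisk, ENNReal.ofReal ((1 - ‖z‖ ^ 2) ^ (-(s - p))) *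
        (ENNReal.ofReal (kap ε z w) * ENNReal.ofReal ((1 - ‖w‖ ^ 2) ^ s) * H w ^ 2) := by
    intro z hz
    have hq := wt_pos hz
    have h := ennCSw (μ := volume.restrict unitDisk)
      (K := fun w => ENNReal.ofReal (kap ε z w))
      (u := fun w => ENNReal.ofReal ((1 - ‖w‖ ^ 2) ^ (-s)))
      (v := fun w => ENNReal.ofReal ((1 - ‖w‖ ^ 2) ^ s)) (H := H)
      (measurable_kap_r ε z).ennreal_ofReal (by fun_prop) (by fun_prop) hH (by
        filter_upwards [ae_restrict_mem meas_D] with w hw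
        have := wt_pos hw
        rw [← ENNReal.ofReal_mul (by positivity), ← Real.rpow_add this]
        simp)
    rw [lintegral_const_mul' _ _ ENNReal.ofReal_ne_top]
    calc Tk ε H z ^ 2 * ENNReal.ofReal ((1 - ‖z‖ ^ 2) ^ p)
        ≤ (ENNReal.ofReal (C1 * (1 - ‖z‖ ^ 2) ^ (-s)) * ∫⁻ w in unitDisk,
        (ENNReal.ofReal (kap ε z w) * ENNReal.ofReal ((1 - ‖w‖ ^ 2) ^ s) * H w ^ 2)) *
          ENNReal.ofReal ((1 - ‖z‖ ^ 2) ^ p) := by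
          gcongr
          refine h.trans ?_
          gcongr
          exact hC1 z hz
      _ = _ := by
          rw [ENNReal.ofReal_mul hC10, show -(s - p) = -s + p by ring, Real.rpow_add hq,
            ENNReal.ofReal_mul (by positivity)]
          ring
  refine (setLIntegral_mono' meas_D step1).trans ?_
  rw [lintegral_const_mul' _ _ ENNReal.ofReal_ne_top, mul_assoc]
  gcongr
  rw [lintegral_lintegral_swap]
  swap
  · apply Measurable.aemeasurable
    simp only [Function.uncurry_def]
    fun_prop
  have step2 : ∀ w ∈ unitDisk, ∫⁻ z in unitDisk, ENNReal.ofReal ((1 - ‖z‖ ^ 2) ^ (-(s - p))) *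
        (ENNReal.ofReal (kap ε z w) * ENNReal.ofReal ((1 - ‖w‖ ^ 2) ^ s) * H w ^ 2) ≤
      ENNReal.ofReal C2 * (H w ^ 2 * ENNReal.ofReal ((1 - ‖w‖ ^ 2) ^ p)) := by
    intro w hw
    have hq := wt_pos hw
    have e : ∀ z : ℂ, ENNReal.ofReal ((1 - ‖z‖ ^ 2) ^ (-(s - p))) *
        (ENNReal.ofReal (kap ε z w) * ENNReal.ofReal ((1 - ‖w‖ ^ 2) ^ s) * H w ^ 2) =
        (ENNReal.ofReal (kap ε w z) * ENNReal.ofReal ((1 - ‖z‖ ^ 2) ^ (-(s - p)))) *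
        (ENNReal.ofReal ((1 - ‖w‖ ^ 2) ^ s) * H w ^ 2) := by
      intro z; rw [kap_symm]; ring
    simp_rw [e]
    rw [lintegral_mul_const]
    swap
    · have := measurable_kap_r ε w
      fun_prop
    calc _ ≤ ENNReal.ofReal (C2 * (1 - ‖w‖ ^ 2) ^ (-(s - p))) *
        (ENNReal.ofReal ((1 - ‖w‖ ^ 2) ^ s) * H w ^ 2) := by
          gcongr; exact hC2 w hw
      _ = _ := by
          rw [ENNReal.ofReal_mul hC20, show p = -(s - p) + s by ring, Real.rpow_add hq,
            ENNReal.ofReal_mul (by positivity)]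
          ring_nf
  refine (setLIntegral_mono' meas_D step2).trans ?_
  rw [lintegral_const_mul' _ _ ENNReal.ofReal_ne_top]

def Hcov (a : ℂ) (H : ℂ → ℝ≥0∞) (z : ℂ) : ℝ≥0∞ := ENNReal.ofReal (mder a z) * H (moebius a z)

theorem measurable_Hcov (a : ℂ) {H : ℂ → ℝ≥0∞} (hH : Measurable H) : Measurable (Hcov a H) := by
  unfold Hcov
  exact (measurable_mder a).ennreal_ofReal.mul (hH.comp (measurable_moebius a))

theorem kap_moebius {ε : ℝ} {a z w : ℂ} (ha : a ∈ unitDisk) (hz : z ∈ unitDisk)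
    (hw : w ∈ unitDisk) :
    kap ε (moebius a z) (moebius a w) * (mder a z * mder a w) = kap ε z w := by
  unfold kap
  have h := norm_moebius_den ha hz hw
  have h1 := den_pos (moebius_mem ha hw) (moebius_mem ha hz)
  have h2 := den_pos hw hz
  rw [wt_moebius ha hz, wt_moebius ha hw]
  obtain ⟨x, hx⟩ := exists_exp (mder_pos ha hz)
  obtain ⟨y, hy⟩ := exists_exp (mder_pos ha hw)
  obtain ⟨t, ht⟩ := exists_exp (wt_pos hz)
  obtain ⟨r, hr⟩ := exists_exp (wt_pos hw)
  obtain ⟨m, hm⟩ := exists_exp h1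
  obtain ⟨l, hl⟩ := exists_exp h2
  rw [← hx, ← hy, ← hm, ← hl] at h
  rw [← hx, ← hy, ← ht, ← hr, ← hm, ← hl]
  simp only [← Real.exp_nat_mul, ← Real.exp_sub, ← Real.exp_add, ← Real.exp_mul] at h ⊢
  have h' := Real.exp_injective h
  push_cast at h'
  congr 1
  linear_combination (ε - 1) * h'

theorem Tk_cov {ε : ℝ} {a z : ℂ} (ha : a ∈ unitDisk) (hz : z ∈ unitDisk) (H : ℂ → ℝ≥0∞) :
    Hcov a (Tk ε H) z = Tk ε (Hcov a H) z := by
  unfold Hcov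
  conv_lhs => rw [Tk, lintegral_moebius ha, ← lintegral_const_mul' _ _ ENNReal.ofReal_ne_top]
  rw [Tk]
  apply setLIntegral_congr_fun meas_D
  intro w hw
  simp only
  rw [← kap_moebius ha hz hw, ENNReal.ofReal_mul (kap_nonneg (moebius_mem ha hz) (moebius_mem ha hw)),
    ENNReal.ofReal_mul (mder_pos ha hz).le, ENNReal.ofReal_pow (mder_pos ha hw).le]
  ring

theorem Iw_cov {p : ℝ} {a : ℂ} (ha : a ∈ unitDisk) (H : ℂ → ℝ≥0∞) :
    Iw p a H = ∫⁻ z in unitDisk, Hcov a H z ^ 2 * ENNReal.ofReal ((1 - ‖z‖ ^ 2) ^ p) := by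
  unfold Iw
  rw [lintegral_moebius ha]
  apply setLIntegral_congr_fun meas_D
  intro z hz
  simp only [Hcov]
  rw [moebius_invol ha hz, ENNReal.ofReal_pow (mder_pos ha hz).le]
  ring

theorem Iw_Tk {p : ℝ} (hp0 : 0 < p) (hp1 : p < 1) :
    ∃ C : ℝ≥0∞, C ≠ ⊤ ∧ ∀ a ∈ unitDisk, ∀ H : ℂ → ℝ≥0∞, Measurable H →
      Iw p a (Tk ((1 - p) / 4) H) ≤ C * Iw p a H := by
  obtain ⟨C, hC, h⟩ := schur2 hp0 hp1
  refine ⟨C, hC, fun a ha H hH => ?_⟩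
  rw [Iw_cov ha, Iw_cov ha]
  refine le_trans (le_of_eq ?_) (h _ (measurable_Hcov a hH))
  apply setLIntegral_congr_fun meas_D
  intro z hz
  simp only
  rw [Tk_cov ha hz]

theorem kap_zero_le {ε : ℝ} (hε : 0 ≤ ε) {z w : ℂ} (hz : z ∈ unitDisk) (hw : w ∈ unitDisk) :
    kap 0 z w * ((‖1 - conj w * z‖ ^ 2) / ((1 - ‖z‖ ^ 2) * (1 - ‖w‖ ^ 2))) ^ ε = kap ε z w := by
  unfold kap
  obtain ⟨t, ht⟩ := exists_exp (wt_pos hz)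
  obtain ⟨r, hr⟩ := exists_exp (wt_pos hw)
  obtain ⟨m, hm⟩ := exists_exp (den_pos hw hz)
  rw [← ht, ← hr, ← hm]
  simp only [← Real.exp_nat_mul, ← Real.exp_sub, ← Real.exp_add, ← Real.exp_mul]
  congr 1
  push_cast
  ring

theorem kap_mono {ε : ℝ} (hε : 0 ≤ ε) {z w : ℂ} (hz : z ∈ unitDisk) (hw : w ∈ unitDisk) :
    kap 0 z w ≤ kap ε z w := by
  rw [← kap_zero_le hε hz hw]
  apply le_mul_of_one_le_right (kap_nonneg hz hw)
  apply Real.one_le_rpow _ hε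
  rw [one_le_div (mul_pos (wt_pos hz) (wt_pos hw)), mul_comm]
  exact wt_mul_le_den_sq

theorem Tk_mono {ε : ℝ} (hε : 0 ≤ ε) {z : ℂ} (hz : z ∈ unitDisk) (H : ℂ → ℝ≥0∞) :
    Tk 0 H z ≤ Tk ε H z := by
  unfold Tk
  apply setLIntegral_mono' meas_D
  intro w hw
  gcongr
  exact kap_mono hε hz hw

theorem Iw_mono {p : ℝ} {a : ℂ} {H K : ℂ → ℝ≥0∞} (h : ∀ z ∈ unitDisk, H z ≤ K z) :
    Iw p a H ≤ Iw p a K := by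
  unfold Iw
  apply setLIntegral_mono' meas_D
  intro z hz
  gcongr
  exact h z hz

theorem Tk_bound {p : ℝ} (hp0 : 0 < p) (hp1 : p < 1) :
    ∃ C : ℝ≥0∞, C ≠ ⊤ ∧ ∀ z ∈ unitDisk, ∀ H : ℂ → ℝ≥0∞, Measurable H →
      (ENNReal.ofReal (1 - ‖z‖ ^ 2) * Tk 0 H z) ^ 2 ≤ C * Iw p z H := by
  obtain ⟨C, hC0, hC⟩ := lemR (α := p) (b := 0) hp0.le hp1 le_rfl (by linarith)
  refine ⟨ENNReal.ofReal C, ENNReal.ofReal_ne_top, fun z hz H hH => ?_⟩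
  have h0 : (0 : ℂ) ∈ unitDisk := by simp [mem_D]
  have h := Tk_cov (ε := 0) hz h0 H
  rw [Hcov, moebius_zero] at h
  have h2 : mder z 0 = 1 - ‖z‖ ^ 2 := by simp [mder]
  rw [h2] at h
  rw [h, Iw_cov hz]
  have e : Tk 0 (Hcov z H) 0 = ∫⁻ w in unitDisk, 1 * Hcov z H w := by
    simp [Tk, kap]
  rw [e]
  have h3 := ennCSw (μ := volume.restrict unitDisk)
      (K := fun w => 1)
      (u := fun w => ENNReal.ofReal ((1 - ‖w‖ ^ 2) ^ (-p)))
      (v := fun w => ENNReal.ofReal ((1 - ‖w‖ ^ 2) ^ p)) (H := Hcov z H)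
      (by fun_prop) (by fun_prop) (by fun_prop) (measurable_Hcov z hH) (by
        filter_upwards [ae_restrict_mem meas_D] with w hw
        have := wt_pos hw
        rw [← ENNReal.ofReal_mul (by positivity), ← Real.rpow_add this]
        simp)
  refine h3.trans ?_
  simp only [one_mul]
  refine mul_le_mul' ?_ (le_of_eq ?_)
  · have := hC 0 h0
    simpa using this
  · simp_rw [mul_comm (ENNReal.ofReal _)]

theorem lintegral_rot_ball {c : ℂ} (hc : ‖c‖ = 1) {R : ℝ} {Φ : ℂ → ℝ≥0∞} (hΦ : Measurable Φ) :
    ∫⁻ v in ball 0 R, Φ (c * v) = ∫⁻ v in ball 0 R, Φ v := by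
  let e := rotation ⟨c, by simpa [Submonoid.unitSphere] using hc⟩
  have h := (e.measurePreserving).setLIntegral_comp_preimage (s := ball 0 R) measurableSet_ball hΦ
  rw [← h]
  have h2 : (⇑e) ⁻¹' (ball 0 R) = ball 0 R := by
    ext v
    simp
  rw [h2]
  rfl

theorem circle_mean {F : ℂ → ℂ} {c v : ℂ} {R : ℝ} (hF : DifferentiableOn ℂ F (ball c R))
    (hv : v ∈ ball (0 : ℂ) R) :
    ∫ θ in (0:ℝ)..2 * π, F (c + circleMap 0 1 θ * v) = (2 * π : ℝ) • F c := by
  have hd : DiffContOnCl ℂ (fun t : ℂ => F (c + t * v)) (ball 0 |1|) := by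
    apply DifferentiableOn.diffContOnCl
    rw [abs_one, closure_ball _ one_ne_zero]
    apply hF.comp
    · fun_prop
    · intro t ht
      simp only [mem_ball, dist_self_add_left, norm_mul, dist_zero_right, mem_closedBall] at *
      nlinarith [norm_nonneg v, norm_nonneg t]
  have h := hd.circleAverage
  rw [Real.circleAverage_def, zero_mul, add_zero] at h
  rw [← h, smul_smul, mul_inv_cancel₀ (by positivity), one_smul]

theorem circle_submean {F : ℂ → ℂ} {c v : ℂ} {R : ℝ} (hF : DifferentiableOn ℂ F (ball c R))
    (hv : v ∈ ball (0 : ℂ) R) :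
    ENNReal.ofReal (2 * π) * ‖F c‖ₑ ≤
      ∫⁻ θ in Ioc (0:ℝ) (2 * π), ‖F (c + circleMap 0 1 θ * v)‖ₑ := by
  have h := circle_mean hF hv
  rw [intervalIntegral.integral_of_le (by positivity)] at h
  calc ENNReal.ofReal (2 * π) * ‖F c‖ₑ = ‖(2 * π : ℝ) • F c‖ₑ := by
        rw [enorm_smul, Real.enorm_of_nonneg (by positivity)]
    _ ≤ _ := by rw [← h]; exact enorm_integral_le_lintegral_enorm _

theorem submean {F : ℂ → ℂ} {c : ℂ} {R : ℝ} (hF : DifferentiableOn ℂ F (ball c R))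
    (hm : Measurable F) :
    volume (ball c R) * ‖F c‖ₑ ≤ ∫⁻ z in ball c R, ‖F z‖ₑ := by
  have hpi := Real.pi_pos
  have e1 : ∫⁻ z in ball c R, ‖F z‖ₑ = ∫⁻ v in ball 0 R, ‖F (c + v)‖ₑ := by
    have h := (measurePreserving_add_left volume c).setLIntegral_comp_preimage (s := ball c R)
      measurableSet_ball (f := fun z => ‖F z‖ₑ) (by fun_prop)
    rw [← h]
    simp
  have hv : volume (ball c R) = volume (ball (0:ℂ) R) := by
    simp [Complex.volume_ball]
  have key : ENNReal.ofReal (2 * π) * (volume (ball c R) * ‖F c‖ₑ) ≤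
      ENNReal.ofReal (2 * π) * ∫⁻ z in ball c R, ‖F z‖ₑ := by
    calc ENNReal.ofReal (2 * π) * (volume (ball c R) * ‖F c‖ₑ)
        = ∫⁻ v in ball (0:ℂ) R, ENNReal.ofReal (2 * π) * ‖F c‖ₑ := by
          rw [setLIntegral_const, hv]; ring
      _ ≤ ∫⁻ v in ball (0:ℂ) R, ∫⁻ θ in Ioc (0:ℝ) (2 * π), ‖F (c + circleMap 0 1 θ * v)‖ₑ := by
          apply setLIntegral_mono' measurableSet_ball
          intro v hv
          exact circle_submean hF hv
      _ = ∫⁻ θ in Ioc (0:ℝ) (2 * π), ∫⁻ v in ball (0:ℂ) R, ‖F (c + circleMap 0 1 θ * v)‖ₑ := by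
          rw [lintegral_lintegral_swap]
          apply Measurable.aemeasurable
          simp only [Function.uncurry_def]
          have : Measurable fun x : ℝ => circleMap 0 1 x := (continuous_circleMap 0 1).measurable
          fun_prop
      _ = ∫⁻ θ in Ioc (0:ℝ) (2 * π), ∫⁻ v in ball (0:ℂ) R, ‖F (c + v)‖ₑ := by
          congr 1
          ext θ
          exact lintegral_rot_ball (c := circleMap 0 1 θ) (Φ := fun v => ‖F (c + v)‖ₑ)
            (by simp) (by fun_prop)
      _ = _ := by
          rw [setLIntegral_const, Real.volume_Ioc, sub_zero, e1, mul_comm]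
  exact (ENNReal.mul_le_mul_iff_right (by simp [hpi]) ENNReal.ofReal_ne_top).1 key

theorem qpIntegral_eq (p : ℝ) (f : ℂ → ℂ) (a : ℂ) :
    qpIntegral p f a = Iw p a (fun z => ‖deriv f z‖ₑ) := by
  unfold qpIntegral Iw
  congr 1
  ext z
  rw [ENNReal.ofReal_mul (sq_nonneg _), ENNReal.ofReal_pow (norm_nonneg _), ofReal_norm]

theorem ball_sub_D {a : ℂ} {r : ℝ} (h : r ≤ 1 - ‖a‖) : ball a r ⊆ unitDisk := by
  intro z hz
  rw [mem_D]
  rw [mem_ball, dist_eq_norm] at hz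
  have := norm_sub_norm_le z a
  linarith

theorem near_wt {p : ℝ} (hp0 : 0 < p) (hp1 : p < 1) {a z : ℂ} (ha : a ∈ unitDisk)
    (hz : z ∈ ball a ((1 - ‖a‖) / 2)) : 2 / 25 ≤ (1 - ‖moebius a z‖ ^ 2) ^ p := by
  have ha' := mem_D.1 ha
  have hzD : z ∈ unitDisk := ball_sub_D (by linarith) hz
  rw [mem_ball, dist_eq_norm] at hz
  set r := (1 - ‖a‖) / 2 with hr
  have hr0 : 0 < r := by linarith
  have h1 : 2 * r ≤ 1 - ‖a‖ ^ 2 := by nlinarith [norm_nonneg a]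
  have h2 : r ≤ 1 - ‖z‖ ^ 2 := by
    have := norm_sub_norm_le z a
    nlinarith [norm_nonneg z, norm_nonneg a]
  have h3 : ‖1 - conj a * z‖ ≤ 5 * r := by
    have e : 1 - conj a * z = (1 - conj a * a) - conj a * (z - a) := by ring
    rw [e]
    refine (norm_sub_le _ _).trans ?_
    rw [norm_wt ha, norm_mul, RCLike.norm_conj]
    nlinarith [norm_nonneg a, norm_nonneg (z - a)]
  have h4 := den_pos ha hzD
  have h5 : 2 / 25 ≤ 1 - ‖moebius a z‖ ^ 2 := by
    rw [one_sub_moebius ha hzD, div_le_div_iff₀ (by norm_num) (by positivity)]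
    have : (2 * r) * r ≤ (1 - ‖a‖ ^ 2) * (1 - ‖z‖ ^ 2) := by gcongr; linarith
    nlinarith
  calc (2 / 25 : ℝ) = (2 / 25 : ℝ) ^ (1 : ℝ) := by simp
    _ ≤ (2 / 25 : ℝ) ^ p := Real.rpow_le_rpow_of_exponent_ge (by norm_num) (by norm_num) hp1.le
    _ ≤ _ := Real.rpow_le_rpow (by norm_num) h5 hp0.le

/-- Bloch estimate. -/
theorem bloch {p : ℝ} (hp0 : 0 < p) (hp1 : p < 1) {F : ℂ → ℂ} (hF : DifferentiableOn ℂ F unitDisk)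
    {C : ℝ} (hC : ∀ a ∈ unitDisk, qpIntegral p F a ≤ ENNReal.ofReal C) :
    ∃ B : ℝ, 0 ≤ B ∧ ∀ a ∈ unitDisk, (1 - ‖a‖) * ‖deriv F a‖ ≤ B := by
  refine ⟨4 * Real.sqrt (max C 0), by positivity, fun a ha => ?_⟩
  have ha' := mem_D.1 ha
  set r := (1 - ‖a‖) / 2 with hr
  have hr0 : 0 < r := by linarith
  have hsub : ball a r ⊆ unitDisk := ball_sub_D (by linarith)
  have hd : DifferentiableOn ℂ (fun z => deriv F z ^ 2) (ball a r) :=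
    ((hF.deriv isOpen_D).mono hsub).pow 2
  have h1 := submean hd ((measurable_deriv F).pow_const 2)
  have h2 : ENNReal.ofReal (2 / 25) * ∫⁻ z in ball a r, ‖deriv F z ^ 2‖ₑ ≤ ENNReal.ofReal C := by
    refine le_trans ?_ (hC a ha)
    rw [qpIntegral_eq, ← lintegral_const_mul' _ _ ENNReal.ofReal_ne_top]
    unfold Iw
    refine le_trans ?_ (lintegral_mono_set hsub)
    apply setLIntegral_mono' measurableSet_ball
    intro z hz
    rw [enorm_pow, mul_comm]
    gcongr
    exact near_wt hp0 hp1 ha hz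
  have h3 : ENNReal.ofReal (2 / 25) * (volume (ball a r) * ‖deriv F a ^ 2‖ₑ) ≤
      ENNReal.ofReal C := le_trans (by gcongr) h2
  rw [Complex.volume_ball, enorm_pow, ← ofReal_norm] at h3
  have hpi : (NNReal.pi : ℝ≥0∞) = ENNReal.ofReal π := by
    rw [← NNReal.coe_real_pi, ENNReal.ofReal_coe_nnreal]
  rw [hpi, ← ENNReal.ofReal_pow hr0.le, ← ENNReal.ofReal_pow (norm_nonneg _),
    ← ENNReal.ofReal_mul (by positivity), ← ENNReal.ofReal_mul (by positivity),
    ← ENNReal.ofReal_mul (by positivity)] at h3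
  have h4 : 2 / 25 * (r ^ 2 * π * ‖deriv F a‖ ^ 2) ≤ max C 0 := by
    have h5 : ENNReal.ofReal C = ENNReal.ofReal (max C 0) := by simp
    rw [h5] at h3
    exact (ENNReal.ofReal_le_ofReal_iff (le_max_right _ _)).1 h3
  have hpi3 := Real.pi_gt_d6
  have h6 : r ^ 2 * ‖deriv F a‖ ^ 2 ≤ 4 * max C 0 := by
    have : 0 ≤ r ^ 2 * ‖deriv F a‖ ^ 2 := by positivity
    nlinarith
  have h7 : (1 - ‖a‖) = 2 * r := by linarith
  rw [h7]
  apply le_of_sq_le_sq_nn _ (by positivity)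
  rw [mul_pow, mul_pow, mul_pow 4, Real.sq_sqrt (le_max_right _ _)]
  nlinarith

theorem diff_log {F : ℂ → ℂ} (hF : DifferentiableOn ℂ F unitDisk) {B : ℝ} (hB0 : 0 ≤ B)
    (hB : ∀ a ∈ unitDisk, (1 - ‖a‖) * ‖deriv F a‖ ≤ B) {z w : ℂ} (hz : z ∈ unitDisk)
    (hw : w ∈ unitDisk) : ‖F z - F w‖ ≤ 2 * B * (-Real.log (1 - ‖moebius w z‖)) := by
  set ζ := moebius w z with hζ
  have hζD := moebius_mem hw hz
  have hζ1 := mem_D.1 hζD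
  rw [← hζ] at hζ1
  have htD : ∀ t ∈ Icc (0:ℝ) 1, (t : ℂ) * ζ ∈ unitDisk := by
    intro t ht
    rw [mem_D, norm_mul, Complex.norm_real, Real.norm_of_nonneg ht.1]
    nlinarith [norm_nonneg ζ, ht.2]
  have hder : ∀ t ∈ Icc (0:ℝ) 1, HasDerivAt (fun t : ℝ => F (moebius w ((t : ℂ) * ζ)) - F w)
      (deriv F (moebius w ((t:ℂ) * ζ)) * ((-(1 - conj w * w) / (1 - conj w * ((t:ℂ) * ζ)) ^ 2) * ζ)) t := by
    intro t ht
    have hm := moebius_mem hw (htD t ht)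
    have h1 := (hF.differentiableAt (isOpen_D.mem_nhds hm)).hasDerivAt
    have h2 := moebius_hasDeriv hw (htD t ht)
    have h3 : HasDerivAt (fun t : ℂ => t * ζ) ζ (t:ℂ) := by
      simpa using (hasDerivAt_id (t:ℂ)).mul_const ζ
    have h4 : HasDerivAt (fun t : ℂ => moebius w (t * ζ))
      ((-(1 - conj w * w) / (1 - conj w * ((t:ℂ) * ζ)) ^ 2) * ζ) (t:ℂ) :=
      HasDerivAt.comp (h₂ := moebius w) (h := fun t : ℂ => t * ζ) (t:ℂ) h2 h3
    have h5 := HasDerivAt.comp (t:ℂ) h1 h4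
    exact (h5.comp_ofReal).sub_const _
  have hden : ∀ t ∈ Icc (0:ℝ) 1, 0 < 1 - t * ‖ζ‖ := by
    intro t ht
    nlinarith [norm_nonneg ζ, ht.2, ht.1]
  have hBd : ∀ t ∈ Icc (0:ℝ) 1, HasDerivAt (fun t : ℝ => 2 * B * (-Real.log (1 - t * ‖ζ‖)))
      (2 * B * (‖ζ‖ / (1 - t * ‖ζ‖))) t := by
    intro t ht
    have h1 : HasDerivAt (fun t : ℝ => 1 - t * ‖ζ‖) (-‖ζ‖) t := by
      simpa using ((hasDerivAt_id t).mul_const ‖ζ‖).const_sub 1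
    refine ((h1.log (hden t ht).ne').neg.const_mul (2 * B)).congr_deriv ?_
    ring
  have key := image_norm_le_of_norm_deriv_right_le_deriv_boundary' (a := 0) (b := 1)
    (f := fun t : ℝ => F (moebius w ((t : ℂ) * ζ)) - F w)
    (f' := fun t : ℝ => deriv F (moebius w ((t:ℂ) * ζ)) *
      ((-(1 - conj w * w) / (1 - conj w * ((t:ℂ) * ζ)) ^ 2) * ζ))
    (B := fun t : ℝ => 2 * B * (-Real.log (1 - t * ‖ζ‖)))
    (B' := fun t : ℝ => 2 * B * (‖ζ‖ / (1 - t * ‖ζ‖)))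
    (fun t ht => (hder t ht).continuousAt.continuousWithinAt)
    (fun t ht => (hder t ⟨ht.1, ht.2.le⟩).hasDerivWithinAt)
    (by simp [moebius_zero])
    (fun t ht => (hBd t ht).continuousAt.continuousWithinAt)
    (fun t ht => (hBd t ⟨ht.1, ht.2.le⟩).hasDerivWithinAt)
    (by
      intro t ht
      have ht' : t ∈ Icc (0:ℝ) 1 := ⟨ht.1, ht.2.le⟩
      have hv := htD t ht'
      have hm := moebius_mem hw hv
      have h1 := hB _ hm
      have h2 := wt_moebius hw hv
      have h3 := mder_pos hw hv
      have h5 := mem_D.1 hm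
      rw [norm_mul, norm_mul, norm_mder hw]
      set m := mder w ((t:ℂ) * ζ)
      set x := ‖moebius w ((t:ℂ) * ζ)‖ with hx
      have hx0 : 0 ≤ x := norm_nonneg _
      have h4 : ‖(t:ℂ) * ζ‖ = t * ‖ζ‖ := by
        rw [norm_mul, Complex.norm_real, Real.norm_of_nonneg ht.1]
      rw [h4] at h2
      have h6 := hden t ht'
      have h7 : 0 ≤ t * ‖ζ‖ := mul_nonneg ht.1 (norm_nonneg _)
      have h8 : ‖deriv F (moebius w ((t:ℂ) * ζ))‖ * m * (1 - t * ‖ζ‖) ≤ 2 * B := by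
        have h9 : m * (1 - t * ‖ζ‖) ≤ 2 * (1 - x) := by nlinarith
        have h10 := norm_nonneg (deriv F (moebius w ((t:ℂ) * ζ)))
        nlinarith
      rw [mul_div_assoc', le_div_iff₀ h6]
      nlinarith [norm_nonneg ζ])
  have := key (x := 1) ⟨zero_le_one, le_rfl⟩
  simp only [Complex.ofReal_one, one_mul] at this
  rwa [hζ, moebius_invol hw hz] at this

theorem diff_pow {F : ℂ → ℂ} (hF : DifferentiableOn ℂ F unitDisk) {B : ℝ} (hB0 : 0 ≤ B)
    (hB : ∀ a ∈ unitDisk, (1 - ‖a‖) * ‖deriv F a‖ ≤ B) {ε : ℝ} (hε : 0 < ε) :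
    ∃ C : ℝ, 0 ≤ C ∧ ∀ z ∈ unitDisk, ∀ w ∈ unitDisk, ‖F z - F w‖ ≤
      C * ((‖1 - conj w * z‖ ^ 2) / ((1 - ‖z‖ ^ 2) * (1 - ‖w‖ ^ 2))) ^ ε := by
  refine ⟨2 * B * (2 ^ ε / ε), by positivity, fun z hz w hw => ?_⟩
  refine (diff_log hF hB0 hB hz hw).trans ?_
  rw [mul_assoc (2 * B)]
  refine mul_le_mul_of_nonneg_left ?_ (by positivity)
  have hm := mem_D.1 (moebius_mem hw hz)
  have hn := norm_nonneg (moebius w z)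
  have h1 : (‖1 - conj w * z‖ ^ 2) / ((1 - ‖z‖ ^ 2) * (1 - ‖w‖ ^ 2)) =
      (1 - ‖moebius w z‖ ^ 2)⁻¹ := by
    rw [one_sub_moebius hw hz, inv_div, mul_comm (1 - ‖w‖ ^ 2)]
  rw [h1, ← Real.log_inv]
  set x := ‖moebius w z‖
  have hx : 0 < 1 - x := by linarith
  refine (Real.log_le_rpow_div (inv_pos.2 hx).le hε).trans ?_
  rw [div_mul_eq_mul_div]
  gcongr
  rw [← Real.mul_rpow (by norm_num) (inv_nonneg.2 (by nlinarith))]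
  apply Real.rpow_le_rpow (by positivity) _ hε.le
  rw [inv_le_iff_one_le_mul₀ hx]
  have : 0 < 1 - x ^ 2 := by nlinarith
  rw [mul_comm, ← mul_assoc, ← div_eq_mul_inv, le_div_iff₀ this]
  nlinarith

theorem zero_mem_D : (0 : ℂ) ∈ unitDisk := by simp [mem_D]

/-- Uniform `Q_p` bound for the logarithmic test functions. -/
theorem test_bound {p : ℝ} (hp0 : 0 < p) (hp1 : p < 1) :
    ∃ C : ℝ, 0 ≤ C ∧ ∀ a ∈ unitDisk, ∀ b ∈ unitDisk,
      Iw p b (fun z => ENNReal.ofReal (‖1 - conj a * z‖⁻¹)) ≤ ENNReal.ofReal C := by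
  obtain ⟨C, hC0, hC⟩ := lemR (α := 0) (b := 2 - p) le_rfl zero_lt_one (by linarith) (by linarith)
  refine ⟨8 * C, by positivity, fun a ha b hb => ?_⟩
  rw [Iw_cov hb]
  set c := moebius b a with hc
  have hcD : c ∈ unitDisk := moebius_mem hb ha
  have hac : moebius b c = a := moebius_invol hb ha
  have hbd : ∀ v ∈ unitDisk, Hcov b (fun z => ENNReal.ofReal (‖1 - conj a * z‖⁻¹)) v ^ 2 *
      ENNReal.ofReal ((1 - ‖v‖ ^ 2) ^ p) ≤
      ENNReal.ofReal 4 * (ENNReal.ofReal ((1 - ‖v‖ ^ 2) ^ (-(0:ℝ)) * ‖1 - conj v * c‖ ^ (-(2 - p))) +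
        ENNReal.ofReal ((1 - ‖v‖ ^ 2) ^ (-(0:ℝ)) * ‖1 - conj v * b‖ ^ (-(2 - p)))) := by
    intro v hv
    have hm := mder_pos hb hv
    have hmc := mder_pos hb hcD
    have hwt := wt_pos hv
    rw [Hcov, ← ENNReal.ofReal_mul hm.le, ← ENNReal.ofReal_pow (by positivity),
      ← ENNReal.ofReal_mul (by positivity), ← ENNReal.ofReal_add (by positivity) (by positivity),
      ← ENNReal.ofReal_mul (by norm_num)]
    apply ENNReal.ofReal_le_ofReal
    have h1 := norm_moebius_den hb hv hcD
    rw [hac] at h1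
    rw [mul_pow, inv_pow, h1]
    have dcv := den_pos hcD hv
    have dbv := den_pos hb hv
    have dbc := den_pos hb hcD
    have wb := wt_pos hb
    have e1 : mder b v ^ 2 * (‖1 - conj c * v‖ ^ 2 * mder b v * mder b c)⁻¹ =
        (‖1 - conj b * c‖ / (‖1 - conj b * v‖ * ‖1 - conj c * v‖)) ^ 2 := by
      unfold mder
      set A := ‖1 - conj c * v‖
      set B := ‖1 - conj b * v‖
      set E := ‖1 - conj b * c‖
      set q := 1 - ‖b‖ ^ 2
      field_simp
    rw [e1]
    have tri : ‖1 - conj b * c‖ ≤ ‖1 - conj b * v‖ + ‖1 - conj c * v‖ := by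
      have e : 1 - conj b * c = (1 - conj b * v) + conj b * (v - c) := by ring
      rw [e]
      refine (norm_add_le _ _).trans ?_
      rw [norm_mul, RCLike.norm_conj, norm_sub_rev v c]
      have := sub_le_den hcD hv
      have hb1 := mem_D.1 hb
      nlinarith [norm_nonneg (c - v)]
    have e2 : (‖1 - conj b * c‖ / (‖1 - conj b * v‖ * ‖1 - conj c * v‖)) ^ 2 ≤
        2 * (‖1 - conj b * v‖⁻¹ ^ 2 + ‖1 - conj c * v‖⁻¹ ^ 2) := by
      have h2 : ‖1 - conj b * c‖ / (‖1 - conj b * v‖ * ‖1 - conj c * v‖) ≤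
          ‖1 - conj b * v‖⁻¹ + ‖1 - conj c * v‖⁻¹ := by
        rw [div_le_iff₀ (by positivity), add_mul, ← mul_assoc, inv_mul_cancel₀ dbv.ne',
          mul_comm ‖1 - conj b * v‖, ← mul_assoc, inv_mul_cancel₀ dcv.ne']
        linarith
      have h3 : 0 ≤ ‖1 - conj b * c‖ / (‖1 - conj b * v‖ * ‖1 - conj c * v‖) := by positivity
      nlinarith [sq_nonneg (‖1 - conj b * v‖⁻¹ - ‖1 - conj c * v‖⁻¹)]
    have e3 : ∀ x ∈ unitDisk, ‖1 - conj x * v‖⁻¹ ^ 2 * (1 - ‖v‖ ^ 2) ^ p ≤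
        2 * ‖1 - conj v * x‖ ^ (-(2 - p)) := by
      intro x hx
      have d := den_pos hx hv
      have h2 := wt_le_den hx hv
      rw [den_symm v x]
      have h3 : (1 - ‖v‖ ^ 2) ^ p ≤ 2 * ‖1 - conj x * v‖ ^ p := by
        refine (Real.rpow_le_rpow hwt.le h2 hp0.le).trans ?_
        rw [Real.mul_rpow (by norm_num) d.le]
        gcongr
        calc (2:ℝ) ^ p ≤ 2 ^ (1:ℝ) := Real.rpow_le_rpow_of_exponent_le (by norm_num) hp1.le
          _ = 2 := by simp
      calc ‖1 - conj x * v‖⁻¹ ^ 2 * (1 - ‖v‖ ^ 2) ^ p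
          ≤ ‖1 - conj x * v‖⁻¹ ^ 2 * (2 * ‖1 - conj x * v‖ ^ p) := by gcongr
        _ = _ := by
          rw [show -(2 - p) = p - (2:ℕ) by push_cast; ring, Real.rpow_sub_natCast d.ne', inv_pow]
          ring
    simp only [neg_zero, Real.rpow_zero, one_mul]
    calc _ ≤ 2 * (‖1 - conj b * v‖⁻¹ ^ 2 + ‖1 - conj c * v‖⁻¹ ^ 2) * (1 - ‖v‖ ^ 2) ^ p := by gcongr
      _ ≤ _ := by nlinarith [e3 b hb, e3 c hcD]
  refine (setLIntegral_mono' meas_D hbd).trans ?_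
  rw [lintegral_const_mul' _ _ ENNReal.ofReal_ne_top, lintegral_add_left]
  swap
  · have := measurable_conj
    fun_prop
  calc _ ≤ ENNReal.ofReal 4 * (ENNReal.ofReal C + ENNReal.ofReal C) := by
        gcongr
        · exact hC c hcD
        · exact hC b hb
    _ = _ := by
      rw [← ENNReal.ofReal_add hC0 hC0, ← ENNReal.ofReal_mul (by norm_num)]
      congr 1; ring

/-- The logarithmic test function. -/
def Ltest (a z : ℂ) : ℂ := (Real.log 2 : ℝ) - Complex.log (1 - conj a * z)

theorem den_slit {a z : ℂ} (ha : a ∈ unitDisk) (hz : z ∈ unitDisk) :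
    1 - conj a * z ∈ Complex.slitPlane := by
  left
  have h : ‖conj a * z‖ < 1 := by
    rw [norm_mul, RCLike.norm_conj]
    have := mem_D.1 ha
    have := mem_D.1 hz
    nlinarith [norm_nonneg a, norm_nonneg z]
  have := Complex.re_le_norm (conj a * z)
  simp only [sub_re, one_re]
  linarith

theorem Ltest_hasDeriv {a z : ℂ} (ha : a ∈ unitDisk) (hz : z ∈ unitDisk) :
    HasDerivAt (Ltest a) (conj a / (1 - conj a * z)) z := by
  have h1 : HasDerivAt (fun z => 1 - conj a * z) (-conj a) z := by
    simpa using ((hasDerivAt_id z).const_mul (conj a)).const_sub 1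
  refine ((h1.clog (den_slit ha hz)).const_sub ((Real.log 2 : ℝ) : ℂ)).congr_deriv ?_
  ring

theorem Ltest_re {a z : ℂ} : (Ltest a z).re = Real.log 2 - Real.log ‖1 - conj a * z‖ := by
  rw [Ltest, sub_re, Complex.log_re, Complex.ofReal_re]

theorem Ltest_re_nonneg {a z : ℂ} (ha : a ∈ unitDisk) (hz : z ∈ unitDisk) :
    0 ≤ (Ltest a z).re := by
  rw [Ltest_re, sub_nonneg]
  exact Real.log_le_log (den_pos ha hz) (den_le_two ha hz)

theorem Ltest_im {a z : ℂ} : |(Ltest a z).im| ≤ π := by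
  rw [Ltest, sub_im, Complex.ofReal_im, zero_sub, abs_neg, Complex.log_im]
  exact Complex.abs_arg_le_pi _

theorem Ltest_norm {a z : ℂ} (ha : a ∈ unitDisk) (hz : z ∈ unitDisk) :
    ‖Ltest a z‖ ≤ Real.log 2 - Real.log (1 - ‖z‖) + π := by
  refine (Complex.norm_le_abs_re_add_abs_im _).trans ?_
  have h1 := Ltest_im (a := a) (z := z)
  rw [abs_of_nonneg (Ltest_re_nonneg ha hz), Ltest_re]
  have := Real.log_le_log (by linarith [mem_D.1 hz]) (one_sub_norm_le (z := z) ha)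
  linarith

theorem Iw_tsum {p : ℝ} {b : ℂ} {H : ℕ → ℂ → ℝ≥0∞} (hH : ∀ k, Measurable (H k)) {C : ℝ≥0∞}
    (hC : ∀ k, Iw p b (H k) ≤ C) :
    Iw p b (fun z => ∑' k, (2⁻¹ : ℝ≥0∞) ^ k * H k z) ≤ 4 * C := by
  have hs : ∀ t : ℝ≥0∞, (t ^ (1 / 2 : ℝ)) ^ 2 = t := by
    intro t
    rw [← ENNReal.rpow_natCast, ← ENNReal.rpow_mul]
    norm_num
  have hss : ∀ t : ℝ≥0∞, (t ^ (1 / 2 : ℝ)) * (t ^ (1 / 2 : ℝ)) = t := by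
    intro t
    rw [← sq, hs]
  have hgeo : ∑' k : ℕ, (2⁻¹ : ℝ≥0∞) ^ k = 2 := by
    rw [ENNReal.tsum_geometric, ENNReal.one_sub_inv_two, inv_inv]
  have h1 : ∀ z, (∑' k, (2⁻¹ : ℝ≥0∞) ^ k * H k z) ^ 2 ≤ 2 * ∑' k, (2⁻¹ : ℝ≥0∞) ^ k * H k z ^ 2 := by
    intro z
    have h := ennCS (μ := (Measure.count : Measure ℕ)) (f := fun k => ((2⁻¹ : ℝ≥0∞) ^ k) ^ (1 / 2 : ℝ))
      (g := fun k => ((2⁻¹ : ℝ≥0∞) ^ k) ^ (1 / 2 : ℝ) * H k z) (by fun_prop) (by fun_prop)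
    simp only [MeasureTheory.lintegral_count, ← mul_assoc, hss, hs, hgeo, mul_pow] at h
    exact h
  have h2 : Iw p b (fun z => ∑' k, (2⁻¹ : ℝ≥0∞) ^ k * H k z) ≤
      ∫⁻ z in unitDisk, 2 * ∑' k, (2⁻¹ : ℝ≥0∞) ^ k * (H k z ^ 2 *
        ENNReal.ofReal ((1 - ‖moebius b z‖ ^ 2) ^ p)) := by
    unfold Iw
    apply lintegral_mono
    intro z
    simp only
    calc _ ≤ (2 * ∑' k, (2⁻¹ : ℝ≥0∞) ^ k * H k z ^ 2) *
        ENNReal.ofReal ((1 - ‖moebius b z‖ ^ 2) ^ p) := by gcongr; exact h1 z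
      _ = _ := by
        rw [mul_assoc, ← ENNReal.tsum_mul_right]
        simp_rw [mul_assoc]
  refine h2.trans ?_
  have hmm := measurable_moebius b
  rw [lintegral_const_mul' _ _ (by simp), lintegral_tsum (by
    intro k
    have := hH k
    fun_prop)]
  calc 2 * ∑' k, ∫⁻ z in unitDisk, (2⁻¹ : ℝ≥0∞) ^ k * (H k z ^ 2 *
        ENNReal.ofReal ((1 - ‖moebius b z‖ ^ 2) ^ p))
      ≤ 2 * ∑' k : ℕ, (2⁻¹ : ℝ≥0∞) ^ k * C := by
        gcongr with k
        rw [lintegral_const_mul' _ _ (by simp)]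
        gcongr
        exact hC k
    _ = _ := by
        rw [ENNReal.tsum_mul_right, hgeo, ← mul_assoc]
        norm_num

/-- `Q_p` membership and lower bound of the sum of test functions. -/
theorem exists_test {p : ℝ} (hp0 : 0 < p) (hp1 : p < 1) (a : ℕ → ℂ) (ha : ∀ k, a k ∈ unitDisk) :
    ∃ F : ℂ → ℂ, MemQp p F ∧
      ∀ k, (2⁻¹ : ℝ) ^ k * (Real.log 2 - Real.log (1 - ‖a k‖ ^ 2)) ≤ ‖F (a k)‖ := by
  set f : ℕ → ℂ → ℂ := fun k z => (((2⁻¹ : ℝ) ^ k : ℝ) : ℂ) * Ltest (a k) z with hf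
  have hgeo : Summable fun k : ℕ => (2⁻¹ : ℝ) ^ k :=
    summable_geometric_of_lt_one (by norm_num) (by norm_num)
  have hgeo2 : ∑' k : ℕ, (2⁻¹ : ℝ) ^ k = 2 := by
    rw [tsum_geometric_of_lt_one (by norm_num) (by norm_num)]; norm_num
  have hn : ∀ r < 1, ∀ k, ∀ w ∈ ball (0:ℂ) r, ‖f k w‖ ≤
      (2⁻¹ : ℝ) ^ k * (Real.log 2 - Real.log (1 - r) + π) := by
    intro r hr k w hw
    rw [hf]
    simp only
    rw [norm_mul, Complex.norm_real, Real.norm_of_nonneg (by positivity)]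
    gcongr
    rw [mem_ball, dist_zero_right] at hw
    refine (Ltest_norm (ha k) (mem_D.2 (by linarith))).trans ?_
    have := Real.log_le_log (x := 1 - r) (y := 1 - ‖w‖) (by linarith) (by linarith)
    linarith
  have hfd : ∀ k, DifferentiableOn ℂ (f k) unitDisk := by
    intro k z hz
    exact (((Ltest_hasDeriv (ha k) hz).const_mul _).differentiableAt).differentiableWithinAt
  have hsub : ∀ r < 1, ball (0:ℂ) r ⊆ unitDisk := fun r hr => ball_subset_ball hr.le
  have hz_in : ∀ z ∈ unitDisk, ∃ r < 1, z ∈ ball (0:ℂ) r := by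
    intro z hz
    have := mem_D.1 hz
    exact ⟨(1 + ‖z‖) / 2, by linarith, by rw [mem_ball, dist_zero_right]; linarith⟩
  have hFd : DifferentiableOn ℂ (fun z => ∑' k, f k z) unitDisk := by
    intro z hz
    obtain ⟨r, hr, hzr⟩ := hz_in z hz
    have := Complex.differentiableOn_tsum_of_summable_norm (hgeo.mul_right _)
      (fun k => (hfd k).mono (hsub r hr)) isOpen_ball (hn r hr)
    exact (this.differentiableAt (isOpen_ball.mem_nhds hzr)).differentiableWithinAt
  have hsum : ∀ z ∈ unitDisk, Summable fun k => f k z := by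
    intro z hz
    obtain ⟨r, hr, hzr⟩ := hz_in z hz
    exact Summable.of_norm_bounded (hgeo.mul_right _) (fun k => hn r hr k z hzr)
  have hderiv : ∀ z ∈ unitDisk, HasSum (fun k => deriv (f k) z) (deriv (fun z => ∑' k, f k z) z) := by
    intro z hz
    obtain ⟨r, hr, hzr⟩ := hz_in z hz
    exact Complex.hasSum_deriv_of_summable_norm (hgeo.mul_right _)
      (fun k => (hfd k).mono (hsub r hr)) isOpen_ball (hn r hr) hzr
  have hre : ∀ z ∈ unitDisk, HasSum (fun k => (2⁻¹:ℝ) ^ k * (Ltest (a k) z).re)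
      (∑' k, f k z).re := by
    intro z hz
    have := (Complex.hasSum_re (hsum z hz).hasSum)
    simpa [hf, -Complex.ofReal_pow] using this
  have him : ∀ z ∈ unitDisk, HasSum (fun k => (2⁻¹:ℝ) ^ k * (Ltest (a k) z).im)
      (∑' k, f k z).im := by
    intro z hz
    have := (Complex.hasSum_im (hsum z hz).hasSum)
    simpa [hf, -Complex.ofReal_pow] using this
  have himb : ∀ z ∈ unitDisk, |(∑' k, f k z).im| ≤ 2 * π := by
    intro z hz
    rw [← (him z hz).tsum_eq, ← Real.norm_eq_abs]
    have hgs := hgeo.hasSum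
    rw [hgeo2] at hgs
    apply tsum_of_norm_bounded (hgs.mul_right π)
    intro k
    rw [norm_mul, Real.norm_of_nonneg (by positivity), Real.norm_eq_abs]
    gcongr
    exact Ltest_im
  obtain ⟨C, hC0, hC⟩ := test_bound hp0 hp1
  refine ⟨fun z => ∑' k, f k z, ⟨hFd, ?_, 4 * C, ?_⟩, ?_⟩
  · refine ⟨2 * π * ‖(∑' k, f k 0) ^ 2‖ + 2 * π * (8 * π ^ 2), fun r hr => ?_⟩
    set F := fun z => ∑' k, f k z with hF
    have hcm := circle_mean (F := fun z => F z ^ 2) (c := 0) (v := (r:ℂ)) (R := 1) (hFd.pow 2)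
      (by simp [abs_of_nonneg hr.1, hr.2])
    have hmem : ∀ t : ℝ, (r : ℂ) * Complex.exp (I * t) ∈ unitDisk := by
      intro t
      rw [mem_D, norm_mul, mul_comm I, Complex.norm_exp_ofReal_mul_I, mul_one, Complex.norm_real,
        Real.norm_of_nonneg hr.1]
      exact hr.2
    have hcont : Continuous fun t : ℝ => F ((r : ℂ) * Complex.exp (I * t)) := by
      apply ContinuousOn.comp_continuous hFd.continuousOn (by fun_prop) hmem
    have heq : ∀ t : ℝ, F (0 + circleMap 0 1 t * (r:ℂ)) ^ 2 = F ((r : ℂ) * Complex.exp (I * t)) ^ 2 := by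
      intro t
      congr 2
      simp only [circleMap, ofReal_one, one_mul, zero_add]
      rw [mul_comm I, mul_comm]
    simp_rw [heq] at hcm
    have hpt : ∀ t : ℝ, ‖F ((r : ℂ) * Complex.exp (I * t))‖ ^ 2 ≤
        (F ((r : ℂ) * Complex.exp (I * t)) ^ 2).re + 8 * π ^ 2 := by
      intro t
      have := himb _ (hmem t)
      have h2 := sq_le_sq' (abs_le.1 this).1 (abs_le.1 this).2
      rw [Complex.sq_norm, Complex.normSq_apply, sq, Complex.mul_re]
      simp only [hF] at *
      nlinarith
    have hre2 : ∫ t in (0:ℝ)..2 * π, (F ((r : ℂ) * Complex.exp (I * t)) ^ 2).re =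
        2 * π * (F 0 ^ 2).re := by
      have h3 := congrArg Complex.re hcm
      rw [Complex.real_smul, Complex.re_ofReal_mul] at h3
      rw [← h3]
      have := (Complex.reCLM).intervalIntegral_comp_comm (μ := volume) (a := 0) (b := 2 * π)
        (f := fun t : ℝ => F ((r : ℂ) * Complex.exp (I * t)) ^ 2)
        ((hcont.pow 2).intervalIntegrable _ _)
      simpa using this
    calc ∫ t in (0 : ℝ)..(2 * Real.pi), ‖F ((r : ℂ) * Complex.exp (Complex.I * t))‖ ^ 2
        ≤ ∫ t in (0 : ℝ)..(2 * Real.pi), ((F ((r : ℂ) * Complex.exp (I * t)) ^ 2).re + 8 * π ^ 2) := by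
          apply intervalIntegral.integral_mono (by positivity)
          · exact ((hcont.norm).pow 2).intervalIntegrable _ _
          · exact ((Complex.continuous_re.comp (hcont.pow 2)).add continuous_const).intervalIntegrable _ _
          · exact hpt
      _ = 2 * π * (F 0 ^ 2).re + 2 * π * (8 * π ^ 2) := by
          rw [intervalIntegral.integral_add, hre2, intervalIntegral.integral_const]
          · simp
          · exact (Complex.continuous_re.comp (hcont.pow 2)).intervalIntegrable _ _
          · exact continuous_const.intervalIntegrable _ _
      _ ≤ _ := by
          gcongr
          exact Complex.re_le_norm _
  · intro b hb
    rw [qpIntegral_eq]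
    have hle : ∀ z ∈ unitDisk, ‖deriv (fun z => ∑' k, f k z) z‖ₑ ≤
        ∑' k, (2⁻¹ : ℝ≥0∞) ^ k * ENNReal.ofReal (‖1 - conj (a k) * z‖⁻¹) := by
      intro z hz
      rw [← (hderiv z hz).tsum_eq]
      refine enorm_tsum_le_tsum_enorm.trans ?_
      gcongr with k
      rw [((Ltest_hasDeriv (ha k) hz).const_mul _).deriv, enorm_mul, ← ofReal_norm, ← ofReal_norm,
        Complex.norm_real, Real.norm_of_nonneg (by positivity), norm_div, RCLike.norm_conj,
        ENNReal.ofReal_pow (by norm_num), ENNReal.ofReal_inv_of_pos (by norm_num)]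
      simp only [ENNReal.ofReal_ofNat]
      gcongr
      rw [div_eq_mul_inv]
      have := mem_D.1 (ha k)
      have h2 := den_pos (ha k) hz
      exact mul_le_of_le_one_left (by positivity) this.le
    refine (Iw_mono hle).trans ?_
    refine (Iw_tsum (by intro k; fun_prop) (fun k => hC (a k) (ha k) b hb)).trans ?_
    rw [ENNReal.ofReal_mul (by norm_num)]
    simp
  · intro k
    refine le_trans ?_ (Complex.re_le_norm _)
    have h := hre (a k) (ha k)
    have h2 := le_hasSum h k (fun j _ => mul_nonneg (by positivity) (Ltest_re_nonneg (ha j) (ha k)))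
    rwa [Ltest_re, norm_wt (ha k)] at h2

theorem multiplier_bounded {p : ℝ} (hp0 : 0 < p) (hp1 : p < 1) {φ : ℂ → ℂ} (hφ : MemMQp p φ) :
    ∃ M : ℝ, 0 ≤ M ∧ ∀ z ∈ unitDisk, ‖φ z‖ ≤ M := by
  by_contra hcon
  push Not at hcon
  choose! a ha hφa using fun k : ℕ => hcon ((4:ℝ) ^ k) (by positivity)
  obtain ⟨F, hF, hFa⟩ := exists_test hp0 hp1 a ha
  obtain ⟨hd, -, C, hC⟩ := hφ.2 F hF
  obtain ⟨B, hB0, hB⟩ := bloch hp0 hp1 hd hC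
  set A := ‖φ 0 * F 0‖ with hA
  have hl2 : 0 < Real.log 2 := Real.log_pos (by norm_num)
  have key : ∀ k : ℕ, (2:ℝ) ^ k ≤ A / Real.log 2 + 2 * B := by
    intro k
    have h1 := diff_log hd hB0 hB (ha k) zero_mem_D
    have h2 : ‖moebius 0 (a k)‖ = ‖a k‖ := by simp [moebius]
    simp only [h2] at h1
    have h3 := norm_sub_norm_le (φ (a k) * F (a k)) (φ 0 * F 0)
    have hak := mem_D.1 (ha k)
    have hwt := wt_pos (ha k)
    set L := Real.log 2 - Real.log (1 - ‖a k‖ ^ 2) with hL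
    have hL1 : -Real.log (1 - ‖a k‖) ≤ L := by
      have : Real.log (1 - ‖a k‖ ^ 2) ≤ Real.log (2 * (1 - ‖a k‖)) := by
        apply Real.log_le_log hwt
        nlinarith [norm_nonneg (a k)]
      rw [Real.log_mul (by norm_num) (by linarith)] at this
      linarith
    have hL2 : Real.log 2 ≤ L := by
      have : Real.log (1 - ‖a k‖ ^ 2) ≤ 0 := Real.log_nonpos hwt.le (by nlinarith [norm_nonneg (a k)])
      linarith
    have hLp : 0 < L := by linarith
    have h4 : (4:ℝ) ^ k * ((2⁻¹) ^ k * L) ≤ ‖φ (a k) * F (a k)‖ := by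
      rw [norm_mul]
      exact mul_le_mul (hφa k).le (hFa k) (by positivity) (norm_nonneg _)
    have h5 : (4:ℝ) ^ k * ((2⁻¹) ^ k * L) = 2 ^ k * L := by
      rw [← mul_assoc, ← mul_pow]; norm_num
    rw [h5] at h4
    have h6 : A ≤ A / Real.log 2 * L := by
      rw [div_mul_eq_mul_div, le_div_iff₀ hl2]
      gcongr
    have h7 : (2:ℝ) ^ k * L ≤ (A / Real.log 2 + 2 * B) * L := by nlinarith
    exact le_of_mul_le_mul_right h7 hLp
  obtain ⟨k, hk⟩ := pow_unbounded_of_one_lt (A / Real.log 2 + 2 * B) (one_lt_two (α := ℝ))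
  exact absurd (key k) (not_le.2 hk)

theorem ennsq_add (x y : ℝ≥0∞) : (x + y) ^ 2 ≤ 2 * (x ^ 2 + y ^ 2) := by
  have h := ENNReal.rpow_add_le_mul_rpow_add_rpow x y (p := 2) (by norm_num)
  norm_num at h
  exact h

theorem Iw_add {p : ℝ} {a : ℂ} {H K : ℂ → ℝ≥0∞} (hH : AEMeasurable H (volume.restrict unitDisk)) :
    Iw p a (fun z => H z + K z) ≤ 2 * (Iw p a H + Iw p a K) := by
  unfold Iw
  have hm := measurable_moebius a
  rw [← lintegral_add_left' (by fun_prop), ← lintegral_const_mul' _ _ (by simp)]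
  apply lintegral_mono
  intro z
  simp only
  rw [← add_mul, ← mul_assoc]
  gcongr
  exact ennsq_add _ _

theorem Iw_const {p : ℝ} {a : ℂ} {H : ℂ → ℝ≥0∞} {c : ℝ≥0∞} (hc : c ≠ ⊤) :
    Iw p a (fun z => c * H z) = c ^ 2 * Iw p a H := by
  unfold Iw
  rw [← lintegral_const_mul' _ _ (by simp [hc])]
  simp_rw [mul_pow, mul_assoc]

def InX (p : ℝ) (H : ℂ → ℝ≥0∞) : Prop :=
  Measurable H ∧ ∀ F : ℂ → ℂ, MemQp p F → ∃ C : ℝ≥0∞, C ≠ ⊤ ∧ ∀ a ∈ unitDisk,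
    Iw p a (fun z => H z * ‖F z‖ₑ) ≤ C

theorem memQp_const {p : ℝ} (c : ℂ) : MemQp p (fun _ => c) := by
  refine ⟨differentiableOn_const _, ⟨2 * π * ‖c‖ ^ 2, fun r _ => by simp⟩, 0, fun a _ => ?_⟩
  rw [qpIntegral_eq]
  simp [Iw]

theorem Qp_aemeas {p : ℝ} {F : ℂ → ℂ} (hF : MemQp p F) : AEMeasurable F (volume.restrict unitDisk) :=
  hF.1.continuousOn.aemeasurable meas_D

theorem InX.add {p : ℝ} {H K : ℂ → ℝ≥0∞} (hH : InX p H) (hK : InX p K) :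
    InX p (fun z => H z + K z) := by
  refine ⟨hH.1.add hK.1, fun F hF => ?_⟩
  obtain ⟨C1, h1, h1'⟩ := hH.2 F hF
  obtain ⟨C2, h2, h2'⟩ := hK.2 F hF
  refine ⟨2 * (C1 + C2), by finiteness, fun a ha => ?_⟩
  have hm := Qp_aemeas hF
  have hm2 := hH.1
  simp_rw [add_mul]
  refine (Iw_add (by fun_prop)).trans ?_
  gcongr
  · exact h1' a ha
  · exact h2' a ha

theorem InX.zero {p : ℝ} : InX p (fun _ => 0) := by
  refine ⟨measurable_const, fun F hF => ⟨0, by simp, fun a ha => ?_⟩⟩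
  simp [Iw]

theorem InX.sum {p : ℝ} {ι : Type*} (s : Finset ι) {H : ι → ℂ → ℝ≥0∞} (hH : ∀ i, InX p (H i)) :
    InX p (fun z => ∑ i ∈ s, H i z) := by
  classical
  induction s using Finset.induction_on with
  | empty => simpa using InX.zero
  | insert i s hi ih =>
    simp_rw [Finset.sum_insert hi]
    exact (hH i).add ih

theorem InX_deriv {p : ℝ} (hp0 : 0 < p) (hp1 : p < 1) {φ : ℂ → ℂ} (hφ : MemMQp p φ) :
    InX p (fun z => ‖deriv φ z‖ₑ) := by
  obtain ⟨M, hM0, hM⟩ := multiplier_bounded hp0 hp1 hφ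
  refine ⟨(measurable_deriv φ).enorm, fun F hF => ?_⟩
  obtain ⟨C1, h1⟩ := (hφ.2 F hF).2.2
  obtain ⟨C2, h2⟩ := hF.2.2
  refine ⟨2 * (ENNReal.ofReal C1 + ENNReal.ofReal M ^ 2 * ENNReal.ofReal C2), by finiteness,
    fun a ha => ?_⟩
  have hle : ∀ z ∈ unitDisk, ‖deriv φ z‖ₑ * ‖F z‖ₑ ≤
      ‖deriv (fun z => φ z * F z) z‖ₑ + ENNReal.ofReal M * ‖deriv F z‖ₑ := by
    intro z hz
    have d1 := hφ.1.1.differentiableAt (isOpen_D.mem_nhds hz)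
    have d2 := hF.1.differentiableAt (isOpen_D.mem_nhds hz)
    have e : deriv φ z * F z = deriv (fun z => φ z * F z) z - φ z * deriv F z := by
      have := deriv_mul d1 d2
      have e2 : deriv (fun z => φ z * F z) z = deriv (φ * F) z := rfl
      rw [e2, this]
      ring
    rw [← enorm_mul, e]
    refine enorm_sub_le.trans ?_
    rw [enorm_mul]
    gcongr
    rw [← ofReal_norm]
    exact ENNReal.ofReal_le_ofReal (hM z hz)
  refine (Iw_mono hle).trans ?_
  refine (Iw_add (measurable_deriv _).enorm.aemeasurable).trans ?_
  rw [Iw_const ENNReal.ofReal_ne_top, ← qpIntegral_eq, ← qpIntegral_eq]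
  gcongr
  · exact h1 a ha
  · exact h2 a ha

theorem Tk_congr {ε : ℝ} {H K : ℂ → ℝ≥0∞} (h : ∀ w ∈ unitDisk, H w = K w) (z : ℂ) :
    Tk ε H z = Tk ε K z := by
  unfold Tk
  apply setLIntegral_congr_fun meas_D
  intro w hw
  simp only [h w hw]

theorem InX_Tk {p : ℝ} (hp0 : 0 < p) (hp1 : p < 1) {H : ℂ → ℝ≥0∞} (hH : InX p H) :
    InX p (Tk 0 H) := by
  have hHm := hH.1
  refine ⟨measurable_Tk 0 hHm, fun F hF => ?_⟩
  set ε := (1 - p) / 4 with hε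
  have hε0 : 0 < ε := by linarith
  obtain ⟨CT, hCT, hT⟩ := Iw_Tk hp0 hp1
  obtain ⟨C1, hC1, h1⟩ := hH.2 F hF
  obtain ⟨C2, hC2, h2⟩ := hH.2 (fun _ => 1) (memQp_const 1)
  obtain ⟨Cq, hCq⟩ := hF.2.2
  obtain ⟨B, hB0, hB⟩ := bloch hp0 hp1 hF.1 hCq
  obtain ⟨Cd, hCd0, hCd⟩ := diff_pow hF.1 hB0 hB hε0
  set K : ℂ → ℝ≥0∞ := unitDisk.indicator (fun w => H w * ‖F w‖ₑ) with hK
  have hKm : Measurable K := by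
    have hFm : Measurable (unitDisk.indicator F) := by
      classical
      have := hF.1.continuousOn.measurable_piecewise (continuousOn_const (c := (0:ℂ)) (s := unitDiskᶜ)) meas_D
      rwa [← Set.piecewise_eq_indicator]
    have : K = fun w => H w * ‖unitDisk.indicator F w‖ₑ := by
      ext w
      by_cases hw : w ∈ unitDisk <;> simp [hK, hw]
    rw [this]
    fun_prop
  have hKe : ∀ w ∈ unitDisk, K w = H w * ‖F w‖ₑ := fun w hw => by simp [hK, hw]
  have hle : ∀ z ∈ unitDisk, Tk 0 H z * ‖F z‖ₑ ≤ Tk ε K z + ENNReal.ofReal Cd * Tk ε H z := by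
    intro z hz
    have hfin : ‖F z‖ₑ ≠ ⊤ := enorm_ne_top
    have step : Tk 0 H z * ‖F z‖ₑ ≤ Tk 0 K z + ENNReal.ofReal Cd * Tk ε H z := by
      unfold Tk
      rw [← lintegral_mul_const' _ _ hfin, ← lintegral_const_mul' _ _ ENNReal.ofReal_ne_top,
        ← lintegral_add_left (by have := measurable_kap_r 0 z; fun_prop)]
      apply setLIntegral_mono' meas_D
      intro w hw
      rw [hKe w hw]
      have t1 : ‖F z‖ₑ ≤ ‖F w‖ₑ + ENNReal.ofReal (Cd *
          ((‖1 - conj w * z‖ ^ 2) / ((1 - ‖z‖ ^ 2) * (1 - ‖w‖ ^ 2))) ^ ε) := by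
        calc ‖F z‖ₑ = ‖F w + (F z - F w)‖ₑ := by congr 1; ring
          _ ≤ ‖F w‖ₑ + ‖F z - F w‖ₑ := enorm_add_le _ _
          _ ≤ _ := by
            gcongr
            rw [← ofReal_norm]
            exact ENNReal.ofReal_le_ofReal (hCd z hz w hw)
      calc ENNReal.ofReal (kap 0 z w) * H w * ‖F z‖ₑ
          ≤ ENNReal.ofReal (kap 0 z w) * H w * (‖F w‖ₑ + ENNReal.ofReal (Cd *
          ((‖1 - conj w * z‖ ^ 2) / ((1 - ‖z‖ ^ 2) * (1 - ‖w‖ ^ 2))) ^ ε)) := by gcongr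
        _ = _ := by
          rw [← kap_zero_le hε0.le hz hw, ENNReal.ofReal_mul hCd0,
            ENNReal.ofReal_mul (kap_nonneg hz hw)]
          ring
    refine step.trans ?_
    gcongr
    exact Tk_mono hε0.le hz K
  refine ⟨2 * (CT * C1 + ENNReal.ofReal Cd ^ 2 * (CT * C2)), by finiteness, fun a ha => ?_⟩
  refine (Iw_mono hle).trans ?_
  refine (Iw_add (measurable_Tk ε hKm).aemeasurable).trans ?_
  rw [Iw_const ENNReal.ofReal_ne_top]
  gcongr
  · refine (hT a ha K hKm).trans ?_
    gcongr
    refine le_trans (Iw_mono fun w hw => (hKe w hw).le) (h1 a ha)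
  · refine (hT a ha H hHm).trans ?_
    gcongr
    simpa using h2 a ha

/-- Sufficient condition for multipliers. -/
theorem memMQp_of {p : ℝ} {G : ℂ → ℂ} {H : ℂ → ℝ≥0∞} (hG : DifferentiableOn ℂ G unitDisk)
    {M : ℝ} (hM0 : 0 ≤ M) (hM : ∀ z ∈ unitDisk, ‖G z‖ ≤ M) (hH : InX p H) {c : ℝ≥0∞} (hc : c ≠ ⊤)
    (hd : ∀ z ∈ unitDisk, ‖deriv G z‖ₑ ≤ c * H z) : MemMQp p G := by
  have main : ∀ f : ℂ → ℂ, MemQp p f → MemQp p (fun z => G z * f z) := by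
    intro f hf
    refine ⟨hG.mul hf.1, ?_, ?_⟩
    · obtain ⟨N, hN⟩ := hf.2.1
      refine ⟨M ^ 2 * N, fun r hr => ?_⟩
      have hmem : ∀ t : ℝ, (r : ℂ) * Complex.exp (I * t) ∈ unitDisk := by
        intro t
        rw [mem_D, norm_mul, mul_comm I, Complex.norm_exp_ofReal_mul_I, mul_one, Complex.norm_real,
          Real.norm_of_nonneg hr.1]
        exact hr.2
      have hc1 : Continuous fun t : ℝ => G ((r : ℂ) * Complex.exp (I * t)) := by
        apply ContinuousOn.comp_continuous hG.continuousOn (by fun_prop) hmem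
      have hc2 : Continuous fun t : ℝ => f ((r : ℂ) * Complex.exp (I * t)) := by
        apply ContinuousOn.comp_continuous hf.1.continuousOn (by fun_prop) hmem
      calc _ ≤ ∫ t in (0:ℝ)..2 * π, M ^ 2 * ‖f ((r : ℂ) * Complex.exp (I * t))‖ ^ 2 := by
            apply intervalIntegral.integral_mono (by positivity)
            · exact (((hc1.mul hc2).norm).pow 2).intervalIntegrable _ _
            · exact (continuous_const.mul (hc2.norm.pow 2)).intervalIntegrable _ _
            · intro t
              simp only
              rw [norm_mul, mul_pow]
              gcongr
              exact hM _ (hmem t)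
        _ ≤ _ := by
            rw [intervalIntegral.integral_const_mul]
            gcongr
            exact hN r hr
    · obtain ⟨C1, h1⟩ := hf.2.2
      obtain ⟨C2, hC2, h2⟩ := hH.2 f hf
      have hfin : 2 * (ENNReal.ofReal M ^ 2 * ENNReal.ofReal C1 + c ^ 2 * C2) ≠ ⊤ := by finiteness
      refine ⟨(2 * (ENNReal.ofReal M ^ 2 * ENNReal.ofReal C1 + c ^ 2 * C2)).toReal, fun a ha => ?_⟩
      rw [ENNReal.ofReal_toReal hfin, qpIntegral_eq]
      have hle : ∀ z ∈ unitDisk, ‖deriv (fun z => G z * f z) z‖ₑ ≤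
          ENNReal.ofReal M * ‖deriv f z‖ₑ + c * (H z * ‖f z‖ₑ) := by
        intro z hz
        have d1 := hG.differentiableAt (isOpen_D.mem_nhds hz)
        have d2 := hf.1.differentiableAt (isOpen_D.mem_nhds hz)
        have e : deriv (fun z => G z * f z) z = G z * deriv f z + deriv G z * f z := by
          have := deriv_mul d1 d2
          have e2 : deriv (fun z => G z * f z) z = deriv (G * f) z := rfl
          rw [e2, this]
          ring
        rw [e]
        refine (enorm_add_le _ _).trans ?_
        rw [enorm_mul, enorm_mul, ← mul_assoc]
        gcongr
        · rw [← ofReal_norm]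
          exact ENNReal.ofReal_le_ofReal (hM z hz)
        · exact hd z hz
      refine (Iw_mono hle).trans ?_
      refine (Iw_add (by have := (measurable_deriv f); fun_prop)).trans ?_
      rw [Iw_const ENNReal.ofReal_ne_top, Iw_const hc, ← qpIntegral_eq]
      gcongr
      · exact h1 a ha
      · exact h2 a ha
  refine ⟨?_, main⟩
  have := main (fun _ => 1) (memQp_const 1)
  simpa using this

/-- The pointwise bound for `T H`. -/
theorem InX_bound {p : ℝ} (hp0 : 0 < p) (hp1 : p < 1) {H : ℂ → ℝ≥0∞} (hH : InX p H) :
    ∃ M : ℝ, 0 ≤ M ∧ ∀ z ∈ unitDisk, ENNReal.ofReal (1 - ‖z‖ ^ 2) * Tk 0 H z ≤ ENNReal.ofReal M := by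
  obtain ⟨C, hC, h⟩ := Tk_bound hp0 hp1
  obtain ⟨C2, hC2, h2⟩ := hH.2 (fun _ => 1) (memQp_const 1)
  refine ⟨Real.sqrt (C * C2).toReal, by positivity, fun z hz => ?_⟩
  have h3 := (h z hz H hH.1).trans (mul_le_mul_right (a := C) (by simpa using h2 z hz))
  have hfin : C * C2 ≠ ⊤ := by finiteness
  rw [← ENNReal.ofReal_toReal hfin, ← Real.sq_sqrt (ENNReal.toReal_nonneg (a := C * C2)),
    ENNReal.ofReal_pow (by positivity)] at h3
  exact (ENNReal.pow_le_pow_left_iff (by norm_num)).1 h3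

theorem ball_half {c z : ℂ} {R : ℝ} (hz : z ∈ ball c (R / 2)) : ball z (R / 2) ⊆ ball c R := by
  intro w hw
  rw [mem_ball] at *
  linarith [dist_triangle w z c]

theorem lemP {α : Type*} [MeasurableSpace α] {μ : Measure α} {F : ℂ → α → ℂ} {c : ℂ} {R : ℝ}
    (hR : 0 < R) {b : α → ℝ} (hm : ∀ z ∈ ball c R, AEStronglyMeasurable (F z) μ)
    (hd : ∀ᵐ x ∂μ, DifferentiableOn ℂ (fun z => F z x) (ball c R))
    (hb : ∀ᵐ x ∂μ, ∀ z ∈ ball c R, ‖F z x‖ ≤ b x) (hbi : Integrable b μ) :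
    Integrable (fun x => deriv (fun z => F z x) c) μ ∧
      HasDerivAt (fun z => ∫ x, F z x ∂μ) (∫ x, deriv (fun z => F z x) c ∂μ) c := by
  have hc : c ∈ ball c R := mem_ball_self hR
  refine hasDerivAt_integral_of_dominated_loc_of_deriv_le (F := F) (𝕜 := ℂ)
    (F' := fun z x => deriv (fun z => F z x) z)
    (s := ball c (R / 2)) (bound := fun x => 2 * b x / (R / 2)) (ball_mem_nhds c (by positivity)) ?_ ?_ ?_ ?_ ?_ ?_
  · filter_upwards [ball_mem_nhds c hR] with z hz using hm z hz
  · refine Integrable.mono' hbi (hm c hc) ?_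
    filter_upwards [hb] with x hx using hx c hc
  · have ht : Tendsto (fun n : ℕ => (R / 2 : ℝ) * (1 / ((n : ℝ) + 1))) atTop (nhds 0) := by
      simpa using tendsto_one_div_add_atTop_nhds_zero_nat.const_mul (R / 2)
    have hin : ∀ n : ℕ, 0 < (R / 2 : ℝ) * (1 / ((n : ℝ) + 1)) ∧ (R / 2 : ℝ) * (1 / ((n : ℝ) + 1)) < R := by
      intro n
      refine ⟨by positivity, ?_⟩
      have : 1 / ((n : ℝ) + 1) ≤ 1 := by
        rw [div_le_one (by positivity)]; linarith [n.cast_nonneg (α := ℝ)]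
      nlinarith
    refine aestronglyMeasurable_of_tendsto_ae atTop (f := fun (n : ℕ) x =>
      (((R / 2 : ℝ) * (1 / ((n : ℝ) + 1)) : ℝ) : ℂ)⁻¹ • (F (c + (((R / 2 : ℝ) * (1 / ((n : ℝ) + 1)) : ℝ) : ℂ)) x - F c x)) ?_ ?_
    · intro n
      refine AEStronglyMeasurable.const_smul (𝕜 := ℂ) ((hm _ ?_).sub (hm c hc)) _
      rw [mem_ball, dist_eq_norm, add_sub_cancel_left, Complex.norm_real, Real.norm_of_nonneg (hin n).1.le]
      exact (hin n).2
    · filter_upwards [hd] with x hx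
      have h1 := (hx.differentiableAt (ball_mem_nhds c hR)).hasDerivAt
      rw [hasDerivAt_iff_tendsto_slope_zero] at h1
      refine h1.comp ?_
      rw [tendsto_nhdsWithin_iff]
      constructor
      · have := (Complex.continuous_ofReal.tendsto 0).comp ht
        rw [Complex.ofReal_zero] at this
        exact this
      · refine Eventually.of_forall fun n => ?_
        have := (hin n).1.ne'
        simp only [mem_compl_iff, mem_singleton_iff]
        exact_mod_cast this
  · filter_upwards [hd, hb] with x hx hbx z hz
    have hs := ball_half hz
    refine norm_deriv_le_div_of_mapsTo_ball (hx.mono hs) ?_ (by positivity)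
    intro w hw
    rw [mem_closedBall, dist_eq_norm]
    have h1 := hbx w (hs hw)
    have h2 := hbx z (hs (mem_ball_self (by positivity)))
    linarith [norm_sub_le (F w x) (F z x)]
  · exact (hbi.const_mul 2).div_const _
  · filter_upwards [hd] with x hx z hz
    refine (hx.differentiableAt (isOpen_ball.mem_nhds ?_)).hasDerivAt
    exact ball_subset_ball (by linarith) hz

theorem lemP_diff {α : Type*} [MeasurableSpace α] {μ : Measure α} {F : ℂ → α → ℂ} {U : Set ℂ}
    (hU : IsOpen U) {b : α → ℝ} (hm : ∀ z ∈ U, AEStronglyMeasurable (F z) μ)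
    (hd : ∀ᵐ x ∂μ, DifferentiableOn ℂ (fun z => F z x) U)
    (hb : ∀ᵐ x ∂μ, ∀ z ∈ U, ‖F z x‖ ≤ b x) (hbi : Integrable b μ) :
    DifferentiableOn ℂ (fun z => ∫ x, F z x ∂μ) U := by
  intro z hz
  obtain ⟨r, hr, hs⟩ := Metric.isOpen_iff.1 hU z hz
  refine ((lemP hr (fun w hw => hm w (hs hw)) ?_ ?_ hbi).2).differentiableAt.differentiableWithinAt
  · filter_upwards [hd] with x hx using hx.mono hs
  · filter_upwards [hb] with x hx w hw using hx w (hs hw)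

/-- layer cake -/
theorem lem_upper (m : Measure ℝ) [IsFiniteMeasure m] (t : ℝ≥0∞) : m {x | m (Ici x) ≤ t} ≤ t := by
  have hmeas : MeasurableSet {x | m (Ici x) ≤ t} := by
    apply OrdConnected.measurableSet
    refine IsUpperSet.ordConnected ?_
    intro a b hab ha
    exact (measure_mono (Ici_subset_Ici.2 hab)).trans ha
  rw [hmeas.measure_eq_iSup_isCompact]
  simp only [iSup_le_iff]
  intro K hK hKc
  rcases K.eq_empty_or_nonempty with rfl | hne
  · simp
  · obtain ⟨x, hx, hmin⟩ := hKc.exists_isLeast hne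
    exact (measure_mono (fun y hy => hmin hy)).trans (hK hx)

theorem lem_layer (m : Measure ℝ) [IsFiniteMeasure m] :
    ∫⁻ x, ENNReal.ofReal (Real.exp (-(m (Ici x)).toReal)) ∂m ≤ 1 := by
  have hN : Measurable fun x => (m (Ici x)).toReal := by
    apply Antitone.measurable
    intro a b hab
    exact ENNReal.toReal_mono (by finiteness) (measure_mono (Ici_subset_Ici.2 hab))
  have h1 : ∀ x, ENNReal.ofReal (Real.exp (-(m (Ici x)).toReal)) =
      ∫⁻ t in Ioi (0:ℝ), (if (m (Ici x)).toReal < t then ENNReal.ofReal (Real.exp (-t)) else 0) := by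
    intro x
    have h0 : 0 ≤ (m (Ici x)).toReal := ENNReal.toReal_nonneg
    set y := (m (Ici x)).toReal
    rw [← integral_exp_neg_Ioi, ofReal_integral_eq_lintegral_ofReal (integrableOn_exp_neg_Ioi y)
      (ae_of_all _ fun t => (Real.exp_pos _).le)]
    rw [← lintegral_indicator measurableSet_Ioi, ← lintegral_indicator measurableSet_Ioi]
    congr 1; ext t
    simp only [indicator, mem_Ioi]
    by_cases h : y < t
    · simp [h, h0.trans_lt h]
    · simp [h]
  simp_rw [h1]
  rw [lintegral_lintegral_swap]
  · calc _ ≤ ∫⁻ t in Ioi (0:ℝ), ENNReal.ofReal (Real.exp (-t) * t) := by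
          refine setLIntegral_mono (by fun_prop) fun t ht => ?_
          calc _ = ∫⁻ x, ({x | (m (Ici x)).toReal < t}.indicator (fun _ => ENNReal.ofReal (Real.exp (-t)))) x ∂m := by
                rfl
            _ = ENNReal.ofReal (Real.exp (-t)) * m {x | (m (Ici x)).toReal < t} := by
                rw [lintegral_indicator_const]
                exact measurableSet_lt hN measurable_const
            _ ≤ _ := by
                rw [ENNReal.ofReal_mul (Real.exp_pos _).le]
                gcongr
                refine (measure_mono ?_).trans (lem_upper m _)
                intro x (hx : _ < t)
                exact (ENNReal.le_ofReal_iff_toReal_le (by finiteness) (le_of_lt ht)).2 hx.le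
      _ = ENNReal.ofReal (∫ t in Ioi (0:ℝ), Real.exp (-t) * t) := by
          rw [ofReal_integral_eq_lintegral_ofReal]
          · have := Real.GammaIntegral_convergent (s := 2) (by norm_num)
            norm_num at this; exact this
          · exact (ae_restrict_iff' measurableSet_Ioi).2 (ae_of_all _ fun t ht => mul_nonneg (Real.exp_pos _).le (le_of_lt ht))
      _ = 1 := by
          have := Real.Gamma_eq_integral (s := 2) (by norm_num)
          norm_num at this
          rw [← this]; simp
  · apply Measurable.aemeasurable
    refine Measurable.ite ?_ (by fun_prop) measurable_const
    exact measurableSet_lt (by exact hN.comp measurable_fst) measurable_snd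

def tau (h : ℂ → ℝ) (z : ℂ) : ℝ := ∫ w in unitDisk, h w / ‖1 - conj w * z‖ ^ 2

structure JH (h : ℂ → ℝ) (M C0 : ℝ) : Prop where
  meas : Measurable h
  nn : ∀ z, 0 ≤ h z
  int : IntegrableOn h unitDisk
  M0 : 0 ≤ M
  C00 : 0 ≤ C0
  tau_le : ∀ z ∈ unitDisk, (1 - ‖z‖ ^ 2) * tau h z ≤ M
  sub : ∀ z ∈ unitDisk, ∀ ζ ∈ ball z ((1 - ‖z‖) / 2), h ζ ≤ C0 * tau h z

def Je (h : ℂ → ℝ) (z ζ : ℂ) : ℂ :=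
  ∫ w in unitDisk, (((if ‖ζ‖ ≤ ‖w‖ then 2 * h w else 0 : ℝ) : ℂ)) / (1 - conj w * z)

def Jk (h : ℂ → ℝ) (z ζ : ℂ) : ℂ :=
  ((1 - ‖ζ‖ ^ 2 : ℝ) : ℂ) / (1 - conj ζ * z) * Complex.exp (Je h ζ ζ - Je h z ζ)

section
variable {h : ℂ → ℝ} {M C0 : ℝ}

theorem tau_nonneg (H : JH h M C0) (z : ℂ) : 0 ≤ tau h z :=
  integral_nonneg fun w => div_nonneg (H.nn w) (by positivity)

theorem tau_int (H : JH h M C0) {z : ℂ} (hz : z ∈ unitDisk) :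
    IntegrableOn (fun w => h w / ‖1 - conj w * z‖ ^ 2) unitDisk := by
  have hm := H.meas
  have := measurable_conj
  have hz' := mem_D.1 hz
  refine Integrable.mono' (H.int.div_const ((1 - ‖z‖) ^ 2)) (Measurable.aestronglyMeasurable (by fun_prop)) ?_
  refine (ae_restrict_iff' meas_D).2 (ae_of_all _ fun w hw => ?_)
  rw [Real.norm_of_nonneg (div_nonneg (H.nn w) (by positivity))]
  have := one_sub_norm_le (z := z) hw
  have : 0 < 1 - ‖z‖ := by linarith
  exact div_le_div_of_nonneg_left (H.nn w) (by positivity) (by gcongr)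

theorem int_h_le (H : JH h M C0) : ∫ w in unitDisk, h w ≤ M := by
  have := H.tau_le 0 zero_mem_D
  simpa [tau] using this

theorem Je_meas (H : JH h M C0) : Measurable (fun p : ℂ × ℂ => Je h p.1 p.2) := by
  have hm := H.meas
  have hc := measurable_conj
  unfold Je
  have : Measurable (fun q : (ℂ × ℂ) × ℂ => (((if ‖q.1.2‖ ≤ ‖q.2‖ then 2 * h q.2 else 0 : ℝ) : ℂ)) / (1 - conj q.2 * q.1.1)) := by
    refine Measurable.div ?_ ?_
    · refine Complex.measurable_ofReal.comp (Measurable.ite ?_ (by fun_prop) measurable_const)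
      exact measurableSet_le (by fun_prop) (by fun_prop)
    · exact (measurable_const.sub ((hc.comp measurable_snd).mul (by fun_prop)))
  exact (this.stronglyMeasurable.integral_prod_right' (ν := volume.restrict unitDisk)).measurable

theorem Jk_meas (H : JH h M C0) : Measurable (fun p : ℂ × ℂ => Jk h p.1 p.2) := by
  have hc := measurable_conj
  have h1 := Je_meas H
  have h2 : Measurable (fun p : ℂ × ℂ => Je h p.2 p.2) :=
    h1.comp (measurable_snd.prodMk measurable_snd)
  have h3 : Measurable (fun p : ℂ × ℂ => conj p.2) := hc.comp measurable_snd
  unfold Jk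
  fun_prop

theorem Je_num_nonneg (H : JH h M C0) (ζ w : ℂ) : 0 ≤ (if ‖ζ‖ ≤ ‖w‖ then 2 * h w else 0 : ℝ) := by
  split_ifs
  · have := H.nn w; positivity
  · exact le_rfl

theorem Je_num_le (H : JH h M C0) (ζ w : ℂ) : (if ‖ζ‖ ≤ ‖w‖ then 2 * h w else 0 : ℝ) ≤ 2 * h w := by
  split_ifs
  · exact le_rfl
  · have := H.nn w; positivity

theorem Je_num_meas (H : JH h M C0) (ζ : ℂ) : Measurable (fun w : ℂ => (if ‖ζ‖ ≤ ‖w‖ then 2 * h w else 0 : ℝ)) := by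
  have hm := H.meas
  exact Measurable.ite (measurableSet_le (by fun_prop) (by fun_prop)) (by fun_prop) measurable_const

theorem Je_int (H : JH h M C0) (ζ : ℂ) {z : ℂ} (hz : z ∈ unitDisk) :
    IntegrableOn (fun w => (((if ‖ζ‖ ≤ ‖w‖ then 2 * h w else 0 : ℝ) : ℂ)) / (1 - conj w * z)) unitDisk := by
  have hm := Je_num_meas H ζ
  have := measurable_conj
  have hz' := mem_D.1 hz
  refine Integrable.mono' ((H.int.const_mul 2).div_const (1 - ‖z‖)) (Measurable.aestronglyMeasurable (by fun_prop)) ?_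
  refine (ae_restrict_iff' meas_D).2 (ae_of_all _ fun w hw => ?_)
  rw [norm_div, Complex.norm_real, Real.norm_of_nonneg (Je_num_nonneg H ζ w)]
  have := one_sub_norm_le (z := z) hw
  have : 0 < 1 - ‖z‖ := by linarith
  exact div_le_div₀ (by have := H.nn w; positivity) (Je_num_le H ζ w) this (by assumption)

theorem Je_deriv (H : JH h M C0) (ζ : ℂ) {z : ℂ} (hz : z ∈ unitDisk) :
    DifferentiableAt ℂ (fun z => Je h z ζ) z ∧ ‖deriv (fun z => Je h z ζ) z‖ ≤ 2 * tau h z := by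
  have hm := Je_num_meas H ζ
  have := measurable_conj
  have hz' := mem_D.1 hz
  have hr : 0 < (1 - ‖z‖) / 2 := by linarith
  have hnear : ∀ z' ∈ ball z ((1 - ‖z‖) / 2), (1 - ‖z‖) / 2 ≤ 1 - ‖z'‖ := by
    intro z' hz'
    rw [mem_ball, dist_eq_norm] at hz'
    linarith [norm_le_insert' z' z]
  have hD : ∀ w ∈ unitDisk, ∀ z' ∈ unitDisk, HasDerivAt (fun z => (((if ‖ζ‖ ≤ ‖w‖ then 2 * h w else 0 : ℝ) : ℂ)) / (1 - conj w * z))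
      ((((if ‖ζ‖ ≤ ‖w‖ then 2 * h w else 0 : ℝ) : ℂ)) * conj w / (1 - conj w * z') ^ 2) z' := by
    intro w hw z' hz'
    have h1 : HasDerivAt (fun z => 1 - conj w * z) (- conj w) z' := by
      simpa using ((hasDerivAt_id z').const_mul (conj w)).const_sub 1
    refine ((hasDerivAt_const z' (((if ‖ζ‖ ≤ ‖w‖ then 2 * h w else 0 : ℝ) : ℂ))).div h1 (den_ne hw hz')).congr_deriv ?_
    simp
  have key := lemP (μ := volume.restrict unitDisk) (c := z) (R := (1 - ‖z‖) / 2)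
    (F := fun z w => (((if ‖ζ‖ ≤ ‖w‖ then 2 * h w else 0 : ℝ) : ℂ)) / (1 - conj w * z))
    (b := fun w => 2 * h w / ((1 - ‖z‖) / 2)) hr
    (fun z' _ => Measurable.aestronglyMeasurable (by fun_prop)) ?_ ?_ ((H.int.const_mul 2).div_const _)
  · refine ⟨key.2.differentiableAt, ?_⟩
    have e : deriv (fun z => Je h z ζ) z = _ := key.2.deriv
    rw [e]
    unfold tau
    rw [← integral_const_mul]
    refine norm_integral_le_of_norm_le ((tau_int H hz).const_mul 2) ?_
    refine (ae_restrict_iff' meas_D).2 (ae_of_all _ fun w hw => ?_)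
    rw [(hD w hw z hz).deriv, norm_div, norm_mul, Complex.norm_real, Real.norm_of_nonneg (Je_num_nonneg H ζ w),
      RCLike.norm_conj, norm_pow, ← mul_div_assoc]
    refine div_le_div_of_nonneg_right ?_ (by positivity)
    have h1 := Je_num_le H ζ w
    have h2 := Je_num_nonneg H ζ w
    have h3 := mem_D.1 hw
    nlinarith [norm_nonneg w]
  · refine (ae_restrict_iff' meas_D).2 (ae_of_all _ fun w hw => ?_)
    intro z' hz'
    refine (hD w hw z' ?_).differentiableAt.differentiableWithinAt
    rw [mem_D]; linarith [hnear z' hz']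
  · refine (ae_restrict_iff' meas_D).2 (ae_of_all _ fun w hw => ?_)
    intro z' hz'
    rw [norm_div, Complex.norm_real, Real.norm_of_nonneg (Je_num_nonneg H ζ w)]
    have h1 := one_sub_norm_le (z := z') hw
    have h2 := hnear z' hz'
    exact div_le_div₀ (by have := H.nn w; positivity) (Je_num_le H ζ w) hr (by linarith)

theorem two_re_inv {u : ℂ} (hu : u ≠ 1) : 2 * ((1 - u)⁻¹).re = 1 + (1 - ‖u‖ ^ 2) / ‖1 - u‖ ^ 2 := by
  have h1 : ‖1 - u‖ ^ 2 ≠ 0 := by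
    have : 1 - u ≠ 0 := sub_ne_zero.2 (Ne.symm hu)
    positivity
  rw [Complex.inv_re, ← Complex.sq_norm]
  rw [eq_comm, ← eq_sub_iff_add_eq', div_eq_iff h1, sub_mul, mul_assoc, div_mul_cancel₀ _ h1]
  rw [Complex.sq_norm, Complex.sq_norm, Complex.normSq_apply, Complex.normSq_apply]
  simp; ring

theorem Je_re (H : JH h M C0) (ζ : ℂ) {z : ℂ} (hz : z ∈ unitDisk) :
    (Je h z ζ).re = ∫ w in unitDisk, (if ‖ζ‖ ≤ ‖w‖ then h w else 0) * (1 + (1 - ‖conj w * z‖ ^ 2) / ‖1 - conj w * z‖ ^ 2) := by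
  unfold Je
  have := Complex.reCLM.integral_comp_comm (Je_int H ζ hz)
  simp only [Complex.reCLM_apply] at this
  rw [← this]
  refine setIntegral_congr_fun meas_D fun w hw => ?_
  have hne : conj w * z ≠ 1 := fun h => den_ne hw hz (by rw [h]; ring)
  rw [← two_re_inv hne, div_eq_mul_inv, Complex.re_ofReal_mul]
  split_ifs <;> ring

theorem Je_re_int (H : JH h M C0) (ζ : ℂ) {z : ℂ} (hz : z ∈ unitDisk) :
    IntegrableOn (fun w => (if ‖ζ‖ ≤ ‖w‖ then h w else 0) * (1 + (1 - ‖conj w * z‖ ^ 2) / ‖1 - conj w * z‖ ^ 2)) unitDisk := by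
  have h1 := (Je_int H ζ hz).re
  refine Integrable.congr h1 ?_
  refine (ae_restrict_iff' meas_D).2 (ae_of_all _ fun w hw => ?_)
  have hne : conj w * z ≠ 1 := fun h => den_ne hw hz (by rw [h]; ring)
  simp only [RCLike.re_to_complex]
  rw [← two_re_inv hne, div_eq_mul_inv, Complex.re_ofReal_mul]
  split_ifs <;> ring

theorem Je_diag (H : JH h M C0) {ζ : ℂ} (hz : ζ ∈ unitDisk) : (Je h ζ ζ).re ≤ 3 * M := by
  rw [Je_re H ζ hz]
  have h0 := mem_D.1 hz
  calc _ ≤ ∫ w in unitDisk, (h w + 2 * (1 - ‖ζ‖ ^ 2) * (h w / ‖1 - conj w * ζ‖ ^ 2)) := by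
        refine setIntegral_mono_on (Je_re_int H ζ hz) (H.int.add ((tau_int H hz).const_mul _)) meas_D fun w hw => ?_
        have hd := den_pos hw hz
        have hh := H.nn w
        have hz0 := norm_nonneg ζ
        have h2 : 2 * (1 - ‖ζ‖ ^ 2) * (h w / ‖1 - conj w * ζ‖ ^ 2) = h w * (2 * (1 - ‖ζ‖ ^ 2) / ‖1 - conj w * ζ‖ ^ 2) := by ring
        rw [h2]
        split_ifs with hw'
        · rw [mul_add, mul_one]
          gcongr
          rw [norm_mul, RCLike.norm_conj, mul_pow]
          have : (‖ζ‖ ^ 2) * ‖ζ‖ ^ 2 ≤ ‖w‖ ^ 2 * ‖ζ‖ ^ 2 := by gcongr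
          nlinarith [sq_nonneg (1 - ‖ζ‖ ^ 2)]
        · rw [zero_mul]
          have : 0 ≤ 1 - ‖ζ‖ ^ 2 := by nlinarith
          positivity
    _ = (∫ w in unitDisk, h w) + 2 * ((1 - ‖ζ‖ ^ 2) * tau h ζ) := by
        rw [integral_add H.int ((tau_int H hz).const_mul _), integral_const_mul]
        unfold tau; ring
    _ ≤ _ := by linarith [int_h_le H, H.tau_le ζ hz]

def Jd (h : ℂ → ℝ) (z w : ℂ) : ℝ := h w * ((1 - ‖w‖ ^ 2) / ‖1 - conj w * z‖ ^ 2)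

theorem Jd_nonneg (H : JH h M C0) (z : ℂ) {w : ℂ} (hw : w ∈ unitDisk) : 0 ≤ Jd h z w := by
  have h0 := mem_D.1 hw
  have : 0 ≤ 1 - ‖w‖ ^ 2 := by nlinarith [norm_nonneg w]
  have := H.nn w
  unfold Jd; positivity

theorem Jd_meas (H : JH h M C0) (z : ℂ) : Measurable (Jd h z) := by
  have hm := H.meas
  have := measurable_conj
  unfold Jd; fun_prop

theorem Jd_int (H : JH h M C0) {z : ℂ} (hz : z ∈ unitDisk) : IntegrableOn (Jd h z) unitDisk := by
  refine Integrable.mono' (tau_int H hz) (Jd_meas H z).aestronglyMeasurable ?_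
  refine (ae_restrict_iff' meas_D).2 (ae_of_all _ fun w hw => ?_)
  rw [Real.norm_of_nonneg (Jd_nonneg H z hw)]
  unfold Jd
  rw [div_eq_mul_inv, div_eq_mul_inv]
  have := H.nn w
  gcongr
  have : 0 ≤ (‖1 - conj w * z‖ ^ 2)⁻¹ := by positivity
  nlinarith [norm_nonneg w]

theorem Je_re_ge (H : JH h M C0) (ζ : ℂ) {z : ℂ} (hz : z ∈ unitDisk) :
    ∫ w in unitDisk, (if ‖ζ‖ ≤ ‖w‖ then Jd h z w else 0) ≤ (Je h z ζ).re := by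
  rw [Je_re H ζ hz]
  have hz' := mem_D.1 hz
  refine integral_mono_of_nonneg ?_ (Je_re_int H ζ hz) ?_
  · refine (ae_restrict_iff' meas_D).2 (ae_of_all _ fun w hw => ?_)
    simp only [Pi.zero_apply]
    split_ifs
    · exact Jd_nonneg H z hw
    · exact le_rfl
  · refine (ae_restrict_iff' meas_D).2 (ae_of_all _ fun w hw => ?_)
    simp only
    split_ifs
    · unfold Jd
      have := H.nn w
      gcongr
      have h1 : (1 - ‖w‖ ^ 2) / ‖1 - conj w * z‖ ^ 2 ≤ (1 - ‖conj w * z‖ ^ 2) / ‖1 - conj w * z‖ ^ 2 := by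
        gcongr
        rw [norm_mul, RCLike.norm_conj]
        nlinarith [norm_nonneg w, norm_nonneg z]
      linarith
    · simp

theorem Je_re_nonneg (H : JH h M C0) (ζ : ℂ) {z : ℂ} (hz : z ∈ unitDisk) : 0 ≤ (Je h z ζ).re := by
  refine le_trans ?_ (Je_re_ge H ζ hz)
  refine setIntegral_nonneg meas_D fun w hw => ?_
  split_ifs
  · exact Jd_nonneg H z hw
  · exact le_rfl

theorem J_int (H : JH h M C0) {z : ℂ} (hz : z ∈ unitDisk) :
    ∫⁻ ζ in unitDisk, ENNReal.ofReal (Jd h z ζ * Real.exp (-(Je h z ζ).re)) ≤ 1 := by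
  set ν := (volume.restrict unitDisk).withDensity (fun w => ENNReal.ofReal (Jd h z w)) with hν
  have hmJ := Jd_meas H z
  have hfin : IsFiniteMeasure ν := by
    apply isFiniteMeasure_withDensity_ofReal
    exact (Jd_int H hz).2
  set m := ν.map (fun w => ‖w‖) with hm
  have hanti : Measurable fun x => m (Ici x) := by
    apply Antitone.measurable
    intro a b hab
    exact measure_mono (Ici_subset_Ici.2 hab)
  have hkey : ∫⁻ x, ENNReal.ofReal (Real.exp (-(m (Ici x)).toReal)) ∂m ≤ 1 := lem_layer m
  have hmm : Measurable fun x => ENNReal.ofReal (Real.exp (-(m (Ici x)).toReal)) :=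
    ENNReal.measurable_ofReal.comp (Real.measurable_exp.comp hanti.ennreal_toReal.neg)
  have hmm2 : Measurable fun w : ℂ => ENNReal.ofReal (Real.exp (-(m (Ici ‖w‖)).toReal)) :=
    hmm.comp measurable_norm
  rw [hm, lintegral_map (by rw [← hm]; exact hmm) measurable_norm, ← hm, hν,
    lintegral_withDensity_eq_lintegral_mul _ (by fun_prop) (by exact hmm2)] at hkey
  refine le_trans ?_ hkey
  refine setLIntegral_mono (Measurable.mul (by fun_prop) hmm2) fun ζ hζ => ?_
  simp only [Pi.mul_apply]
  rw [← ENNReal.ofReal_mul (Jd_nonneg H z hζ)]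
  have hN : (m (Ici ‖ζ‖)).toReal = ∫ w in unitDisk, (if ‖ζ‖ ≤ ‖w‖ then Jd h z w else 0) := by
    rw [hm, Measure.map_apply measurable_norm measurableSet_Ici, hν,
      withDensity_apply _ (measurable_norm measurableSet_Ici),
      ← lintegral_indicator (measurable_norm measurableSet_Ici),
      integral_eq_lintegral_of_nonneg_ae]
    · congr 2; ext w
      simp only [indicator, mem_preimage, mem_Ici]
      split_ifs <;> simp
    · refine (ae_restrict_iff' meas_D).2 (ae_of_all _ fun w hw => ?_)
      simp only [Pi.zero_apply]
      split_ifs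
      · exact Jd_nonneg H z hw
      · exact le_rfl
    · refine Measurable.aestronglyMeasurable ?_
      exact Measurable.ite (measurableSet_le (by fun_prop) (by fun_prop)) (by fun_prop) measurable_const
  refine ENNReal.ofReal_le_ofReal (mul_le_mul_of_nonneg_left ?_ (Jd_nonneg H z hζ))
  rw [hN]
  exact Real.exp_le_exp.2 (neg_le_neg (Je_re_ge H ζ hz))

theorem Jk_diag {ζ : ℂ} (hz : ζ ∈ unitDisk) : Jk h ζ ζ = 1 := by
  unfold Jk
  have h0 := mem_D.1 hz
  have : ((1 - ‖ζ‖ ^ 2 : ℝ) : ℂ) = 1 - conj ζ * ζ := by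
    rw [← Complex.normSq_eq_conj_mul_self, Complex.normSq_eq_norm_sq]; push_cast; ring
  rw [this, div_self (den_ne hz hz)]
  simp

theorem Jk_bound (H : JH h M C0) {z ζ : ℂ} (hζ : ζ ∈ unitDisk) :
    ‖Jk h z ζ‖ ≤ (1 - ‖ζ‖ ^ 2) / ‖1 - conj ζ * z‖ * (Real.exp (3 * M) * Real.exp (-(Je h z ζ).re)) := by
  have h0 := mem_D.1 hζ
  have h1 : 0 ≤ 1 - ‖ζ‖ ^ 2 := by nlinarith [norm_nonneg ζ]
  unfold Jk
  rw [norm_mul, norm_div, Complex.norm_real, Real.norm_of_nonneg h1, Complex.norm_exp, ← Real.exp_add]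
  gcongr
  simp only [sub_re]
  linarith [Je_diag H hζ]

theorem Jk_bound2 (H : JH h M C0) {z ζ : ℂ} (hz : z ∈ unitDisk) (hζ : ζ ∈ unitDisk) :
    ‖Jk h z ζ‖ ≤ 2 * Real.exp (3 * M) := by
  refine (Jk_bound H hζ).trans ?_
  have h0 := mem_D.1 hζ
  have h1 : 0 ≤ 1 - ‖ζ‖ ^ 2 := by nlinarith [norm_nonneg ζ]
  have h2 := Je_re_nonneg H ζ hz
  have h3 : Real.exp (-(Je h z ζ).re) ≤ 1 := Real.exp_le_one_iff.2 (by linarith)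
  have h4 := den_pos hζ hz
  have h5 : (1 - ‖ζ‖ ^ 2) / ‖1 - conj ζ * z‖ ≤ 2 := by
    rw [div_le_iff₀ h4]
    have := one_sub_norm_le' (a := ζ) hz
    nlinarith [norm_nonneg ζ]
  calc _ ≤ 2 * (Real.exp (3 * M) * 1) := by gcongr
    _ = _ := by ring

theorem Jk_deriv (H : JH h M C0) {z ζ : ℂ} (hz : z ∈ unitDisk) (hζ : ζ ∈ unitDisk) :
    DifferentiableAt ℂ (fun z => Jk h z ζ) z ∧
    ‖deriv (fun z => Jk h z ζ) z‖ ≤ ‖Jk h z ζ‖ * (1 / ‖1 - conj ζ * z‖ + 2 * tau h z) := by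
  obtain ⟨h1, h2⟩ := Je_deriv H ζ hz
  have hne := den_ne hζ hz
  have hE : HasDerivAt (fun z => Complex.exp (Je h ζ ζ - Je h z ζ))
      (Complex.exp (Je h ζ ζ - Je h z ζ) * (- deriv (fun z => Je h z ζ) z)) z :=
    (h1.hasDerivAt.const_sub _).cexp
  have h3 : HasDerivAt (fun z => 1 - conj ζ * z) (- conj ζ) z := by
    simpa using ((hasDerivAt_id z).const_mul (conj ζ)).const_sub 1
  have h4 := ((hasDerivAt_const z ((1 - ‖ζ‖ ^ 2 : ℝ) : ℂ)).div h3 hne).mul hE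
  have h5 : HasDerivAt (fun z => Jk h z ζ) (Jk h z ζ * (conj ζ / (1 - conj ζ * z) - deriv (fun z => Je h z ζ) z)) z := by
    refine h4.congr_deriv ?_
    unfold Jk
    simp only [Pi.div_apply]
    generalize 1 - conj ζ * z = x at *
    field_simp
    ring
  refine ⟨h5.differentiableAt, ?_⟩
  rw [h5.deriv, norm_mul]
  gcongr
  refine (norm_sub_le _ _).trans ?_
  gcongr
  rw [norm_div, RCLike.norm_conj]
  gcongr
  exact (mem_D.1 hζ).le

end

theorem disc_lint (z : ℂ) {R : ℝ} (hR : 0 < R) :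
    ∫⁻ ζ in ball z R, ENNReal.ofReal (‖z - ζ‖⁻¹) ≤ ENNReal.ofReal (2 * π * R) := by
  have h1 : ∫⁻ ζ in ball z R, ENNReal.ofReal (‖z - ζ‖⁻¹) =
      ∫⁻ ζ, (ball (0:ℂ) R).indicator (fun ζ => ENNReal.ofReal (‖ζ‖⁻¹)) ζ := by
    rw [← lintegral_indicator measurableSet_ball,
      ← lintegral_add_left_eq_self ((ball z R).indicator fun ζ => ENNReal.ofReal (‖z - ζ‖⁻¹)) z]
    congr 1; ext ζ
    simp [indicator]
  rw [h1, ← Complex.lintegral_comp_polarCoord_symm]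
  calc _ ≤ ∫⁻ p in polarCoord.target, (Iio R ×ˢ univ).indicator (fun _ => 1) p := by
        refine setLIntegral_mono ?_ ?_
        · exact measurable_const.indicator (measurableSet_Iio.prod MeasurableSet.univ)
        · rintro ⟨r, θ⟩ hp
          have hr : 0 < r := by simp at hp; exact hp.1
          have hn : ‖Complex.polarCoord.symm (r, θ)‖ = r := by
            rw [Complex.norm_polarCoord_symm, abs_of_pos hr]
          simp only [indicator, mem_ball_zero_iff, hn, smul_eq_mul, mem_prod, mem_Iio, mem_univ, and_true]
          split_ifs
          · rw [← ENNReal.ofReal_mul hr.le, mul_inv_cancel₀ hr.ne']; simp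
          · simp
    _ = ENNReal.ofReal (2 * π * R) := by
        rw [lintegral_indicator_const (measurableSet_Iio.prod MeasurableSet.univ), one_mul,
          Measure.restrict_apply (measurableSet_Iio.prod MeasurableSet.univ), polarCoord_target, Set.prod_inter_prod,
          Measure.volume_eq_prod, Measure.prod_prod, univ_inter, Iio_inter_Ioi, Real.volume_Ioo, Real.volume_Ioo,
          ← ENNReal.ofReal_mul (by linarith)]
        congr 1; ring

theorem disc_int (z : ℂ) {R : ℝ} (hR : 0 < R) :
    IntegrableOn (fun ζ => ‖z - ζ‖⁻¹) (ball z R) ∧ ∫ ζ in ball z R, ‖z - ζ‖⁻¹ ≤ 2 * π * R := by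
  have h0 := disc_lint z hR
  have hm : Measurable (fun ζ => ‖z - ζ‖⁻¹) := by fun_prop
  have hnn : 0 ≤ᵐ[volume.restrict (ball z R)] (fun ζ => ‖z - ζ‖⁻¹) := ae_of_all _ fun ζ => by positivity
  constructor
  · refine ⟨hm.aestronglyMeasurable, ?_⟩
    rw [hasFiniteIntegral_iff_ofReal hnn]
    exact h0.trans_lt ENNReal.ofReal_lt_top
  · rw [integral_eq_lintegral_of_nonneg_ae hnn hm.aestronglyMeasurable]
    exact ENNReal.toReal_le_of_le_ofReal (by positivity) h0

def JF (h : ℂ → ℝ) (G : ℂ → ℂ) (z ζ : ℂ) : ℂ := G ζ * Jk h z ζ / (z - ζ)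

def Ju (h : ℂ → ℝ) (G : ℂ → ℂ) (z : ℂ) : ℂ := (π : ℂ)⁻¹ * ∫ ζ in unitDisk, JF h G z ζ

def nb (z : ℂ) : Set ℂ := ball z ((1 - ‖z‖) / 2)

section
variable {h : ℂ → ℝ} {M C0 : ℝ} {G : ℂ → ℂ}

theorem nb_sub {z : ℂ} (hz : z ∈ unitDisk) : nb z ⊆ unitDisk := by
  have := mem_D.1 hz
  exact ball_sub_D (by linarith)

theorem nb_meas (z : ℂ) : MeasurableSet (nb z) := measurableSet_ball

theorem JF_meas (H : JH h M C0) (hG : Measurable G) (z : ℂ) : Measurable (JF h G z) := by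
  have h2 : Measurable (fun ζ => Jk h z ζ) :=
    Measurable.comp (g := fun p : ℂ × ℂ => Jk h p.1 p.2) (f := fun ζ => (z, ζ)) (Jk_meas H)
      (measurable_const.prodMk measurable_id)
  have h3 : Measurable (fun ζ : ℂ => z - ζ) := measurable_const.sub measurable_id
  have h4 : Measurable (fun ζ => G ζ * Jk h z ζ) := hG.mul h2
  have h5 : Measurable (fun ζ => G ζ * Jk h z ζ / (z - ζ)) := h4.div h3
  have h6 : JF h G z = fun ζ => G ζ * Jk h z ζ / (z - ζ) := funext fun ζ => rfl
  rw [h6]; exact h5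

theorem far_den {z ζ : ℂ} (hz : z ∈ unitDisk) (hζ : ζ ∈ unitDisk \ nb z) :
    ‖1 - conj ζ * z‖ ≤ 5 * ‖z - ζ‖ ∧ 0 < ‖z - ζ‖ := by
  have h0 := mem_D.1 hz
  have h1 : (1 - ‖z‖) / 2 ≤ ‖z - ζ‖ := by
    have := hζ.2
    rw [nb, mem_ball, not_lt, dist_comm, dist_eq_norm] at this
    exact this
  refine ⟨?_, by linarith⟩
  have h2 : 1 - conj ζ * z = ((1 - ‖z‖ ^ 2 : ℝ) : ℂ) + z * conj (z - ζ) := by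
    have : ((‖z‖ ^ 2 : ℝ) : ℂ) = z * conj z := by
      rw [Complex.mul_conj, Complex.normSq_eq_norm_sq]
    rw [Complex.ofReal_sub, this, map_sub]; push_cast; ring
  rw [h2]
  refine (norm_add_le _ _).trans ?_
  rw [Complex.norm_real, Real.norm_of_nonneg (wt_pos hz).le, norm_mul, RCLike.norm_conj]
  nlinarith [norm_nonneg z, norm_nonneg (z - ζ)]

theorem far_pt (H : JH h M C0) (hGb : ∀ ζ ∈ unitDisk, ‖G ζ‖ ≤ 2 * h ζ) {z ζ : ℂ} (hz : z ∈ unitDisk)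
    (hζ : ζ ∈ unitDisk \ nb z) :
    ‖JF h G z ζ‖ ≤ 10 * Real.exp (3 * M) * (Jd h z ζ * Real.exp (-(Je h z ζ).re)) := by
  obtain ⟨h1, h2⟩ := far_den hz hζ
  have h3 := hGb ζ hζ.1
  have h4 := Jk_bound H (z := z) hζ.1
  have h5 := den_pos hζ.1 hz
  have h6 := wt_pos hζ.1
  have h7 := H.nn ζ
  have h8 : ‖z - ζ‖⁻¹ ≤ 5 / ‖1 - conj ζ * z‖ := by
    rw [inv_eq_one_div, div_le_div_iff₀ h2 h5]; linarith
  unfold JF Jd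
  rw [norm_div, norm_mul, div_eq_mul_inv]
  calc _ ≤ 2 * h ζ * ((1 - ‖ζ‖ ^ 2) / ‖1 - conj ζ * z‖ * (Real.exp (3 * M) * Real.exp (-(Je h z ζ).re))) *
        (5 / ‖1 - conj ζ * z‖) := by gcongr
    _ = _ := by field_simp; ring

theorem Jexp_int (H : JH h M C0) {z : ℂ} (hz : z ∈ unitDisk) :
    IntegrableOn (fun ζ => Jd h z ζ * Real.exp (-(Je h z ζ).re)) unitDisk ∧
    ∫ ζ in unitDisk, Jd h z ζ * Real.exp (-(Je h z ζ).re) ≤ 1 := by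
  have hJ := J_int H hz
  have hm : Measurable (fun ζ => Jd h z ζ * Real.exp (-(Je h z ζ).re)) := by
    have h1 := Jd_meas H z
    have h2 : Measurable (fun ζ => Je h z ζ) := (Je_meas H).comp (measurable_const.prodMk measurable_id)
    fun_prop
  have hnn : 0 ≤ᵐ[volume.restrict unitDisk] (fun ζ => Jd h z ζ * Real.exp (-(Je h z ζ).re)) :=
    (ae_restrict_iff' meas_D).2 (ae_of_all _ fun w hw => mul_nonneg (Jd_nonneg H z hw) (Real.exp_pos _).le)
  constructor
  · refine ⟨hm.aestronglyMeasurable, ?_⟩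
    rw [hasFiniteIntegral_iff_ofReal hnn]
    exact hJ.trans_lt ENNReal.one_lt_top
  · rw [integral_eq_lintegral_of_nonneg_ae hnn hm.aestronglyMeasurable]
    exact ENNReal.toReal_le_of_le_ofReal (by positivity) (by simpa using hJ)

theorem Jexp_far (H : JH h M C0) {z : ℂ} (hz : z ∈ unitDisk) :
    ∫ ζ in unitDisk \ nb z, Jd h z ζ * Real.exp (-(Je h z ζ).re) ≤ 1 := by
  refine le_trans (setIntegral_mono_set (Jexp_int H hz).1 ?_ (LE.le.eventuallyLE sdiff_subset)) (Jexp_int H hz).2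
  exact (ae_restrict_iff' meas_D).2 (ae_of_all _ fun w hw => mul_nonneg (Jd_nonneg H z hw) (Real.exp_pos _).le)

theorem far_int (H : JH h M C0) (hG : Measurable G) (hGb : ∀ ζ ∈ unitDisk, ‖G ζ‖ ≤ 2 * h ζ) {z : ℂ}
    (hz : z ∈ unitDisk) : IntegrableOn (JF h G z) (unitDisk \ nb z) ∧
      ‖∫ ζ in unitDisk \ nb z, JF h G z ζ‖ ≤ 10 * Real.exp (3 * M) := by
  have hI := ((Jexp_int H hz).1.mono_set (sdiff_subset (t := nb z))).const_mul (10 * Real.exp (3 * M))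
  have hb : ∀ᵐ ζ ∂(volume.restrict (unitDisk \ nb z)), ‖JF h G z ζ‖ ≤
      10 * Real.exp (3 * M) * (Jd h z ζ * Real.exp (-(Je h z ζ).re)) :=
    (ae_restrict_iff' (meas_D.diff (nb_meas z))).2 (ae_of_all _ fun w hw => far_pt H hGb hz hw)
  refine ⟨Integrable.mono' hI (JF_meas H hG z).aestronglyMeasurable hb, ?_⟩
  refine (norm_integral_le_of_norm_le hI hb).trans ?_
  rw [integral_const_mul]
  have := Jexp_far H hz
  have := Real.exp_pos (3 * M)
  nlinarith

theorem near_int (H : JH h M C0) (hG : Measurable G) (hGb : ∀ ζ ∈ unitDisk, ‖G ζ‖ ≤ 2 * h ζ) {z z' : ℂ}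
    (hz : z ∈ unitDisk) (hz' : z' ∈ nb z) : IntegrableOn (JF h G z') (nb z) ∧
      ‖∫ ζ in nb z, JF h G z' ζ‖ ≤ 8 * π * C0 * Real.exp (3 * M) * ((1 - ‖z‖) * tau h z) := by
  have hz1 := mem_D.1 hz
  have hδ : 0 < 1 - ‖z‖ := by linarith
  have hs : nb z ⊆ ball z' (1 - ‖z‖) := by
    intro w hw
    rw [nb, mem_ball] at *
    linarith [dist_triangle_right w z' z]
  obtain ⟨d1, d2⟩ := disc_int z' hδ
  have ht := tau_nonneg H z
  have hC := H.C00
  set K := 4 * C0 * Real.exp (3 * M) * tau h z with hK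
  have hK0 : 0 ≤ K := by positivity
  have hI := (d1.mono_set hs).const_mul K
  have hb : ∀ᵐ ζ ∂(volume.restrict (nb z)), ‖JF h G z' ζ‖ ≤ K * ‖z' - ζ‖⁻¹ := by
    refine (ae_restrict_iff' (nb_meas z)).2 (ae_of_all _ fun ζ hζ => ?_)
    have h1 := hGb ζ (nb_sub hz hζ)
    have h2 := H.sub z hz ζ hζ
    have h3 := Jk_bound2 H (nb_sub hz hz') (nb_sub hz hζ)
    unfold JF
    rw [norm_div, norm_mul, div_eq_mul_inv]
    gcongr
    calc _ ≤ (2 * (C0 * tau h z)) * (2 * Real.exp (3 * M)) := by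
          gcongr; linarith
      _ = K := by rw [hK]; ring
  refine ⟨Integrable.mono' hI (JF_meas H hG z').aestronglyMeasurable hb, ?_⟩
  refine (norm_integral_le_of_norm_le hI hb).trans ?_
  rw [integral_const_mul]
  have h5 : ∫ ζ in nb z, ‖z' - ζ‖⁻¹ ≤ 2 * π * (1 - ‖z‖) :=
    (setIntegral_mono_set d1 (ae_of_all _ fun ζ => by positivity) (LE.le.eventuallyLE hs)).trans d2
  calc _ ≤ K * (2 * π * (1 - ‖z‖)) := by gcongr
    _ = _ := by rw [hK]; ring

theorem JF_int (H : JH h M C0) (hG : Measurable G) (hGb : ∀ ζ ∈ unitDisk, ‖G ζ‖ ≤ 2 * h ζ) {z : ℂ}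
    (hz : z ∈ unitDisk) : IntegrableOn (JF h G z) unitDisk := by
  have h1 := (far_int H hG hGb hz).1
  have hz1 := mem_D.1 hz
  have h2 := (near_int H hG hGb hz (z' := z) (mem_ball_self (by linarith))).1
  have := h1.union h2
  rwa [sdiff_union_of_subset (nb_sub hz)] at this

theorem JF_split (H : JH h M C0) (hG : Measurable G) (hGb : ∀ ζ ∈ unitDisk, ‖G ζ‖ ≤ 2 * h ζ) {z z' : ℂ}
    (hz : z ∈ unitDisk) (hz' : z' ∈ unitDisk) : ∫ ζ in unitDisk, JF h G z' ζ =
      (∫ ζ in unitDisk \ nb z, JF h G z' ζ) + ∫ ζ in nb z, JF h G z' ζ := by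
  have h := JF_int H hG hGb hz'
  rw [← setIntegral_union disjoint_sdiff_left (nb_meas z) (h.mono_set sdiff_subset) (h.mono_set (nb_sub hz)),
    sdiff_union_of_subset (nb_sub hz)]

theorem pi_inv_le (x : ℂ) : ‖(π : ℂ)⁻¹ * x‖ ≤ ‖x‖ := by
  rw [norm_mul, norm_inv, Complex.norm_real, Real.norm_of_nonneg Real.pi_pos.le]
  have : π⁻¹ ≤ 1 := inv_le_one_of_one_le₀ (by linarith [Real.pi_gt_three])
  nlinarith [norm_nonneg x]

theorem delta_tau (H : JH h M C0) {z : ℂ} (hz : z ∈ unitDisk) : (1 - ‖z‖) * tau h z ≤ M := by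
  have h1 := H.tau_le z hz
  have h2 := mem_D.1 hz
  have h3 := tau_nonneg H z
  refine le_trans ?_ h1
  gcongr
  nlinarith [norm_nonneg z]

theorem Ju_bound (H : JH h M C0) (hG : Measurable G) (hGb : ∀ ζ ∈ unitDisk, ‖G ζ‖ ≤ 2 * h ζ) {z : ℂ}
    (hz : z ∈ unitDisk) : ‖Ju h G z‖ ≤ 10 * Real.exp (3 * M) + 8 * π * C0 * Real.exp (3 * M) * M := by
  refine (pi_inv_le _).trans ?_
  rw [JF_split H hG hGb hz hz]
  have hz1 := mem_D.1 hz
  have h1 := (far_int H hG hGb hz).2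
  have h2 := (near_int H hG hGb hz (z' := z) (mem_ball_self (by linarith))).2
  have h3 := delta_tau H hz
  have := H.C00
  refine (norm_add_le _ _).trans (add_le_add h1 (h2.trans ?_))
  gcongr

theorem Ju_local (H : JH h M C0) (hG : Measurable G) (hGb : ∀ ζ ∈ unitDisk, ‖G ζ‖ ≤ 2 * h ζ) {z : ℂ}
    (hz : z ∈ unitDisk) : ∃ V : ℂ → ℂ, DifferentiableOn ℂ V (ball z ((1 - ‖z‖) / 4)) ∧
      ‖V z‖ ≤ 10 * Real.exp (3 * M) ∧ ‖deriv V z‖ ≤ 140 * Real.exp (3 * M) * tau h z ∧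
      ∀ z' ∈ ball z ((1 - ‖z‖) / 4),
        ‖Ju h G z' - V z'‖ ≤ 8 * π * C0 * Real.exp (3 * M) * ((1 - ‖z‖) * tau h z) := by
  have hz1 := mem_D.1 hz
  have hδ : 0 < (1 - ‖z‖) / 4 := by linarith
  have hsub : ball z ((1 - ‖z‖) / 4) ⊆ nb z := ball_subset_ball (by linarith)
  set S := unitDisk \ nb z with hS
  have hSm : MeasurableSet S := meas_D.diff (nb_meas z)
  have hsep : ∀ ζ ∈ S, ∀ z' ∈ ball z ((1 - ‖z‖) / 4), (1 - ‖z‖) / 4 ≤ ‖z' - ζ‖ := by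
    intro ζ hζ z' hz'
    have := hζ.2
    rw [nb, mem_ball, not_lt, dist_comm] at this
    rw [mem_ball] at hz'
    rw [← dist_eq_norm]
    linarith [dist_triangle_left z ζ z']
  have hdiff : ∀ ζ ∈ S, ∀ z' ∈ ball z ((1 - ‖z‖) / 4), HasDerivAt (fun z' => JF h G z' ζ)
      (G ζ * (deriv (fun z => Jk h z ζ) z' / (z' - ζ) - Jk h z' ζ / (z' - ζ) ^ 2)) z' := by
    intro ζ hζ z' hz'
    have hne : z' - ζ ≠ 0 := by
      have := hsep ζ hζ z' hz'
      rw [← norm_pos_iff]; linarith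
    have h1 := (Jk_deriv H (nb_sub hz (hsub hz')) hζ.1).1.hasDerivAt
    refine ((h1.const_mul (G ζ)).div ((hasDerivAt_id z').sub_const ζ) hne).congr_deriv ?_
    simp only [id]
    field_simp
  have hmeas : ∀ z', AEStronglyMeasurable (JF h G z') (volume.restrict S) :=
    fun z' => (JF_meas H hG z').aestronglyMeasurable
  have hd : ∀ᵐ ζ ∂(volume.restrict S), DifferentiableOn ℂ (fun z' => JF h G z' ζ) (ball z ((1 - ‖z‖) / 4)) :=
    (ae_restrict_iff' hSm).2 (ae_of_all _ fun ζ hζ z' hz' =>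
      (hdiff ζ hζ z' hz').differentiableAt.differentiableWithinAt)
  have hb : ∀ᵐ ζ ∂(volume.restrict S), ∀ z' ∈ ball z ((1 - ‖z‖) / 4), ‖JF h G z' ζ‖ ≤
      2 * h ζ * (2 * Real.exp (3 * M)) / ((1 - ‖z‖) / 4) := by
    refine (ae_restrict_iff' hSm).2 (ae_of_all _ fun ζ hζ z' hz' => ?_)
    unfold JF
    rw [norm_div, norm_mul]
    have h1 := hGb ζ hζ.1
    have h2 := Jk_bound2 H (nb_sub hz (hsub hz')) hζ.1
    have h3 := H.nn ζ
    have h4 := hsep ζ hζ z' hz'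
    gcongr
  have hbi : Integrable (fun ζ => 2 * h ζ * (2 * Real.exp (3 * M)) / ((1 - ‖z‖) / 4)) (volume.restrict S) :=
    (((H.int.mono_set sdiff_subset).const_mul 2).mul_const _).div_const _
  refine ⟨fun z' => (π : ℂ)⁻¹ * ∫ ζ in S, JF h G z' ζ, ?_, ?_, ?_, ?_⟩
  · refine DifferentiableOn.const_mul ?_ _
    exact lemP_diff isOpen_ball (fun z' _ => hmeas z') hd hb hbi
  · exact (pi_inv_le _).trans (far_int H hG hGb hz).2
  · have key := (lemP hδ (fun z' _ => hmeas z') hd hb hbi).2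
    rw [(key.const_mul _).deriv]
    refine (pi_inv_le _).trans ?_
    have ht := tau_nonneg H z
    have hI1 := ((Jexp_int H hz).1.mono_set (sdiff_subset (t := nb z))).const_mul (20 * Real.exp (3 * M) * tau h z)
    have hI2 := ((tau_int H hz).mono_set (sdiff_subset (t := nb z))).const_mul (120 * Real.exp (3 * M))
    have hbd : ∀ᵐ ζ ∂(volume.restrict S), ‖deriv (fun z' => JF h G z' ζ) z‖ ≤
        20 * Real.exp (3 * M) * tau h z * (Jd h z ζ * Real.exp (-(Je h z ζ).re)) +
        120 * Real.exp (3 * M) * (h ζ / ‖1 - conj ζ * z‖ ^ 2) := by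
      refine (ae_restrict_iff' hSm).2 (ae_of_all _ fun ζ hζ => ?_)
      rw [(hdiff ζ hζ z (mem_ball_self hδ)).deriv]
      have e1 := (Jk_deriv H hz hζ.1).2
      have e2 := far_pt H hGb hz hζ
      obtain ⟨e3, e4⟩ := far_den hz hζ
      have e5 := den_pos hζ.1 hz
      have e6 := Jk_bound2 H hz hζ.1
      have e7 := hGb ζ hζ.1
      have h7 := H.nn ζ
      have e8 : ‖z - ζ‖⁻¹ ≤ 5 / ‖1 - conj ζ * z‖ := by
        rw [inv_eq_one_div, div_le_div_iff₀ e4 e5]; linarith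
      unfold JF at e2
      rw [norm_div, norm_mul] at e2
      rw [norm_mul]
      set d := ‖1 - conj ζ * z‖
      set s := ‖z - ζ‖
      set k := ‖Jk h z ζ‖
      set X := Jd h z ζ * Real.exp (-(Je h z ζ).re)
      have e9 : ‖deriv (fun z => Jk h z ζ) z / (z - ζ) - Jk h z ζ / (z - ζ) ^ 2‖ ≤
          k * (1 / d + 2 * tau h z) * s⁻¹ + k * s⁻¹ ^ 2 := by
        refine (norm_sub_le _ _).trans ?_
        rw [norm_div, norm_div, norm_pow, div_eq_mul_inv, div_eq_mul_inv, inv_pow]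
        gcongr
      calc _ ≤ ‖G ζ‖ * (k * (1 / d + 2 * tau h z) * s⁻¹ + k * s⁻¹ ^ 2) := by gcongr
        _ = 2 * tau h z * (‖G ζ‖ * k / s) + ‖G ζ‖ * k * (1 / d * s⁻¹ + s⁻¹ ^ 2) := by
            rw [div_eq_mul_inv _ s]; ring
        _ ≤ 2 * tau h z * (10 * Real.exp (3 * M) * X) + (2 * h ζ) * (2 * Real.exp (3 * M)) * (1 / d * (5 / d) + (5 / d) ^ 2) := by
            gcongr
        _ = _ := by field_simp; ring
    refine (norm_integral_le_of_norm_le (hI1.add hI2) hbd).trans ?_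
    rw [integral_add' hI1 hI2, integral_const_mul, integral_const_mul]
    have f1 := Jexp_far H hz
    have f2 : ∫ ζ in S, h ζ / ‖1 - conj ζ * z‖ ^ 2 ≤ tau h z :=
      setIntegral_mono_set (tau_int H hz) (ae_of_all _ fun ζ => div_nonneg (H.nn ζ) (by positivity))
        (LE.le.eventuallyLE sdiff_subset)
    calc _ ≤ 20 * Real.exp (3 * M) * tau h z * 1 + 120 * Real.exp (3 * M) * tau h z := by gcongr
      _ = _ := by ring
  · intro z' hz'
    unfold Ju
    simp only
    rw [← mul_sub, JF_split H hG hGb hz (nb_sub hz (hsub hz')), add_sub_cancel_left]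
    exact (pi_inv_le _).trans (near_int H hG hGb hz (hsub hz')).2

end

def cis (θ : ℝ) : ℂ := Real.cos θ + Real.sin θ * Complex.I

theorem cis_norm (θ : ℝ) : ‖cis θ‖ = 1 := by
  have := Complex.norm_polarCoord_symm (1, θ)
  rw [Complex.polarCoord_symm_apply] at this
  simp [cis] at this ⊢

theorem cis_ne (θ : ℝ) : cis θ ≠ 0 := by
  rw [← norm_pos_iff, cis_norm]; norm_num

theorem cis_cont : Continuous cis := by
  unfold cis; fun_prop

theorem cis_deriv (θ : ℝ) : HasDerivAt cis (Complex.I * cis θ) θ := by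
  have h1 := (Real.hasDerivAt_cos θ).ofReal_comp
  have h2 := ((Real.hasDerivAt_sin θ).ofReal_comp).mul_const Complex.I
  refine (h1.add h2).congr_deriv ?_
  unfold cis
  push_cast
  ring_nf
  rw [Complex.I_sq]; ring

theorem D_cis (L : ℂ →L[ℝ] ℂ) (θ : ℝ) : L (cis θ) = Real.cos θ * L 1 + Real.sin θ * L Complex.I := by
  have : cis θ = (Real.cos θ) • (1:ℂ) + (Real.sin θ) • Complex.I := by simp [cis]
  rw [this, map_add, map_smul, map_smul]
  simp

theorem D_Icis (L : ℂ →L[ℝ] ℂ) (θ : ℝ) : L (Complex.I * cis θ) = - Real.sin θ * L 1 + Real.cos θ * L Complex.I := by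
  have : Complex.I * cis θ = (-Real.sin θ) • (1:ℂ) + (Real.cos θ) • Complex.I := by
    simp [cis]; ring_nf; rw [Complex.I_sq]; ring
  rw [this, map_add, map_smul, map_smul]
  simp

theorem D_bar (L : ℂ →L[ℝ] ℂ) (θ : ℝ) :
    (L 1 + Complex.I * L Complex.I) / 2 / cis θ = (L (cis θ) + Complex.I * L (Complex.I * cis θ)) / 2 := by
  rw [div_eq_iff (cis_ne θ), D_cis, D_Icis]
  unfold cis
  have h : (Real.cos θ : ℂ) ^ 2 + (Real.sin θ : ℂ) ^ 2 = 1 := by exact_mod_cast Real.cos_sq_add_sin_sq θ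
  linear_combination (exp := 1) (-(L 1 + Complex.I * L Complex.I) / 2) * h +
    ((Real.sin θ : ℂ) ^ 2 * L 1 / 2 - (Real.sin θ : ℂ) * Real.cos θ * L Complex.I / 2) * Complex.I_sq

theorem pompeiu {v : ℂ → ℂ} {z : ℂ} {R : ℝ} (hR : 0 < R) (hc : Continuous v)
    (hs : ∀ ζ, R ≤ ‖ζ - z‖ → v ζ = 0) {Z : Set ℂ} (hZ : Z.Countable)
    (hd : ∀ ζ, ζ ∉ Z → DifferentiableAt ℝ v ζ) {K : ℝ} (hK : ∀ ζ, ‖fderiv ℝ v ζ‖ ≤ K) :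
    ∫ ζ, wderivBar v ζ / (z - ζ) = π * v z := by
  have hs' : ∀ ζ, R < ‖ζ - z‖ → fderiv ℝ v ζ = 0 := by
    intro ζ hζ
    have : v =ᶠ[nhds ζ] fun _ => 0 := by
      have ho : IsOpen {ζ : ℂ | R < ‖ζ - z‖} := isOpen_lt continuous_const (by fun_prop)
      filter_upwards [ho.mem_nhds hζ] with w hw using hs w (le_of_lt hw)
    rw [this.fderiv_eq]; simp
  set X : ℝ × ℝ → ℂ := fun p => z + p.1 * cis p.2 with hX
  have hXc : Continuous X := by
    have := cis_cont
    rw [hX]; fun_prop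
  have hXn : ∀ p : ℝ × ℝ, ‖X p - z‖ = |p.1| := by
    intro p; simp [hX, cis_norm]
  set A : ℝ × ℝ → ℂ := fun p => fderiv ℝ v (X p) (cis p.2) with hA
  set B : ℝ × ℝ → ℂ := fun p => fderiv ℝ v (X p) (Complex.I * cis p.2) with hB
  have m1 : Measurable fun p => fderiv ℝ v (X p) 1 := (measurable_fderiv_apply_const ℝ v 1).comp hXc.measurable
  have m2 : Measurable fun p => fderiv ℝ v (X p) Complex.I :=
    (measurable_fderiv_apply_const ℝ v Complex.I).comp hXc.measurable
  have hAm : Measurable A := by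
    rw [hA]; simp_rw [D_cis]; fun_prop
  have hBm : Measurable B := by
    rw [hB]; simp_rw [D_Icis]; fun_prop
  have hAb : ∀ p, ‖A p‖ ≤ K := fun p => by
    refine ((fderiv ℝ v (X p)).le_opNorm _).trans ?_
    rw [cis_norm, mul_one]; exact hK _
  have hBb : ∀ p, ‖B p‖ ≤ K := fun p => by
    refine ((fderiv ℝ v (X p)).le_opNorm _).trans ?_
    rw [norm_mul, Complex.norm_I, cis_norm, mul_one, mul_one]; exact hK _
  have hA0 : ∀ p : ℝ × ℝ, R < p.1 → A p = 0 := by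
    intro p hp
    simp only [hA]
    rw [hs' _ (by rw [hXn]; exact hp.trans_le (le_abs_self _))]; simp
  have hB0 : ∀ p : ℝ × ℝ, R < p.1 → B p = 0 := by
    intro p hp
    simp only [hB]
    rw [hs' _ (by rw [hXn]; exact hp.trans_le (le_abs_self _))]; simp
  set μ := (volume.restrict (Ioi (0:ℝ))) with hμ
  set ν := (volume.restrict (Ioo (-π) π)) with hν
  have hInteg : ∀ F : ℝ × ℝ → ℂ, Measurable F → (∀ p, ‖F p‖ ≤ K) → (∀ p : ℝ × ℝ, R < p.1 → F p = 0) →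
      Integrable F (μ.prod ν) := by
    intro F hF hFb hF0
    rw [hμ, hν, Measure.prod_restrict]
    refine IntegrableOn.of_forall_sdiff_eq_zero (s := Ioc (0:ℝ) R ×ˢ Ioo (-π) π) ?_ (measurableSet_Ioi.prod measurableSet_Ioo) ?_
    · have hfin : (volume.prod volume) (Ioc (0:ℝ) R ×ˢ Ioo (-π) π) ≠ ⊤ := by
        rw [Measure.prod_prod, Real.volume_Ioc, Real.volume_Ioo]; finiteness
      exact Measure.integrableOn_of_bounded (M := K) hfin hF.aestronglyMeasurable (ae_of_all _ hFb)
    · rintro p ⟨hp1, hp2⟩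
      apply hF0
      by_contra hcon
      exact hp2 ⟨⟨hp1.1, not_lt.1 hcon⟩, hp1.2⟩
  have hAi := hInteg A hAm hAb hA0
  have hBi := hInteg B hBm hBb hB0
  have hAint : ∫ p, A p ∂(μ.prod ν) = - (2 * π * v z) := by
    rw [integral_prod_symm _ hAi]
    have : ∀ θ, ∫ r, A (r, θ) ∂μ = - v z := by
      intro θ
      have e1 : ∫ r, A (r, θ) ∂μ = ∫ r in (0:ℝ)..R, A (r, θ) := by
        rw [intervalIntegral.integral_of_le hR.le, hμ]
        refine (setIntegral_eq_of_subset_of_forall_sdiff_eq_zero measurableSet_Ioi Ioc_subset_Ioi_self ?_)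
        rintro r ⟨hr1, hr2⟩
        apply hA0
        by_contra hcon
        exact hr2 ⟨hr1, not_lt.1 hcon⟩
      have hcd : Continuous fun r : ℝ => X (r, θ) := hXc.comp (by fun_prop)
      rw [e1, integral_eq_of_hasDerivAt_off_countable_of_le (fun r => v (X (r, θ))) _ hR.le
        (s := {r | X (r, θ) ∈ Z}) ?_ (hc.comp hcd).continuousOn ?_ ?_]
      · rw [hs (X (R, θ)) (by rw [hXn]; exact le_abs_self _)]
        simp [hX]
      · refine MapsTo.countable_of_injOn (f := fun r : ℝ => X (r, θ)) (t := Z) (fun r hr => hr) ?_ hZ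
        intro a _ b _ hab
        simp only [hX, add_right_inj] at hab
        exact_mod_cast mul_right_cancel₀ (cis_ne θ) hab
      · rintro r ⟨_, hr⟩
        have h1 : HasDerivAt (fun r : ℝ => X (r, θ)) (cis θ) r := by
          have := ((hasDerivAt_id r).ofReal_comp.mul_const (cis θ)).const_add z
          simpa [hX] using this
        exact (hd _ hr).hasFDerivAt.comp_hasDerivAt r h1
      · rw [intervalIntegrable_iff_integrableOn_Ioc_of_le hR.le]
        refine Measure.integrableOn_of_bounded (M := K) (by simp) ?_ (ae_of_all _ fun r => hAb _)
        exact (hAm.comp (measurable_id.prodMk measurable_const)).aestronglyMeasurable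
    simp_rw [this]
    rw [hν, setIntegral_const]
    simp [Real.volume_Ioo, Measure.real, ENNReal.toReal_ofReal, Real.pi_pos.le]
    left; ring
  have hBint : ∫ p, B p ∂(μ.prod ν) = 0 := by
    rw [integral_prod _ hBi]
    have : ∀ r ∈ Ioi (0:ℝ), ∫ θ, B (r, θ) ∂ν = 0 := by
      intro r hr
      have hr : 0 < r := hr
      have hle : -π ≤ π := by linarith [Real.pi_pos]
      have e1 : ∫ θ, B (r, θ) ∂ν = ∫ θ in (-π)..π, B (r, θ) := by
        rw [intervalIntegral.integral_of_le hle, hν, integral_Ioc_eq_integral_Ioo]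
      have hcd : Continuous fun θ : ℝ => X (r, θ) := hXc.comp (by fun_prop)
      have e2 : ∫ θ in (-π)..π, (r : ℂ) * B (r, θ) = v (X (r, π)) - v (X (r, -π)) := by
        refine integral_eq_of_hasDerivAt_off_countable_of_le (fun θ => v (X (r, θ))) _ hle
          (s := {θ | θ ∈ Ioo (-π) π ∧ X (r, θ) ∈ Z}) ?_ (hc.comp hcd).continuousOn ?_ ?_
        · refine MapsTo.countable_of_injOn (f := fun θ : ℝ => X (r, θ)) (t := Z) (fun r hr => hr.2) ?_ hZ
          intro a ha b hb hab
          have h1 : Complex.polarCoord.symm (r, a) = Complex.polarCoord.symm (r, b) := by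
            rw [Complex.polarCoord_symm_apply, Complex.polarCoord_symm_apply]
            simpa [hX, cis] using hab
          have := Complex.polarCoord.symm.injOn (x₁ := (r, a)) (x₂ := (r, b))
            (by simpa using ⟨hr, ha.1⟩) (by simpa using ⟨hr, hb.1⟩) h1
          simpa using this
        · rintro θ ⟨h0, hθ⟩
          have hn : X (r, θ) ∉ Z := fun h => hθ ⟨h0, h⟩
          have h1 : HasDerivAt (fun θ : ℝ => X (r, θ)) (r * (Complex.I * cis θ)) θ :=
            ((cis_deriv θ).const_mul (r : ℂ)).const_add z
          refine ((hd _ hn).hasFDerivAt.comp_hasDerivAt θ h1).congr_deriv ?_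
          simp only [hB]
          rw [← Complex.real_smul, map_smul, Complex.real_smul]
        · rw [intervalIntegrable_iff_integrableOn_Ioc_of_le hle]
          refine Integrable.const_mul ?_ _
          refine Measure.integrableOn_of_bounded (M := K) (by simp) ?_ (ae_of_all _ fun r => hBb _)
          exact (hBm.comp (measurable_const.prodMk measurable_id)).aestronglyMeasurable
      have e3 : X (r, π) = X (r, -π) := by simp [hX, cis]
      rw [e3, sub_self, intervalIntegral.integral_const_mul] at e2
      rw [e1]
      exact (mul_eq_zero.1 e2).resolve_left (by exact_mod_cast hr.ne')
    rw [hμ]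
    exact setIntegral_eq_zero_of_forall_eq_zero this
  calc _ = ∫ w, wderivBar v (z + w) / (z - (z + w)) :=
        (integral_add_left_eq_self (fun ζ => wderivBar v ζ / (z - ζ)) z).symm
    _ = ∫ p in polarCoord.target, (-(1/2) : ℂ) * (A p + Complex.I * B p) := by
        rw [← Complex.integral_comp_polarCoord_symm]
        refine setIntegral_congr_fun polarCoord.open_target.measurableSet ?_
        rintro ⟨r, θ⟩ hp
        have hr : 0 < r := by simp at hp; exact hp.1
        have hr' : (r : ℂ) ≠ 0 := by exact_mod_cast hr.ne'
        have e : Complex.polarCoord.symm (r, θ) = r * cis θ := by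
          rw [Complex.polarCoord_symm_apply]; rfl
        simp only [e]
        have e2 := D_bar (fderiv ℝ v (X (r, θ))) θ
        have e3 : wderivBar v (z + r * cis θ) / cis θ = (A (r, θ) + Complex.I * B (r, θ)) / 2 := e2
        have hcn := cis_ne θ
        rw [Complex.real_smul]
        calc _ = - (wderivBar v (z + r * cis θ) / cis θ) := by
              field_simp; ring
          _ = _ := by rw [e3]; ring
    _ = ∫ p, (-(1/2) : ℂ) * (A p + Complex.I * B p) ∂(μ.prod ν) := by
        rw [hμ, hν, Measure.prod_restrict, polarCoord_target, Measure.volume_eq_prod]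
    _ = _ := by
        rw [integral_const_mul, integral_add hAi (hBi.const_mul _), integral_const_mul, hAint, hBint]
        ring

def Ps {n : ℕ} (g : ℂ) (F : EuclideanSpace ℂ (Fin n)) (j : Fin n) : ℂ :=
  g ^ 3 * conj (F j) / ((‖F‖ ^ 2 : ℝ) : ℂ)

theorem comp_le {n : ℕ} (F : EuclideanSpace ℂ (Fin n)) (j : Fin n) : ‖F j‖ ≤ ‖F‖ :=
  PiLp.norm_apply_le F j

theorem Ps_bound {n : ℕ} {g : ℂ} {F : EuclideanSpace ℂ (Fin n)} (j : Fin n) (hg : ‖g‖ ≤ ‖F‖) :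
    ‖Ps g F j‖ ≤ ‖F‖ ^ 2 := by
  unfold Ps
  rcases eq_or_lt_of_le (norm_nonneg F) with h0 | h0
  · simp [← h0]
  · rw [norm_div, norm_mul, norm_pow, RCLike.norm_conj, Complex.norm_real, Real.norm_of_nonneg (by positivity),
      div_le_iff₀ (by positivity)]
    calc _ ≤ ‖F‖ ^ 3 * ‖F‖ := by gcongr; exact comp_le F j
      _ = _ := by ring

theorem Ps_lip_aux {n : ℕ} {g g' : ℂ} {F F' : EuclideanSpace ℂ (Fin n)} (j : Fin n) (hg : ‖g‖ ≤ ‖F‖)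
    (hg' : ‖g'‖ ≤ ‖F'‖) (hF : ‖F'‖ ≤ ‖F‖) :
    ‖Ps g F j - Ps g' F' j‖ ≤ 3 * ‖F‖ * (‖g - g'‖ + ‖F - F'‖) := by
  rcases eq_or_lt_of_le (norm_nonneg F') with h0 | h0
  · have e : Ps g' F' j = 0 := by simp [Ps, ← h0]
    have hF0 : F' = 0 := norm_eq_zero.1 h0.symm
    rw [e, sub_zero, hF0, sub_zero]
    refine (Ps_bound j hg).trans ?_
    nlinarith [norm_nonneg F, norm_nonneg (g - g')]
  · have h1 : 0 < ‖F‖ := h0.trans_le hF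
    set a := ‖F‖ with ha
    set b := ‖F'‖ with hb
    have e : Ps g F j - Ps g' F' j = (g - g') * (g ^ 2 + g * g' + g' ^ 2) * conj (F j) / ((a ^ 2 : ℝ) : ℂ)
        + g' ^ 3 * (conj ((F - F') j)) / ((a ^ 2 : ℝ) : ℂ)
        + g' ^ 3 * conj (F' j) * ((b ^ 2 - a ^ 2 : ℝ) : ℂ) / (((a ^ 2 * b ^ 2 : ℝ)) : ℂ) := by
      unfold Ps
      have ha' : (a : ℂ) ≠ 0 := by exact_mod_cast h1.ne'
      have hb' : (b : ℂ) ≠ 0 := by exact_mod_cast h0.ne'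
      rw [← ha, ← hb]
      simp only [PiLp.sub_apply, map_sub]
      push_cast
      field_simp
      ring
    have c1 := comp_le F j
    have c2 := comp_le F' j
    have c3 := comp_le (F - F') j
    have t := abs_norm_sub_norm_le F F'
    have t2 : |b ^ 2 - a ^ 2| ≤ ‖F - F'‖ * (2 * a) := by
      rw [abs_sub_comm, sq_sub_sq, abs_mul, abs_of_pos (by positivity : 0 < a + b), mul_comm]
      gcongr
      linarith
    have n1 : ‖(g - g') * (g ^ 2 + g * g' + g' ^ 2) * conj (F j) / ((a ^ 2 : ℝ) : ℂ)‖ ≤ ‖g - g'‖ * (3 * a) := by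
      rw [norm_div, norm_mul, norm_mul, RCLike.norm_conj, Complex.norm_real, Real.norm_of_nonneg (by positivity),
        div_le_iff₀ (by positivity)]
      have : ‖g ^ 2 + g * g' + g' ^ 2‖ ≤ 3 * a ^ 2 := by
        refine (norm_add₃_le).trans ?_
        rw [norm_pow, norm_pow, norm_mul]
        have : ‖g'‖ ≤ a := hg'.trans hF
        calc _ ≤ a ^ 2 + a * a + a ^ 2 := by gcongr
          _ = _ := by ring
      calc _ ≤ ‖g - g'‖ * (3 * a ^ 2) * a := by gcongr
        _ = _ := by ring
    have n2 : ‖g' ^ 3 * (conj ((F - F') j)) / ((a ^ 2 : ℝ) : ℂ)‖ ≤ a * ‖F - F'‖ := by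
      rw [norm_div, norm_mul, norm_pow, RCLike.norm_conj, Complex.norm_real, Real.norm_of_nonneg (by positivity),
        div_le_iff₀ (by positivity)]
      calc _ ≤ a ^ 3 * ‖F - F'‖ := by gcongr; exact hg'.trans hF
        _ = _ := by ring
    have n3 : ‖g' ^ 3 * conj (F' j) * ((b ^ 2 - a ^ 2 : ℝ) : ℂ) / (((a ^ 2 * b ^ 2 : ℝ)) : ℂ)‖ ≤ 2 * a * ‖F - F'‖ := by
      rw [norm_div, norm_mul, norm_mul, norm_pow, RCLike.norm_conj, Complex.norm_real, Complex.norm_real,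
        Real.norm_of_nonneg (by positivity : 0 ≤ a ^ 2 * b ^ 2), div_le_iff₀ (by positivity), Real.norm_eq_abs]
      calc _ ≤ b ^ 3 * b * (‖F - F'‖ * (2 * a)) := by gcongr
        _ = (b ^ 2 * b ^ 2) * (2 * a * ‖F - F'‖) := by ring
        _ ≤ (a ^ 2 * b ^ 2) * (2 * a * ‖F - F'‖) := by gcongr
        _ = _ := by ring
    rw [e]
    refine (norm_add₃_le).trans ?_
    nlinarith

theorem Ps_lip {n : ℕ} {g g' : ℂ} {F F' : EuclideanSpace ℂ (Fin n)} {M : ℝ} (j : Fin n) (hg : ‖g‖ ≤ ‖F‖)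
    (hg' : ‖g'‖ ≤ ‖F'‖) (hF : ‖F‖ ≤ M) (hF' : ‖F'‖ ≤ M) :
    ‖Ps g F j - Ps g' F' j‖ ≤ 3 * M * (‖g - g'‖ + ‖F - F'‖) := by
  rcases le_total ‖F'‖ ‖F‖ with h | h
  · refine (Ps_lip_aux j hg hg' h).trans ?_
    gcongr
  · rw [norm_sub_rev, norm_sub_rev g, norm_sub_rev F]
    refine (Ps_lip_aux j hg' hg h).trans ?_
    gcongr

theorem eu_norm_le {n : ℕ} (F : EuclideanSpace ℂ (Fin n)) : ‖F‖ ≤ ∑ l, ‖F l‖ := by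
  rw [EuclideanSpace.norm_eq]
  apply Real.sqrt_le_iff.2
  refine ⟨Finset.sum_nonneg fun i _ => norm_nonneg _, ?_⟩
  exact Finset.sum_sq_le_sq_sum_of_nonneg fun i _ => norm_nonneg _

/-- Wirtinger calculus -/
def WL (a b : ℂ) : ℂ →L[ℝ] ℂ :=
  a • (ContinuousLinearMap.id ℝ ℂ) + b • (Complex.conjCLE : ℂ →L[ℝ] ℂ)

theorem WL_apply (a b v : ℂ) : WL a b v = a * v + b * conj v := by
  simp [WL]

def HasW (F : ℂ → ℂ) (a b z : ℂ) : Prop := HasFDerivAt F (WL a b) z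

theorem HasW.bar {F : ℂ → ℂ} {a b z : ℂ} (h : HasW F a b z) : wderivBar F z = b := by
  unfold wderivBar
  rw [HasFDerivAt.fderiv h, WL_apply, WL_apply]
  simp only [map_one, Complex.conj_I]
  linear_combination (a - b) / 2 * Complex.I_sq

theorem HasW.of_hol {F : ℂ → ℂ} {a z : ℂ} (h : HasDerivAt F a z) : HasW F a 0 z := by
  have h1 : HasFDerivAt F _ z := h.hasFDerivAt.restrictScalars ℝ
  refine h1.congr_fderiv ?_
  ext v <;> simp [WL_apply, mul_comm]

theorem HasW.conj {F : ℂ → ℂ} {a b z : ℂ} (h : HasW F a b z) :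
    HasW (fun z => conj (F z)) (conj b) (conj a) z := by
  have h1 := (Complex.conjCLE : ℂ →L[ℝ] ℂ).hasFDerivAt.comp z h
  refine h1.congr_fderiv ?_
  ext v <;> simp [WL_apply] <;> ring

theorem HasW.mul {F G : ℂ → ℂ} {a b c d z : ℂ} (h : HasW F a b z) (h' : HasW G c d z) :
    HasW (fun z => F z * G z) (a * G z + F z * c) (b * G z + F z * d) z := by
  have h1 := HasFDerivAt.mul h h'
  refine h1.congr_fderiv ?_
  ext v <;> simp [WL_apply] <;> ring

theorem HasW.sum {n : ℕ} {F : Fin n → ℂ → ℂ} {a b : Fin n → ℂ} {z : ℂ} (h : ∀ i, HasW (F i) (a i) (b i) z) :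
    HasW (fun z => ∑ i, F i z) (∑ i, a i) (∑ i, b i) z := by
  have h1 := HasFDerivAt.fun_sum (u := Finset.univ) fun i _ => h i
  refine h1.congr_fderiv ?_
  ext v <;> simp [WL_apply, Finset.sum_add_distrib, Finset.sum_mul]

theorem HasW.inv {F : ℂ → ℂ} {a b z : ℂ} (h : HasW F a b z) (h0 : F z ≠ 0) :
    HasW (fun z => (F z)⁻¹) (-a / (F z) ^ 2) (-b / (F z) ^ 2) z := by
  have h2 : HasFDerivAt (fun w : ℂ => w⁻¹) _ (F z) := ((hasDerivAt_inv h0).hasFDerivAt.restrictScalars ℝ)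
  have h1 := h2.comp z h
  refine h1.congr_fderiv ?_
  ext v <;> simp [WL_apply] <;> ring

theorem wderivBar_meas (v : ℂ → ℂ) : Measurable (wderivBar v) := by
  unfold wderivBar
  have h1 := measurable_fderiv_apply_const ℝ v 1
  have h2 := measurable_fderiv_apply_const ℝ v Complex.I
  fun_prop

theorem wderivBar_le {v : ℂ → ℂ} {K : ℝ} {ζ : ℂ} (h : ‖fderiv ℝ v ζ‖ ≤ K) : ‖wderivBar v ζ‖ ≤ K := by
  unfold wderivBar
  have h1 := (fderiv ℝ v ζ).le_opNorm 1
  have h2 := (fderiv ℝ v ζ).le_opNorm Complex.I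
  have h3 := norm_add_le (fderiv ℝ v ζ 1) (Complex.I * fderiv ℝ v ζ Complex.I)
  rw [norm_mul, Complex.norm_I] at h3
  rw [Complex.norm_I] at h2
  rw [norm_one] at h1
  rw [norm_div, Complex.norm_ofNat]
  linarith

theorem wderivBar_congr {v w : ℂ → ℂ} {ζ : ℂ} (h : v =ᶠ[nhds ζ] w) : wderivBar v ζ = wderivBar w ζ := by
  unfold wderivBar
  rw [h.fderiv_eq]

theorem cutoff {z0 : ℂ} {r K A : ℝ} (hr : 0 < r) {ψ : ℂ → ℂ} {Z : Set ℂ} (hA : ∀ ζ ∈ ball z0 (4 * r), ‖ψ ζ‖ ≤ A)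
    (hK : 0 ≤ K)
    (hL : ∀ x ∈ ball z0 (4 * r), ∀ y ∈ ball z0 (4 * r), ‖ψ x - ψ y‖ ≤ K * ‖x - y‖)
    (hd : ∀ ζ ∈ ball z0 (4 * r), ζ ∉ Z → DifferentiableAt ℝ ψ ζ) :
    ∃ (v : ℂ → ℂ) (K' : ℝ), 0 ≤ K' ∧ Continuous v ∧ (∀ ζ, 3 * r ≤ ‖ζ - z0‖ → v ζ = 0) ∧
      (∀ ζ, ζ ∉ Z → DifferentiableAt ℝ v ζ) ∧ (∀ ζ, ‖fderiv ℝ v ζ‖ ≤ K') ∧ (∀ ζ ∈ ball z0 (2 * r), v ζ = ψ ζ) ∧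
      (∀ ζ, 3 * r < ‖ζ - z0‖ → wderivBar v ζ = 0) := by
  let χ : ContDiffBump z0 := ⟨2 * r, 3 * r, by positivity, by linarith⟩
  obtain ⟨C, hC⟩ := (χ.contDiff (n := 1)).lipschitzWith_of_hasCompactSupport χ.hasCompactSupport (by simp)
  have hA0 : 0 ≤ A := (norm_nonneg _).trans (hA z0 (mem_ball_self (by positivity)))
  set v : ℂ → ℂ := fun ζ => ((χ ζ : ℝ) : ℂ) * ψ ζ with hv
  have hz : ∀ ζ, 3 * r ≤ ‖ζ - z0‖ → v ζ = 0 := by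
    intro ζ h
    have : χ ζ = 0 := χ.zero_of_le_dist (by rw [dist_eq_norm]; exact h)
    simp [hv, this]
  have hev : ∀ ζ, 3 * r < ‖ζ - z0‖ → v =ᶠ[nhds ζ] fun _ => 0 := by
    intro ζ h
    have : IsOpen {ζ : ℂ | 3 * r < ‖ζ - z0‖} := isOpen_lt continuous_const (by fun_prop)
    filter_upwards [this.mem_nhds h] with x hx using hz x (le_of_lt hx)
  have hlip : ∀ x ∈ ball z0 (4 * r), ∀ y ∈ ball z0 (4 * r), ‖v x - v y‖ ≤ (C * A + K) * ‖x - y‖ := by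
    intro x hx y hy
    have e : v x - v y = ((χ x - χ y : ℝ) : ℂ) * ψ x + ((χ y : ℝ) : ℂ) * (ψ x - ψ y) := by
      simp only [hv]; push_cast; ring
    rw [e]
    refine (norm_add_le _ _).trans ?_
    rw [norm_mul, norm_mul, Complex.norm_real, Complex.norm_real]
    have h1 := hC.dist_le_mul x y
    rw [dist_eq_norm, dist_eq_norm] at h1
    have h2 : ‖χ y‖ ≤ 1 := by
      rw [Real.norm_of_nonneg χ.nonneg]; exact χ.le_one
    calc _ ≤ (C * ‖x - y‖) * A + 1 * (K * ‖x - y‖) := by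
          gcongr
          · exact hA x hx
          · exact hL x hx y hy
      _ = _ := by ring
  have hout : ∀ ζ, ζ ∉ ball z0 (4 * r) → 3 * r < ‖ζ - z0‖ := by
    intro ζ h
    rw [mem_ball, dist_eq_norm, not_lt] at h
    linarith
  have hK' : 0 ≤ C * A + K := by positivity
  have hfin : ∀ ζ, ‖fderiv ℝ v ζ‖ ≤ C * A + K := by
    intro ζ
    by_cases h : ζ ∈ ball z0 (4 * r)
    · refine norm_fderiv_le_of_lip' ℝ hK' ?_
      filter_upwards [isOpen_ball.mem_nhds h] with x hx using hlip x hx ζ h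
    · rw [(hev ζ (hout ζ h)).fderiv_eq]; simpa using hK'
  refine ⟨v, C * A + K, hK', ?_, hz, ?_, hfin, ?_, ?_⟩
  · rw [continuous_iff_continuousAt]
    intro ζ
    by_cases h : ζ ∈ ball z0 (4 * r)
    · have : LipschitzOnWith ⟨_, hK'⟩ v (ball z0 (4 * r)) := by
        refine LipschitzOnWith.of_dist_le_mul fun x hx y hy => ?_
        rw [dist_eq_norm, dist_eq_norm]; exact hlip x hx y hy
      exact this.continuousOn.continuousAt (isOpen_ball.mem_nhds h)
    · exact (continuousAt_const (y := (0 : ℂ))).congr (hev ζ (hout ζ h)).symm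
  · intro ζ hZ
    by_cases h : ζ ∈ ball z0 (4 * r)
    · have h1 : DifferentiableAt ℝ (fun ζ => ((χ ζ : ℝ) : ℂ)) ζ :=
        Complex.ofRealCLM.differentiableAt.comp ζ ((χ.contDiff (n := 1)).differentiable (by simp) ζ)
      exact h1.mul (hd ζ h hZ)
    · exact (hev ζ (hout ζ h)).differentiableAt_iff.2 (differentiableAt_const _)
  · intro ζ h
    have : χ ζ = 1 := χ.one_of_mem_closedBall (ball_subset_closedBall h)
    simp [hv, this]
  · intro ζ h
    have := hev ζ h
    rw [wderivBar_congr this]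
    simp [wderivBar]

theorem dslope_bd {q : ℂ → ℂ} {z0 : ℂ} {r b : ℝ} (hr : 0 < r) (hq : DifferentiableOn ℂ q (ball z0 (4 * r)))
    (hb : ∀ z ∈ ball z0 (4 * r), ‖q z‖ ≤ b) {ζ z : ℂ} (hζ : ζ ∈ ball z0 (2 * r)) (hz : z ∈ ball z0 (2 * r)) :
    ‖dslope q ζ z‖ ≤ b / r := by
  have hder : ∀ x ∈ ball z0 (2 * r), ‖deriv q x‖ ≤ b / r := by
    intro x hx
    have hs : ball x (2 * r) ⊆ ball z0 (4 * r) := by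
      refine ball_subset_ball' ?_
      rw [mem_ball] at hx
      linarith
    have := norm_deriv_le_div_of_mapsTo_ball (c := x) (R₁ := 2 * r) (R₂ := 2 * b) (hq.mono hs) (fun y hy => ?_) (by positivity)
    · refine this.trans_eq ?_
      field_simp
    · rw [mem_closedBall, dist_eq_norm]
      refine (norm_sub_le _ _).trans ?_
      have := hb y (hs hy)
      have := hb x (hs (mem_ball_self (by positivity)))
      linarith
  by_cases h : z = ζ
  · rw [h, dslope_same]; exact hder ζ hζ
  · rw [dslope_of_ne _ h, slope_def_field, norm_div, div_le_iff₀ (norm_pos_iff.2 (sub_ne_zero.2 h))]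
    refine (convex_ball z0 (2 * r)).norm_image_sub_le_of_norm_deriv_le (fun x hx => ?_) hder hζ hz
    exact hq.differentiableAt (isOpen_ball.mem_nhds (ball_subset_ball (by linarith) hx))

theorem bar_int {w : ℂ → ℂ} (hw : Measurable w) {K : ℝ} (hK : ∀ ζ, ‖w ζ‖ ≤ K) {z : ℂ} {R : ℝ} (hR : 0 < R)
    (hs : ∀ ζ, R ≤ ‖ζ - z‖ → w ζ = 0) : Integrable w ∧ Integrable (fun ζ => w ζ / (z - ζ)) := by
  have hz : ∀ ζ, ζ ∉ ball z R → w ζ = 0 := fun ζ h => hs ζ (by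
    rw [mem_ball, dist_eq_norm, not_lt] at h; exact h)
  constructor
  · rw [← integrableOn_iff_integrable_of_support_subset (s := ball z R)]
    · exact Measure.integrableOn_of_bounded (M := K) measure_ball_lt_top.ne hw.aestronglyMeasurable
        (ae_of_all _ hK)
    · intro ζ h
      by_contra h'
      exact h (hz ζ h')
  · rw [← integrableOn_iff_integrable_of_support_subset (s := ball z R)]
    · refine Integrable.mono' ((disc_int z hR).1.const_mul K) (Measurable.aestronglyMeasurable (by fun_prop)) (ae_of_all _ fun ζ => ?_)
      rw [norm_div, div_eq_mul_inv]
      gcongr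
      exact hK ζ
    · intro ζ h
      by_contra h'
      exact h (by simp [hz ζ h'])

theorem hol_local {z0 : ℂ} {r K A : ℝ} (hr : 0 < r) {ψ : ℂ → ℂ} {Z : Set ℂ} (hZ : Z.Countable)
    (hA : ∀ ζ ∈ ball z0 (4 * r), ‖ψ ζ‖ ≤ A) (hK : 0 ≤ K)
    (hL : ∀ x ∈ ball z0 (4 * r), ∀ y ∈ ball z0 (4 * r), ‖ψ x - ψ y‖ ≤ K * ‖x - y‖)
    (hd : ∀ ζ ∈ ball z0 (4 * r), ζ ∉ Z → DifferentiableAt ℝ ψ ζ)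
    {D : Set ℂ} (hD : MeasurableSet D) (hDs : ball z0 (4 * r) ⊆ D)
    {Q : ℂ → ℂ → ℂ} {b : ℂ → ℝ} (hb : IntegrableOn b D)
    (hQm : ∀ z, Measurable (Q z)) (hQmd : Measurable (fun ζ => Q ζ ζ))
    (hQd : ∀ ζ ∈ D, DifferentiableOn ℂ (fun z => Q z ζ) (ball z0 (4 * r)))
    (hQb : ∀ ζ ∈ D, ∀ z ∈ ball z0 (4 * r), ‖Q z ζ‖ ≤ b ζ)
    (hQi : ∀ z ∈ ball z0 r, IntegrableOn (fun ζ => Q z ζ / (z - ζ)) D)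
    (hbar : ∀ ζ ∈ ball z0 (4 * r), ζ ∉ Z → wderivBar ψ ζ = - Q ζ ζ) :
    DifferentiableOn ℂ (fun z => π * ψ z + ∫ ζ in D, Q z ζ / (z - ζ)) (ball z0 r) := by
  obtain ⟨v, K', hK', vc, vs, vd, vK, vψ, vb⟩ := cutoff hr hA hK hL hd
  set B := ball z0 (2 * r) with hB
  have hBm : MeasurableSet B := measurableSet_ball
  have hBD : B ⊆ D := (ball_subset_ball (by linarith)).trans hDs
  have hB4 : B ⊆ ball z0 (4 * r) := ball_subset_ball (by linarith)
  have hrB : ball z0 r ⊆ B := ball_subset_ball (by linarith)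
  have hZ0 : volume Z = 0 := hZ.measure_zero _
  have hfar : ∀ z ∈ ball z0 r, ∀ ζ, ζ ∉ B → r ≤ ‖z - ζ‖ := by
    intro z hz ζ hζ
    rw [mem_ball, dist_eq_norm] at hz
    rw [hB, mem_ball, dist_eq_norm, not_lt] at hζ
    have : ‖ζ - z0‖ ≤ ‖z - ζ‖ + ‖z - z0‖ := by
      rw [norm_sub_rev z ζ]
      exact norm_sub_le_norm_sub_add_norm_sub ζ z z0
    linarith
  have wm := wderivBar_meas v
  have wK : ∀ ζ, ‖wderivBar v ζ‖ ≤ K' := fun ζ => wderivBar_le (vK ζ)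
  have wI := bar_int wm wK (z := z0) (R := 4 * r) (by positivity) (fun ζ h => vb ζ (by linarith))
  have bB : IntegrableOn b B := hb.mono_set hBD
  have h3 : ∀ z ∈ ball z0 r, ∀ᵐ ζ ∂(volume.restrict B),
      dslope (fun z => Q z ζ) ζ z = Q z ζ / (z - ζ) - Q ζ ζ / (z - ζ) := by
    intro z hz
    have : ∀ᵐ ζ ∂(volume.restrict B), ζ ≠ z := by
      refine ae_restrict_of_ae ?_
      exact (measure_singleton z : volume ({z} : Set ℂ) = 0) |> compl_mem_ae_iff.2
    filter_upwards [this] with ζ hζ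
    rw [dslope_of_ne _ hζ.symm, slope_def_field, sub_div]
  -- decomposition
  have key : ∀ z ∈ ball z0 r, π * ψ z + ∫ ζ in D, Q z ζ / (z - ζ) =
      (∫ ζ in Bᶜ, wderivBar v ζ / (z - ζ)) + (∫ ζ in D \ B, Q z ζ / (z - ζ))
        + ∫ ζ in B, dslope (fun z => Q z ζ) ζ z := by
    intro z hz
    have hz' := hz
    rw [mem_ball, dist_eq_norm] at hz'
    have p1 := pompeiu (z := z) (R := 4 * r) (by positivity) vc (fun ζ h => vs ζ (by
      have := norm_sub_le_norm_sub_add_norm_sub ζ z0 z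
      rw [norm_sub_rev z0 z] at this
      linarith)) hZ vd vK
    have i1 := (bar_int wm wK (z := z) (R := 5 * r) (by positivity) (fun ζ h => vb ζ (by
      have := norm_sub_le_norm_sub_add_norm_sub ζ z0 z
      rw [norm_sub_rev z0 z] at this
      linarith))).2
    have i2 := hQi z hz
    rw [← vψ z (hrB hz), ← p1, ← integral_add_compl hBm i1]
    have e1 : ∫ ζ in D, Q z ζ / (z - ζ) = (∫ ζ in D \ B, Q z ζ / (z - ζ)) + ∫ ζ in B, Q z ζ / (z - ζ) := by
      rw [← setIntegral_union disjoint_sdiff_left hBm (i2.mono_set sdiff_subset) (i2.mono_set hBD),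
        sdiff_union_of_subset hBD]
    have e2 : ∫ ζ in B, dslope (fun z => Q z ζ) ζ z
        = (∫ ζ in B, Q z ζ / (z - ζ)) + ∫ ζ in B, wderivBar v ζ / (z - ζ) := by
      rw [← integral_add (i2.mono_set hBD) i1.integrableOn]
      refine integral_congr_ae ?_
      have hZae : ∀ᵐ ζ ∂(volume.restrict B), ζ ∉ Z := ae_restrict_of_ae (compl_mem_ae_iff.2 hZ0)
      filter_upwards [h3 z hz, hZae, ae_restrict_mem hBm] with ζ h1 h2 h4
      rw [h1]
      have : wderivBar v ζ = - Q ζ ζ := by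
        rw [← hbar ζ (hB4 h4) h2]
        refine wderivBar_congr ?_
        filter_upwards [isOpen_ball.mem_nhds h4] with x hx using vψ x hx
      rw [this]; ring
    rw [e1, e2]; ring
  refine DifferentiableOn.congr ?_ key
  refine (DifferentiableOn.add ?_ ?_).add ?_
  · refine lemP_diff (b := fun ζ => ‖wderivBar v ζ‖ / r) isOpen_ball (fun z hz => Measurable.aestronglyMeasurable (by fun_prop)) ?_ ?_ ?_
    · refine (ae_restrict_iff' hBm.compl).2 (ae_of_all _ fun ζ hζ z hz => ?_)
      have : z - ζ ≠ 0 := norm_pos_iff.1 (hr.trans_le (hfar z hz ζ hζ))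
      have hs : DifferentiableAt ℂ (fun z : ℂ => z - ζ) z := by fun_prop
      exact DifferentiableAt.differentiableWithinAt ((differentiableAt_const (wderivBar v ζ)).fun_div hs this)
    · refine (ae_restrict_iff' hBm.compl).2 (ae_of_all _ fun ζ hζ z hz => ?_)
      rw [norm_div]
      gcongr
      exact hfar z hz ζ hζ
    · exact (wI.1.norm.div_const r).integrableOn
  · refine lemP_diff (b := fun ζ => b ζ / r) isOpen_ball (fun z hz => Measurable.aestronglyMeasurable ?_) ?_ ?_ ?_
    · have := hQm z
      fun_prop
    · refine (ae_restrict_iff' (hD.diff hBm)).2 (ae_of_all _ fun ζ hζ z hz => ?_)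
      have : z - ζ ≠ 0 := norm_pos_iff.1 (hr.trans_le (hfar z hz ζ hζ.2))
      have hs : DifferentiableAt ℂ (fun z : ℂ => z - ζ) z := by fun_prop
      refine DifferentiableAt.differentiableWithinAt (DifferentiableAt.fun_div (c := fun z => Q z ζ) ?_ hs this)
      exact (hQd ζ hζ.1).differentiableAt (isOpen_ball.mem_nhds (hB4 (hrB hz)))
    · refine (ae_restrict_iff' (hD.diff hBm)).2 (ae_of_all _ fun ζ hζ z hz => ?_)
      rw [norm_div]
      have := hQb ζ hζ.1 z (hB4 (hrB hz))
      have h0 := (norm_nonneg _).trans this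
      gcongr
      exact hfar z hz ζ hζ.2
    · exact (Integrable.div_const (hb.mono_set sdiff_subset) r)
  · refine lemP_diff (b := fun ζ => b ζ / r) isOpen_ball (fun z hz => ?_) ?_ ?_ ?_
    · refine AEStronglyMeasurable.congr (f := fun ζ => Q z ζ / (z - ζ) - Q ζ ζ / (z - ζ)) (Measurable.aestronglyMeasurable ?_) ?_
      · have hs : Measurable (fun ζ : ℂ => z - ζ) := by fun_prop
        exact ((hQm z).div hs).sub (hQmd.div hs)
      · filter_upwards [h3 z hz] with ζ h using h.symm
    · refine (ae_restrict_iff' hBm).2 (ae_of_all _ fun ζ hζ => ?_)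
      refine DifferentiableOn.mono ?_ (hrB.trans hB4)
      exact (Complex.differentiableOn_dslope (isOpen_ball.mem_nhds (hB4 hζ))).2 (hQd ζ (hBD hζ))
    · refine (ae_restrict_iff' hBm).2 (ae_of_all _ fun ζ hζ z hz => ?_)
      exact dslope_bd hr (hQd ζ (hBD hζ)) (hQb ζ (hBD hζ)) hζ (hrB hz)
    · exact bB.div_const r

theorem zeros_countable {φ : ℂ → ℂ} (hφ : DifferentiableOn ℂ φ unitDisk) (h0 : ∃ z ∈ unitDisk, φ z ≠ 0) :
    {z | z ∈ unitDisk ∧ φ z = 0}.Countable := by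
  have hc : IsPreconnected unitDisk := (convex_ball (0 : ℂ) 1).isPreconnected
  rcases (hφ.analyticOnNhd isOpen_D).eqOn_zero_or_eventually_ne_zero_of_preconnected hc with h | h
  · obtain ⟨z, hz, hne⟩ := h0
    exact absurd (h hz) hne
  · have : IsDiscrete ({z | φ z = 0} ∩ unitDisk) := isDiscrete_of_codiscreteWithin (by
      filter_upwards [h] with x hx using hx)
    have := this.to_subtype
    have hcount : Countable ↑({z | φ z = 0} ∩ unitDisk) := TopologicalSpace.separableSpace_iff_countable.1 inferInstance
    refine (Set.countable_coe_iff.1 hcount).mono ?_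
    rintro z ⟨h1, h2⟩
    exact ⟨h2, h1⟩

def Fv {n : ℕ} (f : Fin n → ℂ → ℂ) (z : ℂ) : EuclideanSpace ℂ (Fin n) := WithLp.toLp 2 (fun l => f l z)

structure CH {n : ℕ} (g : ℂ → ℂ) (f : Fin n → ℂ → ℂ) (h : ℂ → ℝ) (M C0 Mb : ℝ) : Prop where
  J : JH h M C0
  gm : Measurable g
  fm : ∀ l, Measurable (f l)
  gd : DifferentiableOn ℂ g unitDisk
  fd : ∀ l, DifferentiableOn ℂ (f l) unitDisk
  size : ∀ z ∈ unitDisk, ‖g z‖ ≤ ‖Fv f z‖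
  bd : ∀ z ∈ unitDisk, ‖Fv f z‖ ≤ Mb
  dg : ∀ z ∈ unitDisk, ‖deriv g z‖ ≤ h z
  df : ∀ l, ∀ z ∈ unitDisk, ‖deriv (f l) z‖ ≤ h z
  nz : ∃ l, ∃ z ∈ unitDisk, f l z ≠ 0

def Gm {n : ℕ} (g : ℂ → ℂ) (f : Fin n → ℂ → ℂ) (j k : Fin n) (z : ℂ) : ℂ :=
  g z ^ 3 * (conj (f j z) * conj (deriv (f k) z) - conj (f k z) * conj (deriv (f j) z)) / ((‖Fv f z‖ ^ 2 : ℝ) : ℂ) ^ 2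

section
variable {n : ℕ} {g : ℂ → ℂ} {f : Fin n → ℂ → ℂ} {h : ℂ → ℝ} {M C0 Mb : ℝ}

theorem Fv_sq (f : Fin n → ℂ → ℂ) (z : ℂ) : ((‖Fv f z‖ ^ 2 : ℝ) : ℂ) = ∑ l, f l z * conj (f l z) := by
  rw [EuclideanSpace.norm_sq_eq]
  push_cast
  refine Finset.sum_congr rfl fun l _ => ?_
  rw [Complex.mul_conj, Complex.normSq_eq_norm_sq]
  simp [Fv]

theorem Fv_comp (f : Fin n → ℂ → ℂ) (z : ℂ) (l : Fin n) : ‖f l z‖ ≤ ‖Fv f z‖ := comp_le (Fv f z) l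

theorem Gm_anti (j k : Fin n) (z : ℂ) : Gm g f j k z = - Gm g f k j z := by
  unfold Gm; ring

theorem Fv_meas (H : CH g f h M C0 Mb) : Measurable (fun z => ‖Fv f z‖ ^ 2) := by
  have := H.fm
  simp only [EuclideanSpace.norm_sq_eq, Fv]
  fun_prop

theorem Gm_meas (H : CH g f h M C0 Mb) (j k : Fin n) : Measurable (Gm g f j k) := by
  have h1 := Fv_meas H
  have h2 : ∀ l, Measurable fun z => conj (f l z) := fun l => measurable_conj.comp (H.fm l)
  have h3 : ∀ l, Measurable fun z => conj (deriv (f l) z) := fun l => measurable_conj.comp (measurable_deriv _)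
  have h4 : Measurable fun z => ((‖Fv f z‖ ^ 2 : ℝ) : ℂ) := Complex.measurable_ofReal.comp h1
  exact ((H.gm.pow_const 3).mul (((h2 j).mul (h3 k)).sub ((h2 k).mul (h3 j)))).div (h4.pow_const 2)

theorem Gm_le (H : CH g f h M C0 Mb) (j k : Fin n) : ∀ z ∈ unitDisk, ‖Gm g f j k z‖ ≤ 2 * h z := by
  intro z hz
  unfold Gm
  have hn := H.J.nn z
  rcases eq_or_lt_of_le (norm_nonneg (Fv f z)) with h0 | h0
  · simp [← h0]; linarith
  · rw [norm_div, norm_mul, norm_pow, norm_pow, Complex.norm_real, Real.norm_of_nonneg (by positivity), div_le_iff₀ (by positivity)]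
    set a := ‖Fv f z‖
    have e : ‖conj (f j z) * conj (deriv (f k) z) - conj (f k z) * conj (deriv (f j) z)‖ ≤ a * h z + a * h z := by
      refine (norm_sub_le _ _).trans ?_
      rw [norm_mul, norm_mul, RCLike.norm_conj, RCLike.norm_conj, RCLike.norm_conj, RCLike.norm_conj]
      gcongr
      · exact Fv_comp f z j
      · exact H.df k z hz
      · exact Fv_comp f z k
      · exact H.df j z hz
    calc _ ≤ a ^ 3 * (a * h z + a * h z) := by
          gcongr
          exact H.size z hz
      _ = _ := by ring

theorem psi_W (H : CH g f h M C0 Mb) (j : Fin n) {z : ℂ} (hz : z ∈ unitDisk) (h0 : ‖Fv f z‖ ≠ 0) :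
    DifferentiableAt ℝ (fun z => Ps (g z) (Fv f z) j) z ∧
    wderivBar (fun z => Ps (g z) (Fv f z) j) z = - ∑ k, f k z * Gm g f j k z := by
  have hdl : ∀ l, HasW (f l) (deriv (f l) z) 0 z := fun l =>
    HasW.of_hol ((H.fd l).differentiableAt (isOpen_D.mem_nhds hz)).hasDerivAt
  have hdg : HasW g (deriv g z) 0 z := HasW.of_hol (H.gd.differentiableAt (isOpen_D.mem_nhds hz)).hasDerivAt
  have hS := HasW.sum fun l => (hdl l).mul (hdl l).conj
  have hs0 : (∑ l, f l z * conj (f l z)) ≠ 0 := by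
    rw [← Fv_sq]
    exact_mod_cast pow_ne_zero 2 h0
  have hI := hS.inv hs0
  have hT := (((hdg.mul hdg).mul hdg).mul (hdl j).conj).mul hI
  have e : (fun z => Ps (g z) (Fv f z) j) = fun z => g z * g z * g z * conj (f j z) * (∑ l, f l z * conj (f l z))⁻¹ := by
    funext w
    rw [← Fv_sq]
    unfold Ps
    rw [div_eq_mul_inv]
    simp only [Fv]
    ring
  rw [e]
  refine ⟨HasFDerivAt.differentiableAt hT, ?_⟩
  rw [hT.bar]
  have : ∀ k, f k z * Gm g f j k z = g z ^ 3 / (∑ l, f l z * conj (f l z)) ^ 2 * conj (f j z) * (f k z * conj (deriv (f k) z))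
     - g z ^ 3 / (∑ l, f l z * conj (f l z)) ^ 2 * conj (deriv (f j) z) * (f k z * conj (f k z)) := by
    intro k
    unfold Gm
    rw [Fv_sq]
    ring
  simp only [this, Finset.sum_sub_distrib, ← Finset.mul_sum]
  simp only [mul_zero, zero_mul, add_zero, zero_add]
  field_simp
  ring

theorem psi_lip (H : CH g f h M C0 Mb) (j : Fin n) {z0 : ℂ} (hz : z0 ∈ unitDisk) :
    ∀ x ∈ nb z0, ∀ y ∈ nb z0, ‖Ps (g x) (Fv f x) j - Ps (g y) (Fv f y) j‖
      ≤ (3 * Mb * (n + 1) * C0 * tau h z0) * ‖x - y‖ := by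
  intro x hx y hy
  have hs := nb_sub hz
  have hMb : 0 ≤ Mb := (norm_nonneg _).trans (H.bd z0 hz)
  refine (Ps_lip j (H.size x (hs hx)) (H.size y (hs hy)) (H.bd x (hs hx)) (H.bd y (hs hy))).trans ?_
  have mv : ∀ φ : ℂ → ℂ, DifferentiableOn ℂ φ unitDisk → (∀ z ∈ unitDisk, ‖deriv φ z‖ ≤ h z) →
      ‖φ x - φ y‖ ≤ (C0 * tau h z0) * ‖x - y‖ := by
    intro φ h1 h2
    refine (convex_ball z0 _).norm_image_sub_le_of_norm_deriv_le (fun w hw => ?_) (fun w hw => ?_) hy hx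
    · exact h1.differentiableAt (isOpen_D.mem_nhds (hs hw))
    · exact (h2 w (hs hw)).trans (H.J.sub z0 hz w hw)
  have m1 := mv g H.gd H.dg
  have m2 : ‖Fv f x - Fv f y‖ ≤ n * ((C0 * tau h z0) * ‖x - y‖) := by
    refine (eu_norm_le _).trans ?_
    calc _ ≤ ∑ l : Fin n, ((C0 * tau h z0) * ‖x - y‖) := by
          refine Finset.sum_le_sum fun l _ => ?_
          exact mv (f l) (H.fd l) (H.df l)
      _ = _ := by simp
  calc _ ≤ 3 * Mb * ((C0 * tau h z0) * ‖x - y‖ + n * ((C0 * tau h z0) * ‖x - y‖)) := by gcongr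
    _ = _ := by ring

def gj (g : ℂ → ℂ) (f : Fin n → ℂ → ℂ) (h : ℂ → ℝ) (j : Fin n) (z : ℂ) : ℂ :=
  Ps (g z) (Fv f z) j + ∑ k, f k z * Ju h (Gm g f j k) z

theorem gj_sum (H : CH g f h M C0 Mb) {z : ℂ} (hz : z ∈ unitDisk) : ∑ j, f j z * gj g f h j z = g z ^ 3 := by
  unfold gj
  simp only [mul_add, Finset.sum_add_distrib]
  have anti : ∀ j k, Ju h (Gm g f j k) z = - Ju h (Gm g f k j) z := by
    intro j k
    unfold Ju
    rw [← mul_neg, ← integral_neg]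
    congr 2
    funext ζ
    unfold JF
    rw [Gm_anti]; ring
  have e2 : ∑ j, f j z * ∑ k, f k z * Ju h (Gm g f j k) z = 0 := by
    have : ∑ j, f j z * ∑ k, f k z * Ju h (Gm g f j k) z = - ∑ j, f j z * ∑ k, f k z * Ju h (Gm g f j k) z := by
      conv_lhs =>
        simp only [Finset.mul_sum]
        rw [Finset.sum_comm]
      rw [← Finset.sum_neg_distrib]
      refine Finset.sum_congr rfl fun j _ => ?_
      rw [Finset.mul_sum, ← Finset.sum_neg_distrib]
      refine Finset.sum_congr rfl fun k _ => ?_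
      rw [anti]; ring
    exact self_eq_neg.1 this
  rw [e2, add_zero]
  have e1 : ∀ j, f j z * Ps (g z) (Fv f z) j = (g z ^ 3 / ((‖Fv f z‖ ^ 2 : ℝ) : ℂ)) * (f j z * conj (f j z)) := by
    intro j
    unfold Ps
    simp only [Fv]
    ring
  simp only [e1, ← Finset.mul_sum, ← Fv_sq]
  by_cases h0 : ‖Fv f z‖ = 0
  · have := H.size z hz
    rw [h0] at this
    simp [norm_le_zero_iff.1 this]
  · have : ((‖Fv f z‖ ^ 2 : ℝ) : ℂ) ≠ 0 := by exact_mod_cast pow_ne_zero 2 h0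
    field_simp

theorem gj_hol (H : CH g f h M C0 Mb) (j : Fin n) : DifferentiableOn ℂ (gj g f h j) unitDisk := by
  intro z0 hz0
  have hz1 := mem_D.1 hz0
  set r := (1 - ‖z0‖) / 8 with hr
  have hrp : 0 < r := by rw [hr]; linarith
  have h4 : ball z0 (4 * r) = nb z0 := by unfold nb; rw [hr]; congr 1; ring
  have hsub : ball z0 (4 * r) ⊆ unitDisk := h4 ▸ nb_sub hz0
  have hrD : ball z0 r ⊆ unitDisk := (ball_subset_ball (by linarith)).trans hsub
  obtain ⟨l, hl⟩ := H.nz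
  have hMb : 0 ≤ Mb := (norm_nonneg _).trans (H.bd z0 hz0)
  have hZ := zeros_countable (H.fd l) hl
  have hF0 : ∀ ζ ∈ unitDisk, ζ ∉ {z | z ∈ unitDisk ∧ f l z = 0} → ‖Fv f ζ‖ ≠ 0 := by
    intro ζ hζ hn h0
    have := Fv_comp f ζ l
    rw [h0] at this
    exact hn ⟨hζ, norm_le_zero_iff.1 this⟩
  have ht := tau_nonneg H.J z0
  have hC0 := H.J.C00
  have hJ1 : ∀ z, Measurable (fun ζ => Jk h z ζ) := fun z =>
    Measurable.comp (g := fun p : ℂ × ℂ => Jk h p.1 p.2) (f := fun ζ : ℂ => (z, ζ)) (Jk_meas H.J) (by fun_prop)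
  have hJ2 : Measurable (fun ζ => Jk h ζ ζ) :=
    Measurable.comp (g := fun p : ℂ × ℂ => Jk h p.1 p.2) (f := fun ζ : ℂ => (ζ, ζ)) (Jk_meas H.J) (by fun_prop)
  have key := hol_local (z0 := z0) (r := r) (K := 3 * Mb * (n + 1) * C0 * tau h z0) (A := Mb ^ 2) hrp
    (ψ := fun z => Ps (g z) (Fv f z) j) hZ
    (fun ζ hζ => (Ps_bound j (H.size ζ (hsub hζ))).trans (by have := H.bd ζ (hsub hζ); gcongr))
    (by positivity) (by rw [h4]; exact psi_lip H j hz0)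
    (fun ζ hζ hn => (psi_W H j (hsub hζ) (hF0 ζ (hsub hζ) hn)).1) meas_D hsub
    (Q := fun z ζ => ∑ k, f k z * (Gm g f j k ζ * Jk h z ζ))
    (b := fun ζ => (n * (Mb * (2 * (2 * Real.exp (3 * M))))) * h ζ) (H.J.int.const_mul _)
    (fun z => ?_) ?_ ?_ ?_ ?_ ?_
  · have hd : DifferentiableAt ℂ (fun z => (π : ℂ)⁻¹ * (π * Ps (g z) (Fv f z) j +
        ∫ ζ in unitDisk, (∑ k, f k z * (Gm g f j k ζ * Jk h z ζ)) / (z - ζ))) z0 :=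
      (key.differentiableAt (ball_mem_nhds z0 hrp)).const_mul _
    refine (hd.congr_of_eventuallyEq ?_).differentiableWithinAt
    filter_upwards [ball_mem_nhds z0 hrp] with z hz
    have hpi : (π : ℂ) ≠ 0 := by exact_mod_cast Real.pi_ne_zero
    rw [mul_add, ← mul_assoc, inv_mul_cancel₀ hpi, one_mul]
    unfold gj Ju
    congr 1
    have e : ∀ ζ, (∑ k, f k z * (Gm g f j k ζ * Jk h z ζ)) / (z - ζ) = ∑ k, f k z * JF h (Gm g f j k) z ζ := by
      intro ζ
      rw [Finset.sum_div]
      refine Finset.sum_congr rfl fun k _ => ?_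
      unfold JF; ring
    simp only [e]
    rw [integral_finsetSum _ fun k _ => (JF_int H.J (Gm_meas H j k) (Gm_le H j k) (hrD hz)).const_mul _, Finset.mul_sum]
    refine Finset.sum_congr rfl fun k _ => ?_
    rw [integral_const_mul]; ring
  · refine Finset.measurable_fun_sum _ fun k _ => ?_
    exact ((Gm_meas H j k).mul (hJ1 z)).const_mul _
  · refine Finset.measurable_fun_sum _ fun k _ => ?_
    exact (H.fm k).mul ((Gm_meas H j k).mul hJ2)
  · intro ζ hζ
    refine DifferentiableOn.fun_sum fun k _ => ?_
    refine ((H.fd k).mono hsub).mul (DifferentiableOn.const_mul ?_ _)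
    exact fun z hz => (Jk_deriv H.J (hsub hz) hζ).1.differentiableWithinAt
  · intro ζ hζ z hz
    refine (norm_sum_le _ _).trans ?_
    have hn := H.J.nn ζ
    calc _ ≤ ∑ k : Fin n, Mb * (2 * h ζ * (2 * Real.exp (3 * M))) := by
          refine Finset.sum_le_sum fun k _ => ?_
          rw [norm_mul, norm_mul]
          gcongr
          · exact (Fv_comp f z k).trans (H.bd z (hsub hz))
          · exact Gm_le H j k ζ hζ
          · exact Jk_bound2 H.J (hsub hz) hζ
      _ = _ := by simp; ring
  · intro z hz
    have : ∀ ζ, (∑ k, f k z * (Gm g f j k ζ * Jk h z ζ)) / (z - ζ) = ∑ k, f k z * JF h (Gm g f j k) z ζ := by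
      intro ζ
      rw [Finset.sum_div]
      refine Finset.sum_congr rfl fun k _ => ?_
      unfold JF; ring
    simp only [this]
    exact integrable_finsetSum _ fun k _ => (JF_int H.J (Gm_meas H j k) (Gm_le H j k) (hrD hz)).const_mul _
  · intro ζ hζ hn
    rw [(psi_W H j (hsub hζ) (hF0 ζ (hsub hζ) hn)).2]
    simp only [Jk_diag (hsub hζ), mul_one]

end

section
variable {n : ℕ} {g : ℂ → ℂ} {f : Fin n → ℂ → ℂ} {h : ℂ → ℝ} {M C0 Mb : ℝ}

theorem gj_bound (H : CH g f h M C0 Mb) (j : Fin n) {z : ℂ} (hz : z ∈ unitDisk) :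
    ‖gj g f h j z‖ ≤ Mb ^ 2 + n * (Mb * (10 * Real.exp (3 * M) + 8 * π * C0 * Real.exp (3 * M) * M)) := by
  have hMb : 0 ≤ Mb := (norm_nonneg _).trans (H.bd z hz)
  unfold gj
  refine (norm_add_le _ _).trans (add_le_add ?_ ?_)
  · refine (Ps_bound j (H.size z hz)).trans ?_
    have := H.bd z hz
    gcongr
  · refine (norm_sum_le _ _).trans ?_
    calc _ ≤ ∑ k : Fin n, (Mb * (10 * Real.exp (3 * M) + 8 * π * C0 * Real.exp (3 * M) * M)) := by
          refine Finset.sum_le_sum fun k _ => ?_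
          rw [norm_mul]
          gcongr
          · exact (Fv_comp f z k).trans (H.bd z hz)
          · exact Ju_bound H.J (Gm_meas H j k) (Gm_le H j k) hz
      _ = _ := by simp

theorem gj_deriv (H : CH g f h M C0 Mb) (j : Fin n) {z0 : ℂ} (hz0 : z0 ∈ unitDisk) :
    ‖deriv (gj g f h j) z0‖ ≤ ((3 * Mb * (n + 1) * C0 + 8 * (n * (Mb * (8 * π * C0 * Real.exp (3 * M)))))
      + n * (C0 * (10 * Real.exp (3 * M)) + Mb * (140 * Real.exp (3 * M)))) * tau h z0 := by
  have hMb : 0 ≤ Mb := (norm_nonneg _).trans (H.bd z0 hz0)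
  have hz1 := mem_D.1 hz0
  set δ := 1 - ‖z0‖ with hδ
  have hδ0 : 0 < δ := by rw [hδ]; linarith
  have hτ := tau_nonneg H.J z0
  set τ := tau h z0
  have hC0 := H.J.C00
  set E := 8 * π * C0 * Real.exp (3 * M) with hE
  have hE0 : 0 ≤ E := by positivity
  have hBs : ball z0 (δ / 4) ⊆ nb z0 := ball_subset_ball (by linarith)
  have hBD := hBs.trans (nb_sub hz0)
  have hc : z0 ∈ ball z0 (δ / 4) := mem_ball_self (by positivity)
  choose V Vd Vb Vd' Ve using fun k => Ju_local H.J (Gm_meas H j k) (Gm_le H j k) hz0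
  have hS : DifferentiableOn ℂ (fun z => ∑ k, f k z * V k z) (ball z0 (δ / 4)) :=
    DifferentiableOn.fun_sum fun k _ => ((H.fd k).mono hBD).mul (Vd k)
  have hg := (gj_hol H j).mono hBD
  set R : ℂ → ℂ := fun z => gj g f h j z - ∑ k, f k z * V k z with hR
  have hRd : DifferentiableOn ℂ R (ball z0 (δ / 4)) := hg.sub hS
  have hRe : ∀ z, R z = Ps (g z) (Fv f z) j + ∑ k, f k z * (Ju h (Gm g f j k) z - V k z) := by
    intro z
    simp only [hR, gj, mul_sub, Finset.sum_sub_distrib]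
    ring
  have hrest : ∀ z ∈ ball z0 (δ / 4), ‖∑ k, f k z * (Ju h (Gm g f j k) z - V k z)‖ ≤ n * (Mb * (E * (δ * τ))) := by
    intro z hz
    refine (norm_sum_le _ _).trans ?_
    calc _ ≤ ∑ k : Fin n, (Mb * (E * (δ * τ))) := by
          refine Finset.sum_le_sum fun k _ => ?_
          rw [norm_mul]
          gcongr
          · exact (Fv_comp f z k).trans (H.bd z (hBD hz))
          · exact Ve k z hz
      _ = _ := by simp
  have d1 : ‖deriv R z0‖ ≤ ((3 * Mb * (n + 1) * C0 * τ) * (δ / 4) + 2 * (n * (Mb * (E * (δ * τ))))) / (δ / 4) := by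
    refine norm_deriv_le_div_of_mapsTo_ball hRd (fun z hz => ?_) (by positivity)
    rw [mem_closedBall, dist_eq_norm, hRe, hRe, add_sub_add_comm]
    refine (norm_add_le _ _).trans (add_le_add ?_ ?_)
    · refine (psi_lip H j hz0 z (hBs hz) z0 (hBs hc)).trans ?_
      have : ‖z - z0‖ ≤ δ / 4 := by
        rw [mem_ball, dist_eq_norm] at hz; exact hz.le
      gcongr
    · refine (norm_sub_le _ _).trans ?_
      have := hrest z hz
      have := hrest z0 hc
      linarith
  have d1' : ‖deriv R z0‖ ≤ (3 * Mb * (n + 1) * C0 + 8 * (n * (Mb * E))) * τ := by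
    refine d1.trans_eq ?_
    field_simp
    ring
  have hfd : ∀ k, DifferentiableAt ℂ (f k) z0 := fun k => (H.fd k).differentiableAt (isOpen_D.mem_nhds hz0)
  have hVd : ∀ k, DifferentiableAt ℂ (V k) z0 := fun k => (Vd k).differentiableAt (isOpen_ball.mem_nhds hc)
  have d2 : ‖deriv (fun z => ∑ k, f k z * V k z) z0‖ ≤ n * ((C0 * τ) * (10 * Real.exp (3 * M)) + Mb * (140 * Real.exp (3 * M) * τ)) := by
    have : HasDerivAt (fun z => ∑ k, f k z * V k z) (∑ k, (deriv (f k) z0 * V k z0 + f k z0 * deriv (V k) z0)) z0 :=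
      HasDerivAt.fun_sum fun k _ => (hfd k).hasDerivAt.mul (hVd k).hasDerivAt
    rw [this.deriv]
    refine (norm_sum_le _ _).trans ?_
    calc _ ≤ ∑ k : Fin n, ((C0 * τ) * (10 * Real.exp (3 * M)) + Mb * (140 * Real.exp (3 * M) * τ)) := by
          refine Finset.sum_le_sum fun k _ => ?_
          refine (norm_add_le _ _).trans ?_
          rw [norm_mul, norm_mul]
          gcongr
          · exact (H.df k z0 hz0).trans (H.J.sub z0 hz0 z0 (mem_ball_self (by linarith)))
          · exact Vb k
          · exact (Fv_comp f z0 k).trans (H.bd z0 hz0)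
          · exact Vd' k
      _ = _ := by simp; ring
  have e : deriv (gj g f h j) z0 = deriv R z0 + deriv (fun z => ∑ k, f k z * V k z) z0 := by
    have a1 := hRd.differentiableAt (isOpen_ball.mem_nhds hc)
    have a2 := hS.differentiableAt (isOpen_ball.mem_nhds hc)
    rw [← deriv_fun_add a1 a2]
    congr 1
    funext z
    simp only [hR]; ring
  rw [e]
  refine (norm_add_le _ _).trans ((add_le_add d1' d2).trans_eq ?_)
  ring

end

theorem core {n : ℕ} {g : ℂ → ℂ} {f : Fin n → ℂ → ℂ} {h : ℂ → ℝ} {M C0 Mb : ℝ} (H : CH g f h M C0 Mb) :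
    ∃ (G : Fin n → ℂ → ℂ) (C : ℝ), 0 ≤ C ∧ (∀ j, DifferentiableOn ℂ (G j) unitDisk) ∧
      (∀ j, ∀ z ∈ unitDisk, ‖G j z‖ ≤ C) ∧ (∀ j, ∀ z ∈ unitDisk, ‖deriv (G j) z‖ ≤ C * tau h z) ∧
      ∀ z ∈ unitDisk, ∑ j, f j z * G j z = g z ^ 3 := by
  refine ⟨gj g f h, max (max (Mb ^ 2 + n * (Mb * (10 * Real.exp (3 * M) + 8 * π * C0 * Real.exp (3 * M) * M)))
    ((3 * Mb * (n + 1) * C0 + 8 * (n * (Mb * (8 * π * C0 * Real.exp (3 * M)))))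
      + n * (C0 * (10 * Real.exp (3 * M)) + Mb * (140 * Real.exp (3 * M))))) 0, le_max_right _ _, gj_hol H, fun j z hz => ?_, fun j z hz => ?_, fun z hz => gj_sum H hz⟩
  · exact (gj_bound H j hz).trans ((le_max_left _ _).trans (le_max_left _ _))
  · refine (gj_deriv H j hz).trans ?_
    have := tau_nonneg H.J z
    gcongr
    exact (le_max_right _ _).trans (le_max_left _ _)

theorem kap_zero (z w : ℂ) : kap 0 z w = (‖1 - conj w * z‖ ^ 2)⁻¹ := by
  unfold kap
  simp only [neg_zero, Real.rpow_zero, one_mul, mul_zero, zero_sub]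
  rw [Real.rpow_neg (norm_nonneg _)]
  norm_num

theorem submean_real {F : ℂ → ℂ} {c : ℂ} {R : ℝ} (hR : 0 ≤ R) (hF : DifferentiableOn ℂ F (ball c R))
    (hm : Measurable F) (hi : IntegrableOn F (ball c R)) :
    π * R ^ 2 * ‖F c‖ ≤ ∫ z in ball c R, ‖F z‖ := by
  have h := submean hF hm
  rw [← ofReal_integral_norm_eq_lintegral_enorm hi, Complex.volume_ball, ← ofReal_norm] at h
  have e : ENNReal.ofReal R ^ 2 * (NNReal.pi : ℝ≥0∞) * ENNReal.ofReal ‖F c‖ = ENNReal.ofReal (π * R ^ 2 * ‖F c‖) := by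
    rw [ENNReal.ofReal_mul (by positivity), ENNReal.ofReal_mul (by positivity), ENNReal.ofReal_pow hR, mul_comm (ENNReal.ofReal π)]
    congr 2
    exact (ENNReal.ofReal_coe_nnreal (p := NNReal.pi)).symm
  rw [e] at h
  exact (ENNReal.ofReal_le_ofReal_iff (integral_nonneg fun z => norm_nonneg _)).1 h

theorem JH_of {p : ℝ} (hp0 : 0 < p) (hp1 : p < 1) {ι : Type} [Fintype ι] (φ : ι → ℂ → ℂ) (hφ : ∀ i, MemMQp p (φ i)) :
    ∃ M C0 : ℝ, JH (fun z => ∑ i, ‖deriv (φ i) z‖) M C0 ∧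
      InX p (fun z => ENNReal.ofReal (∑ i, ‖deriv (φ i) z‖)) ∧
      ∀ z ∈ unitDisk, ENNReal.ofReal (tau (fun z => ∑ i, ‖deriv (φ i) z‖) z) =
        Tk 0 (fun z => ENNReal.ofReal (∑ i, ‖deriv (φ i) z‖)) z := by
  set h : ℂ → ℝ := fun z => ∑ i, ‖deriv (φ i) z‖ with hh
  have hm : Measurable h := Finset.measurable_fun_sum _ fun i _ => (measurable_deriv (φ i)).norm
  have hnn : ∀ z, 0 ≤ h z := fun z => Finset.sum_nonneg fun i _ => norm_nonneg _
  have hX : InX p (fun z => ENNReal.ofReal (h z)) := by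
    have := InX.sum (p := p) Finset.univ fun i => InX_deriv hp0 hp1 (hφ i)
    have e : (fun z => ENNReal.ofReal (h z)) = fun z => ∑ i, ‖deriv (φ i) z‖ₑ := by
      funext z
      rw [hh, ENNReal.ofReal_sum_of_nonneg fun i _ => norm_nonneg _]
      simp only [ofReal_norm]
    rw [e]; exact this
  obtain ⟨M, hM0, hM⟩ := InX_bound hp0 hp1 hX
  have hTk : ∀ z, Tk 0 (fun z => ENNReal.ofReal (h z)) z = ∫⁻ w in unitDisk, ENNReal.ofReal (h w / ‖1 - conj w * z‖ ^ 2) := by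
    intro z
    unfold Tk
    refine lintegral_congr fun w => ?_
    rw [kap_zero, ← ENNReal.ofReal_mul (by positivity)]
    congr 1
    rw [div_eq_mul_inv, mul_comm]
  have hqm : ∀ z : ℂ, Measurable (fun w => h w / ‖1 - conj w * z‖ ^ 2) := by
    intro z
    have := measurable_conj
    fun_prop
  have hqn : ∀ z w : ℂ, 0 ≤ h w / ‖1 - conj w * z‖ ^ 2 := fun z w => div_nonneg (hnn w) (by positivity)
  have hfin : ∀ z ∈ unitDisk, Tk 0 (fun z => ENNReal.ofReal (h z)) z < ⊤ := by
    intro z hz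
    by_contra hc
    rw [not_lt, top_le_iff] at hc
    have := hM z hz
    rw [hc, ENNReal.mul_top (by simpa using wt_pos hz)] at this
    simp at this
  have hqi : ∀ z ∈ unitDisk, IntegrableOn (fun w => h w / ‖1 - conj w * z‖ ^ 2) unitDisk := by
    intro z hz
    refine ⟨(hqm z).aestronglyMeasurable, ?_⟩
    rw [hasFiniteIntegral_iff_ofReal (ae_of_all _ (hqn z)), ← hTk]
    exact hfin z hz
  have htau : ∀ z ∈ unitDisk, ENNReal.ofReal (tau h z) = Tk 0 (fun z => ENNReal.ofReal (h z)) z := by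
    intro z hz
    rw [hTk]
    exact ofReal_integral_eq_lintegral_ofReal (hqi z hz) (ae_of_all _ (hqn z))
  have hInteg : IntegrableOn h unitDisk := by
    have := hqi 0 zero_mem_D
    simpa using this
  refine ⟨M, 144, ⟨hm, hnn, hInteg, hM0, by norm_num, fun z hz => ?_, fun z hz ζ hζ => ?_⟩, hX, htau⟩
  · have := hM z hz
    rw [← htau z hz, ← ENNReal.ofReal_mul (wt_pos hz).le] at this
    exact (ENNReal.ofReal_le_ofReal_iff hM0).1 this
  · have hz1 := mem_D.1 hz
    set δ := 1 - ‖z‖ with hδ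
    have hδ0 : 0 < δ := by rw [hδ]; linarith
    rw [mem_ball, dist_eq_norm] at hζ
    have hB : ball ζ (δ / 4) ⊆ unitDisk := by
      refine ball_sub_D ?_
      have := norm_sub_norm_le ζ z
      linarith
    have hder : ∀ i, Measurable (deriv (φ i)) := fun i => measurable_deriv _
    have hdi : ∀ i, IntegrableOn (deriv (φ i)) (ball ζ (δ / 4)) := by
      intro i
      refine Integrable.mono' (hInteg.mono_set hB) (hder i).aestronglyMeasurable (ae_of_all _ fun w => ?_)
      exact Finset.single_le_sum (f := fun i => ‖deriv (φ i) w‖) (fun i _ => norm_nonneg _) (Finset.mem_univ i)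
    have s1 : π * (δ / 4) ^ 2 * h ζ ≤ ∫ w in ball ζ (δ / 4), h w := by
      rw [hh, integral_finsetSum _ fun i _ => (hdi i).norm, Finset.mul_sum]
      refine Finset.sum_le_sum fun i _ => ?_
      refine submean_real (by positivity) ?_ (hder i) (hdi i)
      exact ((hφ i).1.1.deriv isOpen_D).mono hB
    have s2 : ∫ w in ball ζ (δ / 4), h w ≤ ∫ w in ball ζ (δ / 4), 9 * δ ^ 2 * (h w / ‖1 - conj w * z‖ ^ 2) := by
      refine setIntegral_mono_on (hInteg.mono_set hB) (((hqi z hz).mono_set hB).const_mul _) measurableSet_ball fun w hw => ?_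
      have hwD := hB hw
      have hd0 := den_pos hwD hz
      rw [mul_div_assoc', le_div_iff₀ (by positivity), mul_comm]
      refine mul_le_mul_of_nonneg_right ?_ (hnn w)
      have : ‖1 - conj w * z‖ ≤ 3 * δ := by
        have e : 1 - conj w * z = ((1 - ‖z‖ ^ 2 : ℝ) : ℂ) + conj (z - w) * z := by
          have := Complex.mul_conj' z
          push_cast
          rw [← this, map_sub]; ring
        rw [e]
        refine (norm_add_le _ _).trans ?_
        rw [Complex.norm_real, Real.norm_of_nonneg (wt_pos hz).le, norm_mul, RCLike.norm_conj]
        rw [mem_ball, dist_eq_norm] at hw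
        have t := norm_sub_le_norm_sub_add_norm_sub z ζ w
        rw [norm_sub_rev z ζ, norm_sub_rev ζ w] at t
        have a1 : ‖z - w‖ * ‖z‖ ≤ (3 * δ / 4) * 1 := by
          gcongr
          linarith
        have a2 : 1 - ‖z‖ ^ 2 ≤ 2 * δ := by
          rw [hδ]; nlinarith [norm_nonneg z]
        linarith
      calc _ ≤ (3 * δ) ^ 2 := by gcongr
        _ = _ := by ring
    have s3 : ∫ w in ball ζ (δ / 4), 9 * δ ^ 2 * (h w / ‖1 - conj w * z‖ ^ 2) ≤ 9 * δ ^ 2 * tau h z := by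
      rw [integral_const_mul]
      refine mul_le_mul_of_nonneg_left ?_ (by positivity)
      exact setIntegral_mono_set (hqi z hz) (ae_of_all _ (hqn z)) (LE.le.eventuallyLE hB)
    have s4 : δ ^ 2 * (π / 16 * h ζ) ≤ δ ^ 2 * (9 * tau h z) := by
      have := s1.trans (s2.trans s3)
      linarith
    have s5 := le_of_mul_le_mul_left s4 (by positivity)
    have hpi := Real.pi_gt_three
    have := hnn ζ
    nlinarith

theorem deriv_ind {φ : ℂ → ℂ} {z : ℂ} (hz : z ∈ unitDisk) : deriv (unitDisk.indicator φ) z = deriv φ z := by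
  refine Filter.EventuallyEq.deriv_eq ?_
  filter_upwards [isOpen_D.mem_nhds hz] with w hw using indicator_of_mem hw φ

theorem diff_ind {φ : ℂ → ℂ} (h : DifferentiableOn ℂ φ unitDisk) : DifferentiableOn ℂ (unitDisk.indicator φ) unitDisk :=
  h.congr fun _ hw => indicator_of_mem hw φ

theorem meas_ind {φ : ℂ → ℂ} (h : DifferentiableOn ℂ φ unitDisk) : Measurable (unitDisk.indicator φ) := by
  classical
  rw [← piecewise_eq_indicator]
  exact h.continuousOn.measurable_piecewise continuousOn_const meas_D

theorem memMQp_zero {p : ℝ} : MemMQp p (fun _ => 0) := by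
  refine ⟨memQp_const 0, fun f hf => ?_⟩
  simp only [zero_mul]
  exact memQp_const 0

theorem wolff_ideal_multiplier_Qp (p : ℝ) (hp0 : 0 < p) (hp1 : p < 1)
    (n : ℕ) (g : ℂ → ℂ) (f : Fin n → ℂ → ℂ)
    (hg : MemMQp p g) (hf : ∀ j, MemMQp p (f j))
    (hsize : ∀ z ∈ unitDisk, ‖g z‖ ≤ Real.sqrt (∑ j, ‖f j z‖ ^ 2)) :
    ∃ G : Fin n → ℂ → ℂ, (∀ j, MemMQp p (G j)) ∧
      ∀ z ∈ unitDisk, ∑ j, f j z * G j z = (g z) ^ 3 := by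
  by_cases hnz : ∃ l, ∃ z ∈ unitDisk, f l z ≠ 0
  swap
  · push Not at hnz
    refine ⟨fun _ _ => 0, fun _ => memMQp_zero, fun z hz => ?_⟩
    have h1 := hsize z hz
    have h2 : ∑ j, ‖f j z‖ ^ 2 = 0 := Finset.sum_eq_zero fun j _ => by rw [hnz j z hz]; simp
    rw [h2, Real.sqrt_zero] at h1
    rw [norm_le_zero_iff.1 h1]
    simp
  · let φ : Option (Fin n) → ℂ → ℂ := fun o => o.elim g f
    have hφ : ∀ o, MemMQp p (φ o) := by
      rintro (_ | l)
      · exact hg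
      · exact hf l
    obtain ⟨M, C0, J, hX, ht⟩ := JH_of hp0 hp1 φ hφ
    have hle : ∀ o z, ‖deriv (φ o) z‖ ≤ ∑ i, ‖deriv (φ i) z‖ := fun o z =>
      Finset.single_le_sum (f := fun i => ‖deriv (φ i) z‖) (fun i _ => norm_nonneg _) (Finset.mem_univ o)
    choose B hB0 hB using fun l => multiplier_bounded hp0 hp1 (hf l)
    have hi : ∀ (ψ : ℂ → ℂ), ∀ z ∈ unitDisk, unitDisk.indicator ψ z = ψ z := fun ψ z hz => indicator_of_mem hz ψ
    have H : CH (unitDisk.indicator g) (fun l => unitDisk.indicator (f l)) (fun z => ∑ i, ‖deriv (φ i) z‖) M C0 (∑ l, B l) := by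
      refine ⟨J, meas_ind hg.1.1, fun l => meas_ind (hf l).1.1, diff_ind hg.1.1, fun l => diff_ind (hf l).1.1, ?_, ?_, ?_, ?_, ?_⟩
      · intro z hz
        rw [EuclideanSpace.norm_eq, hi g z hz]
        simpa [Fv, hi _ z hz] using hsize z hz
      · intro z hz
        refine (eu_norm_le _).trans (Finset.sum_le_sum fun l _ => ?_)
        simpa [Fv, hi _ z hz] using hB l z hz
      · intro z hz
        rw [deriv_ind hz]
        exact hle none z
      · intro l z hz
        rw [deriv_ind hz]
        exact hle (some l) z
      · obtain ⟨l, z, hz, hne⟩ := hnz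
        exact ⟨l, z, hz, by rw [hi _ z hz]; exact hne⟩
    obtain ⟨G, C, hC, Gd, Gb, Gd', Gs⟩ := core H
    refine ⟨G, fun j => ?_, fun z hz => ?_⟩
    · refine memMQp_of (Gd j) hC (Gb j) (InX_Tk hp0 hp1 hX) (c := ENNReal.ofReal C) ENNReal.ofReal_ne_top fun z hz => ?_
      rw [← ht z hz, ← ENNReal.ofReal_mul hC, ← ofReal_norm]
      exact ENNReal.ofReal_le_ofReal (Gd' j z hz)
    · have := Gs z hz
      simpa [hi _ z hz] using this

end
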